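/- arXiv:2401.13263 — 2 statements merged into one kernel-verified Lean document; each statement's English description precedes it below -/
import Mathlib

section
/- Let 2 < p < ∞ and let Ω ⊂ ℝ² be a bounded simply connected domain. Then Ω is a local Sobolev–Poincaré imbedding domain of order p — i.e. there exist constants C ≥ 1 and λ ≥ 1 such that for every locally Lipschitz function u : Ω → ℝ, every x ∈ Ω, every 0 < r < diam(Ω) and all x₁, x₂ ∈ B(x,r) ∩ Ω, |u(x₁) − u(x₂)| ≤ C |x₁ − x₂|^{1 − 2/p} (∫_{B(x,λr)∩Ω} |∇u(y)|^p dy)^{1/p} — if and only if Ω is an α-cigar domain with α = (p − 2)/(p − 1). -/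
open Set Metric MeasureTheory ENNReal NNReal

noncomputable section

/-- Euclidean space `ℝⁿ`. -/
abbrev Euc (n : ℕ) : Type := EuclideanSpace ℝ (Fin n)

/-- `u` is locally Lipschitz on the set `Ω`. -/
def LocallyLipschitzOnSet {n : ℕ} (u : Euc n → ℝ) (Ω : Set (Euc n)) : Prop :=
  ∀ x ∈ Ω, ∃ K : ℝ≥0, ∃ s ∈ nhdsWithin x Ω, LipschitzOnWith K u s

/-- `x` and `y` are joined by a (continuous) curve lying in `S`. -/
def JoinedByCurveIn {n : ℕ} (S : Set (Euc n)) (x y : Euc n) : Prop :=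
  ∃ γ : ℝ → Euc n, ContinuousOn γ (Icc 0 1) ∧ γ 0 = x ∧ γ 1 = y ∧ MapsTo γ (Icc 0 1) S

/-- `γ` is parametrized by arclength on `[0, L]`. -/
def ArclengthOn {n : ℕ} (γ : ℝ → Euc n) (L : ℝ) : Prop :=
  ∀ s t : ℝ, 0 ≤ s → s ≤ t → t ≤ L → eVariationOn γ (Icc s t) = ENNReal.ofReal (t - s)

/-- `Ω` is an `ε₀`-uniform domain. -/
def IsUniformWith {n : ℕ} (Ω : Set (Euc n)) (ε₀ : ℝ) : Prop :=
  ∀ x ∈ Ω, ∀ y ∈ Ω, ∃ γ : ℝ → Euc n,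
    ContinuousOn γ (Icc 0 1) ∧ γ 0 = x ∧ γ 1 = y ∧ MapsTo γ (Icc 0 1) Ω ∧
    eVariationOn γ (Icc 0 1) ≤ ENNReal.ofReal (dist x y / ε₀) ∧
    ∀ t ∈ Icc (0:ℝ) 1,
      ε₀ * (dist x (γ t) * dist y (γ t)) / dist x y ≤ infDist (γ t) (frontier Ω)

/-- `Ω` is a uniform domain. -/
def IsUniformDomain {n : ℕ} (Ω : Set (Euc n)) : Prop :=
  ∃ ε₀ : ℝ, 0 < ε₀ ∧ ε₀ ≤ 1 ∧ IsUniformWith Ω ε₀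

/-- `Ω` is an `α`-cigar domain: any two points can be joined by a rectifiable
(arclength-parametrized) curve in `Ω` along which
`∫_γ dist(z, ∂Ω)^(α-1) |dz| ≤ C |x - y|^α`. -/
def IsCigarDomain {n : ℕ} (Ω : Set (Euc n)) (α : ℝ) : Prop :=
  ∃ C : ℝ, 0 < C ∧ ∀ x ∈ Ω, ∀ y ∈ Ω, ∃ L : ℝ, 0 ≤ L ∧ ∃ γ : ℝ → Euc n,
    γ 0 = x ∧ γ L = y ∧ MapsTo γ (Icc 0 L) Ω ∧ ArclengthOn γ L ∧
    (∫⁻ t in Icc (0:ℝ) L, ENNReal.ofReal (infDist (γ t) (frontier Ω) ^ (α - 1)) ∂volume)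
      ≤ ENNReal.ofReal (C * dist x y ^ α)

/-- `Ω` is a `c₀`-John domain. -/
def IsJohnDomain {n : ℕ} (Ω : Set (Euc n)) (c₀ : ℝ) : Prop :=
  ∃ x₀ ∈ Ω, ∀ x ∈ Ω, ∃ l : ℝ, 0 ≤ l ∧ ∃ γ : ℝ → Euc n,
    γ 0 = x ∧ γ l = x₀ ∧ MapsTo γ (Icc 0 l) Ω ∧ ArclengthOn γ l ∧
    ∀ t ∈ Icc (0:ℝ) l, c₀ * t ≤ infDist (γ t) (frontier Ω)

/-- `Ω` has the `C`-slice property with respect to `x₀`. -/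
def HasSliceProperty {n : ℕ} (Ω : Set (Euc n)) (C : ℝ) (x₀ : Euc n) : Prop :=
  ∀ x ∈ Ω, ∃ γ : ℝ → Euc n,
    ContinuousOn γ (Icc 0 1) ∧ γ 0 = x₀ ∧ γ 1 = x ∧ MapsTo γ (Icc 0 1) Ω ∧
    ∃ j : ℕ, ∃ U : Fin (j + 1) → Set (Euc n),
      (∀ i, IsOpen (U i) ∧ U i ⊆ Ω) ∧
      (Pairwise fun i₁ i₂ => Disjoint (U i₁) (U i₂)) ∧
      -- (1)
      x₀ ∈ U 0 ∧ x ∈ U (Fin.last j) ∧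
      (∀ i : Fin (j + 1), 0 < (i : ℕ) → (i : ℕ) < j →
        x₀ ∈ Ω \ closure (U i) ∧ x ∈ Ω \ closure (U i) ∧
        x ∉ connectedComponentIn (Ω \ closure (U i)) x₀) ∧
      -- (2)
      (∀ i : Fin (j + 1), 0 < (i : ℕ) → (i : ℕ) < j →
        ∀ γ' : ℝ → Euc n, ContinuousOn γ' (Icc 0 1) → MapsTo γ' (Icc 0 1) Ω →
          (∃ t ∈ Icc (0:ℝ) 1, γ' t = x) → (∃ t ∈ Icc (0:ℝ) 1, γ' t = x₀) →
          ENNReal.ofReal (diam (U i)) ≤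
            ENNReal.ofReal C * eVariationOn γ' {t ∈ Icc (0:ℝ) 1 | γ' t ∈ U i}) ∧
      -- (3)
      (∀ t ∈ Icc (0:ℝ) 1,
        ball (γ t) (infDist (γ t) (frontier Ω) / C) ⊆ ⋃ i, closure (U i)) ∧
      -- (4)
      (∀ i : Fin (j + 1), ∀ t ∈ Icc (0:ℝ) 1, γ t ∈ U i →
        diam (U i) ≤ C * infDist (γ t) (frontier Ω)) ∧
      (∀ i : Fin (j + 1), ∃ xi ∈ U i, (∃ t ∈ Icc (0:ℝ) 1, γ t = xi) ∧
        ((i : ℕ) = j → xi = x) ∧ ball xi (infDist xi (frontier Ω) / C) ⊆ U i)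

/-- `Ω` satisfies the slice condition. -/
def SliceCondition {n : ℕ} (Ω : Set (Euc n)) : Prop :=
  ∃ C : ℝ, 1 < C ∧ ∀ x₀ ∈ Ω, HasSliceProperty Ω C x₀

/-- `Ω` is LLC. -/
def IsLLC {n : ℕ} (Ω : Set (Euc n)) : Prop :=
  ∃ b : ℝ, 0 < b ∧ b ≤ 1 ∧ ∀ z : Euc n, ∀ r : ℝ, 0 < r →
    (∀ x ∈ Ω ∩ ball z r, ∀ y ∈ Ω ∩ ball z r, JoinedByCurveIn (Ω ∩ ball z (r / b)) x y) ∧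
    (∀ x ∈ Ω \ ball z r, ∀ y ∈ Ω \ ball z r, JoinedByCurveIn (Ω \ ball z (b * r)) x y)

/-- `Ω` is quasiconvex. -/
def IsQuasiconvex {n : ℕ} (Ω : Set (Euc n)) : Prop :=
  ∃ C : ℝ, 1 ≤ C ∧ ∀ x ∈ Ω, ∀ y ∈ Ω, ∃ γ : ℝ → Euc n,
    ContinuousOn γ (Icc 0 1) ∧ γ 0 = x ∧ γ 1 = y ∧ MapsTo γ (Icc 0 1) Ω ∧
    eVariationOn γ (Icc 0 1) ≤ ENNReal.ofReal (C * dist x y)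

/-- The intrinsic (inner) metric of `Ω` (`∞` if there is no rectifiable curve). -/
def intrinsicDist {n : ℕ} (Ω : Set (Euc n)) (x y : Euc n) : ℝ≥0∞ :=
  ⨅ (γ : ℝ → Euc n)
    (_ : ContinuousOn γ (Icc 0 1) ∧ γ 0 = x ∧ γ 1 = y ∧ MapsTo γ (Icc 0 1) Ω),
    eVariationOn γ (Icc 0 1)

/-- The intrinsic ball `B_Ω(x, r)`. -/
def intrinsicBall {n : ℕ} (Ω : Set (Euc n)) (x : Euc n) (r : ℝ) : Set (Euc n) :=
  {y ∈ Ω | intrinsicDist Ω x y < ENNReal.ofReal r}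

/-- `Ω` is intrinsic Ahlfors `n`-regular. -/
def IntrinsicAhlforsRegular {n : ℕ} (Ω : Set (Euc n)) : Prop :=
  ∃ c : ℝ, 0 < c ∧ c < 1 ∧ ∃ r₀ : ℝ, 0 < r₀ ∧ ∀ x ∈ Ω, ∀ r : ℝ, 0 < r → r < r₀ →
    ENNReal.ofReal c * volume (ball x r) ≤ volume (intrinsicBall Ω x r)

/-- `Ω` is a local Sobolev–Poincaré imbedding domain of order `p`, `1 ≤ p < n`. -/
def LocalSPLow (n : ℕ) (Ω : Set (Euc n)) (p : ℝ) : Prop :=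
  ∃ C : ℝ, 1 ≤ C ∧ ∃ lam : ℝ, 1 ≤ lam ∧
    ∀ u : Euc n → ℝ, LocallyLipschitzOnSet u Ω →
      ∀ x ∈ Ω, ∀ r : ℝ, 0 < r → r < diam Ω →
        (⨅ c : ℝ, (∫⁻ y in ball x r ∩ Ω,
            ENNReal.ofReal |u y - c| ^ ((n : ℝ) * p / ((n : ℝ) - p)) ∂volume)
              ^ (((n : ℝ) - p) / ((n : ℝ) * p)))
          ≤ ENNReal.ofReal C *
            (∫⁻ y in ball x (lam * r) ∩ Ω,
              ENNReal.ofReal ‖fderiv ℝ u y‖ ^ p ∂volume) ^ (1 / p)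

/-- `Ω` is a local Sobolev–Poincaré imbedding domain of order `n`
(local Trudinger inequality). -/
def LocalSPn (n : ℕ) (Ω : Set (Euc n)) : Prop :=
  ∃ C : ℝ, 1 ≤ C ∧ ∃ lam : ℝ, 1 ≤ lam ∧ ∃ A : ℝ, 0 < A ∧
    ∀ u : Euc n → ℝ, LocallyLipschitzOnSet u Ω →
      ∀ x ∈ Ω, ∀ r : ℝ, 0 < r → r < diam Ω →
        0 < (∫⁻ y in ball x (lam * r) ∩ Ω,
              ENNReal.ofReal ‖fderiv ℝ u y‖ ^ (n : ℝ) ∂volume) →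
        (∫⁻ y in ball x (lam * r) ∩ Ω,
              ENNReal.ofReal ‖fderiv ℝ u y‖ ^ (n : ℝ) ∂volume) < ⊤ →
        (⨅ c : ℝ, ∫⁻ y in ball x r ∩ Ω,
            ENNReal.ofReal (Real.exp ((A * |u y - c| /
              (∫⁻ z in ball x (lam * r) ∩ Ω,
                ENNReal.ofReal ‖fderiv ℝ u z‖ ^ (n : ℝ) ∂volume).toReal
                  ^ ((1 : ℝ) / (n : ℝ))) ^ ((n : ℝ) / ((n : ℝ) - 1)))) ∂volume)
          ≤ ENNReal.ofReal C * volume (ball x r)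

/-- `Ω` is a local Sobolev–Poincaré imbedding domain of order `p`, `n < p < ∞`
(local Morrey inequality). -/
def LocalSPHigh (n : ℕ) (Ω : Set (Euc n)) (p : ℝ) : Prop :=
  ∃ C : ℝ, 1 ≤ C ∧ ∃ lam : ℝ, 1 ≤ lam ∧
    ∀ u : Euc n → ℝ, LocallyLipschitzOnSet u Ω →
      ∀ x ∈ Ω, ∀ r : ℝ, 0 < r → r < diam Ω →
        ∀ x₁ ∈ ball x r ∩ Ω, ∀ x₂ ∈ ball x r ∩ Ω,
          ENNReal.ofReal |u x₁ - u x₂| ≤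
            ENNReal.ofReal (C * dist x₁ x₂ ^ (1 - (n : ℝ) / p)) *
              (∫⁻ y in ball x (lam * r) ∩ Ω,
                ENNReal.ofReal ‖fderiv ℝ u y‖ ^ p ∂volume) ^ (1 / p)

/-- `Ω` is a `p`-Poincaré domain. -/
def PoincareDomain (n : ℕ) (Ω : Set (Euc n)) (p : ℝ) : Prop :=
  ∃ C : ℝ, 1 ≤ C ∧ ∃ lam : ℝ, 1 ≤ lam ∧
    ∀ u : Euc n → ℝ, LocallyLipschitzOnSet u Ω →
      ∀ x ∈ Ω, ∀ r : ℝ, 0 < r → r < diam Ω →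
        (volume (ball x r ∩ Ω))⁻¹ *
          (∫⁻ y in ball x r ∩ Ω,
            ENNReal.ofReal |u y - ⨍ z in ball x r ∩ Ω, u z ∂volume| ∂volume)
          ≤ ENNReal.ofReal (C * r) *
            ((volume (ball x (lam * r) ∩ Ω))⁻¹ *
              ∫⁻ y in ball x (lam * r) ∩ Ω,
                ENNReal.ofReal ‖fderiv ℝ u y‖ ^ p ∂volume) ^ (1 / p)

theorem eq_of_exp_eq_one {X : Type*} [TopologicalSpace X] {β : Set X} (hβ : IsPreconnected β)
    {h : X → ℂ} (hc : ContinuousOn h β) (h1 : ∀ z ∈ β, Complex.exp (h z) = 1)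
    {x y : X} (hx : x ∈ β) (hy : y ∈ β) : h x = h y := by
  have := Complex.isCoveringMap_exp.eqOn_of_comp_eqOn hβ hc (continuousOn_const (c := h x))
    (fun z hz => by simp [h1 z hz, h1 x hx]) hx rfl
  exact (this hy).symm

/-- A nonvanishing continuous function on the plane cannot agree with `w - x` near infinity. -/
theorem exists_zero_of_eq_sub_near_infinity {F : ℂ → ℂ} (hF : Continuous F) {x : ℂ} {R : ℝ}
    (hR : 0 < R) (h : ∀ w, dist w x = R → F w = w - x) : ∃ w, F w = 0 := by
  by_contra! h0
  obtain ⟨g, hg, hge⟩ := Complex.exists_continuousOn_eqOn_exp_comp (U := (univ : Set ℂ))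
    (by
      have : SimplyConnectedSpace (univ : Set ℂ) :=
        (Homeomorph.Set.univ ℂ).toHomotopyEquiv.simplyConnectedSpace
      exact this) isOpen_univ hF.continuousOn (by simpa using h0)
  rw [continuousOn_univ] at hg
  have key := eq_of_exp_eq_one (β := (univ : Set ℝ)) isPreconnected_univ
    (h := fun t : ℝ => g (x + R * Complex.exp (t * Complex.I)) - (Real.log R + t * Complex.I))
    (by fun_prop) (by
      intro t _
      have h1 := hge (mem_univ (x + R * Complex.exp (t * Complex.I)))
      simp only [Function.comp] at h1
      rw [Complex.exp_sub, h1, h _ (by simp [abs_of_pos hR]), Complex.exp_add,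
        ← Complex.ofReal_exp, Real.exp_log hR, add_sub_cancel_left]
      apply div_self
      exact mul_ne_zero (by exact_mod_cast hR.ne') (Complex.exp_ne_zero _))
    (mem_univ 0) (mem_univ (2 * Real.pi))
  have e : Complex.exp (((2 * Real.pi : ℝ) : ℂ) * Complex.I) = 1 := by
    push_cast; exact Complex.exp_two_pi_mul_I
  simp only [e] at key
  simp at key

/-- If `(y - w) / (x - w)` has a continuous logarithm on the boundary of a bounded open set
containing `x`, then the set contains `y` as well. -/
theorem mem_of_log_on_frontier {U : Set ℂ} (hU : IsOpen U) (hb : Bornology.IsBounded U) {x y : ℂ}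
    (hx : x ∈ U) {Λ : ℂ → ℂ} (hΛ : ContinuousOn Λ (frontier U))
    (he : ∀ w ∈ frontier U, Complex.exp (Λ w) = (y - w) / (x - w)) : y ∈ U := by
  classical
  by_contra hy
  have hyf : y ∉ frontier U := fun h => by
    have := he y h
    simp at this
  obtain ⟨φ, hφ⟩ := ContinuousMap.exists_restrict_eq (Y := ℂ) (isClosed_frontier (s := U))
    ⟨_, continuousOn_iff_continuous_domRestrict.1 hΛ⟩
  have hφ' : ∀ w ∈ frontier U, φ w = Λ w := fun w hw => by
    have := congrArg (fun f => f ⟨w, hw⟩) hφ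
    simpa using this
  let F : ℂ → ℂ := U.piecewise (fun w => (w - y) * Complex.exp (-φ w)) (fun w => w - x)
  have hxne : ∀ w, w ∉ U → w - x ≠ 0 := fun w hw h => hw (by rwa [sub_eq_zero.1 h])
  have hyne : ∀ w ∈ U, w - y ≠ 0 := fun w hw h => hy (by rwa [← sub_eq_zero.1 h])
  have hF : Continuous F := by
    apply Continuous.piecewise
    · intro w hw
      have hwU : w ∉ U := by
        rw [hU.frontier_eq] at hw; exact hw.2
      have h1 := hxne w hwU
      have h2 : w - y ≠ 0 := fun h => hyf (by rwa [← sub_eq_zero.1 h])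
      have h1' : x - w ≠ 0 := by rw [← neg_sub]; exact neg_ne_zero.2 h1
      have h2' : y - w ≠ 0 := by rw [← neg_sub]; exact neg_ne_zero.2 h2
      rw [Complex.exp_neg, hφ' w hw, he w hw]
      field_simp
      ring
    · fun_prop
    · fun_prop
  obtain ⟨R, hR⟩ := hb.subset_ball x
  have hRpos : 0 < max R 1 := by positivity
  obtain ⟨w, hw⟩ := exists_zero_of_eq_sub_near_infinity hF (x := x) hRpos (by
    intro w hw
    have : w ∉ U := fun h => by
      have := hR h
      rw [mem_ball, hw] at this
      exact absurd (le_max_left R 1) (not_le.2 this)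
    simp [F, this])
  by_cases hwU : w ∈ U
  · simp only [F, hwU, piecewise_eq_of_mem, mul_eq_zero, Complex.exp_ne_zero, or_false] at hw
    exact hyne w hwU hw
  · simp only [F, hwU, not_false_eq_true, piecewise_eq_of_notMem] at hw
    exact hxne w hwU hw

theorem div_sub_mem_slitPlane {z w a : ℂ} (h : dist w a < dist z w) :
    (z - a) / (z - w) ∈ Complex.slitPlane := by
  have hzw : z - w ≠ 0 := by
    intro h0
    rw [sub_eq_zero.1 h0, dist_self] at h
    exact absurd h (not_lt.2 dist_nonneg)
  have : (z - a) / (z - w) = 1 + (w - a) / (z - w) := by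
    field_simp
    ring
  rw [this]
  apply Complex.mem_slitPlane_of_norm_lt_one
  rw [norm_div, div_lt_one (norm_pos_iff.2 hzw), ← dist_eq_norm, ← dist_eq_norm]
  exact h

theorem continuousOn_log_div_sub {β : Set ℂ} {w a : ℂ} (h : ∀ z ∈ β, dist w a < dist z w) :
    ContinuousOn (fun z => Complex.log ((z - a) / (z - w))) β := by
  apply ContinuousOn.clog
  · apply ContinuousOn.div (by fun_prop) (by fun_prop)
    intro z hz h0
    have := h z hz
    rw [sub_eq_zero.1 h0, dist_self] at this
    exact absurd this (not_lt.2 dist_nonneg)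
  · exact fun z hz => div_sub_mem_slitPlane (h z hz)

theorem exp_log_div_sub {z w a : ℂ} (h : dist w a < dist z w) :
    Complex.exp (Complex.log ((z - a) / (z - w))) = (z - a) / (z - w) :=
  Complex.exp_log (Complex.slitPlane_ne_zero (div_sub_mem_slitPlane h))

theorem sub_ne_zero_of_dist_lt {z w a : ℂ} (h : dist w a < dist z w) :
    z - a ≠ 0 ∧ z - w ≠ 0 := by
  have := Complex.slitPlane_ne_zero (div_sub_mem_slitPlane h)
  exact ⟨fun h => this (by simp [h]), fun h => this (by simp [h])⟩

/-- In a bounded planar domain on which `z - a` has a logarithm for every boundary point `a`, any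
two points `x`, `y` are joined by a curve all of whose points `w` have the ball separation property:
the ball of radius `2 dist(w, ∂D)` about `w` meets every connected subset of `D` containing both
`x` and `y`. -/
theorem exists_path_ball_separation {D : Set ℂ} (hD : IsOpen D) (hconn : IsConnected D)
    (hb : Bornology.IsBounded D)
    (hlog : ∀ a ∈ frontier D, ∃ l : ℂ → ℂ, ContinuousOn l D ∧ ∀ z ∈ D, Complex.exp (l z) = z - a)
    {x y : ℂ} (hx : x ∈ D) (hy : y ∈ D) :
    ∃ γ : ℝ → ℂ, Continuous γ ∧ γ 0 = x ∧ γ 1 = y ∧ (∀ t, γ t ∈ D) ∧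
      ∀ t, ∀ β ⊆ D, IsPreconnected β → x ∈ β → y ∈ β →
        ∃ z ∈ β, dist z (γ t) < 2 * infDist (γ t) (frontier D) := by
  have hne : (frontier D).Nonempty := by
    rw [nonempty_iff_ne_empty]
    intro h
    have h1 : IsClopen D := isClopen_iff_frontier_eq_empty.2 h
    have h2 := (isClopen_iff.1 h1).resolve_left (Set.nonempty_iff_ne_empty.1 hconn.nonempty)
    rw [h2] at hb
    exact NormedSpace.unbounded_univ ℝ ℂ hb
  set δ : ℂ → ℝ := fun w => infDist w (frontier D) with hδ
  have hδ0 : ∀ w, 0 ≤ δ w := fun w => infDist_nonneg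
  have hδlip : ∀ w w', δ w ≤ δ w' + dist w w' := fun w w' => infDist_le_infDist_add_dist
  have hδpos : ∀ w ∈ D, 0 < δ w := fun w hw => by
    refine (isClosed_frontier.notMem_iff_infDist_pos hne).1 fun h => ?_
    rw [hD.frontier_eq] at h
    exact h.2 hw
  have hex : ∀ w, ∃ a ∈ frontier D, δ w = dist w a := fun w =>
    isClosed_frontier.exists_infDist_eq_dist hne w
  choose a haf had using hex
  choose! l hl hle using hlog
  let B : Set (Set ℂ) := {β | β ⊆ D ∧ IsPreconnected β ∧ x ∈ β ∧ y ∈ β}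
  let X : Set ℂ := {w | ∃ β ∈ B, ∃ c > 0, ∀ z ∈ β, δ w + c ≤ dist z w}
  let Λ : ℂ → ℂ := fun w => (l (a w) y - Complex.log ((y - a w) / (y - w))) -
    (l (a w) x - Complex.log ((x - a w) / (x - w)))
  have hΛc : ∀ w ∈ X, ContinuousAt Λ w := by
    rintro w ⟨β, ⟨hβD, hβ, hxβ, hyβ⟩, c, hc, hβc⟩
    have h0 : ∀ z ∈ β, dist w (a w) < dist z w := fun z hz => by
      have := hβc z hz
      rw [← had]; linarith
    have hev : ∀ᶠ w' in nhds w, Λ w' = Λ w + (Complex.log ((y - w') / (y - w)) -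
        Complex.log ((x - w') / (x - w))) := by
      filter_upwards [ball_mem_nhds w (show 0 < c / 4 by positivity)] with w' hw'
      rw [mem_ball] at hw'
      have h1 : ∀ z ∈ β, dist w' (a w') < dist z w' := fun z hz => by
        have := hβc z hz
        have h2 := hδlip w' w
        have h3 := dist_triangle z w' w
        rw [← had]; linarith
      have h2 : ∀ z ∈ β, dist w w' < dist z w := fun z hz => by
        have := hβc z hz
        have h3 := hδ0 w
        rw [dist_comm]; linarith
      have key := eq_of_exp_eq_one hβ (h := fun z =>
        (l (a w') z - Complex.log ((z - a w') / (z - w'))) -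
        (l (a w) z - Complex.log ((z - a w) / (z - w))) - Complex.log ((z - w') / (z - w)))
        (by
          have e1 := (hl _ (haf w')).mono hβD
          have e2 := (hl _ (haf w)).mono hβD
          exact ((e1.sub (continuousOn_log_div_sub h1)).sub
            (e2.sub (continuousOn_log_div_sub h0))).sub (continuousOn_log_div_sub h2))
        (by
          intro z hz
          have n0 := sub_ne_zero_of_dist_lt (h0 z hz)
          have n1 := sub_ne_zero_of_dist_lt (h1 z hz)
          simp only [Complex.exp_sub, exp_log_div_sub (h0 z hz), exp_log_div_sub (h1 z hz),
            exp_log_div_sub (h2 z hz), hle _ (haf w') z (hβD hz), hle _ (haf w) z (hβD hz)]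
          obtain ⟨n01, n02⟩ := n0
          obtain ⟨n11, n12⟩ := n1
          field_simp) hxβ hyβ
      simp only [Λ]
      linear_combination -key
    rw [continuousAt_congr hev]
    apply ContinuousAt.add continuousAt_const
    have : ∀ z ∈ β, ContinuousAt (fun w' => Complex.log ((z - w') / (z - w))) w := by
      intro z hz
      have n0 := (sub_ne_zero_of_dist_lt (h0 z hz)).2
      apply ContinuousAt.clog
      · fun_prop
      · simp [div_self n0]
    exact (this y hyβ).sub (this x hxβ)
  have hΛe : ∀ w ∈ X, Complex.exp (Λ w) = (y - w) / (x - w) := by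
    rintro w ⟨β, ⟨hβD, hβ, hxβ, hyβ⟩, c, hc, hβc⟩
    have h0 : ∀ z ∈ β, dist w (a w) < dist z w := fun z hz => by
      have := hβc z hz
      rw [← had]; linarith
    obtain ⟨n01, n02⟩ := sub_ne_zero_of_dist_lt (h0 x hxβ)
    obtain ⟨n11, n12⟩ := sub_ne_zero_of_dist_lt (h0 y hyβ)
    simp only [Λ, Complex.exp_sub, exp_log_div_sub (h0 x hxβ), exp_log_div_sub (h0 y hyβ),
      hle _ (haf w) x hx, hle _ (haf w) y hy]
    field_simp
  let V : Set ℂ := {w | ∃ β ∈ B, ∀ z ∈ β, 2 * δ w ≤ dist z w}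
  let S : Set ℂ := D \ closure V
  have hS : IsOpen S := hD.sdiff isClosed_closure
  have hxS : x ∈ S := by
    refine ⟨hx, fun hxV => ?_⟩
    have hp := hδpos x hx
    obtain ⟨w, ⟨β, hβ, hw⟩, hxw⟩ := Metric.mem_closure_iff.1 hxV (δ x / 8) (by positivity)
    have h1 := hw x hβ.2.2.1
    have h2 := hδlip x w
    linarith
  let U : Set ℂ := connectedComponentIn S x
  have hUo : IsOpen U := hS.connectedComponentIn
  have hUS : U ⊆ S := connectedComponentIn_subset S x
  have hUx : x ∈ U := mem_connectedComponentIn hxS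
  have hfr : frontier U ⊆ X := by
    intro w hw
    rw [hUo.frontier_eq] at hw
    have hwS : w ∉ S := by
      intro hwS
      obtain ⟨v, hv1, hv2⟩ := mem_closure_iff.1 hw.1 _ (hS.connectedComponentIn (x := w))
        (mem_connectedComponentIn hwS)
      have e1 := connectedComponentIn_eq hv1
      have e2 := connectedComponentIn_eq hv2
      apply hw.2
      change w ∈ connectedComponentIn S x
      rw [e2, ← e1]
      exact mem_connectedComponentIn hwS
    have hwD : w ∈ closure D := closure_mono (hUS.trans sdiff_subset) hw.1
    by_cases hwD' : w ∈ D
    · have hwV : w ∈ closure V := by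
        by_contra h
        exact hwS ⟨hwD', h⟩
      have hp := hδpos w hwD'
      obtain ⟨v, ⟨β, hβ, hv⟩, hwv⟩ := Metric.mem_closure_iff.1 hwV (δ w / 8) (by positivity)
      refine ⟨β, hβ, δ w / 2, by positivity, fun z hz => ?_⟩
      have h1 := hv z hz
      have h2 := hδlip w v
      have h3 := dist_triangle z w v
      linarith
    · have hwf : w ∈ frontier D := by
        rw [hD.frontier_eq]; exact ⟨hwD, hwD'⟩
      have hδw : δ w = 0 := infDist_zero_of_mem hwf
      obtain ⟨p, hp⟩ := (hD.isConnected_iff_isPathConnected.1 hconn).joinedIn x hx y hy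
      have hpD : range p ⊆ D := by
        rintro _ ⟨t, rfl⟩
        exact hp t
      have hpos : 0 < infDist w (range p) :=
        ((isCompact_range p.continuous).isClosed.notMem_iff_infDist_pos (range_nonempty p)).1
          fun h => hwD' (hpD h)
      refine ⟨range p, ⟨hpD, isPreconnected_range p.continuous, ⟨0, p.source⟩, ⟨1, p.target⟩⟩,
        _, hpos, fun z hz => ?_⟩
      rw [hδw, zero_add, dist_comm]
      exact infDist_le_dist_of_mem hz
  have hyU : y ∈ U := mem_of_log_on_frontier hUo (hb.subset (hUS.trans sdiff_subset)) hUx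
    (fun w hw => (hΛc w (hfr hw)).continuousWithinAt) (fun w hw => hΛe w (hfr hw))
  have hUc : IsConnected U := ⟨⟨x, hUx⟩, isPreconnected_connectedComponentIn⟩
  obtain ⟨p, hp⟩ := (hUo.isConnected_iff_isPathConnected.1 hUc).joinedIn x hUx y hyU
  have hpU : ∀ t, p.extend t ∈ U := fun t => by
    have : p.extend t ∈ range p := by
      rw [← p.extend_range]; exact mem_range_self t
    obtain ⟨s, hs⟩ := this
    rw [← hs]; exact hp s
  refine ⟨p.extend, p.continuous_extend, p.extend_zero, p.extend_one,
    fun t => (hUS (hpU t)).1, fun t β hβD hβ hxβ hyβ => ?_⟩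
  by_contra! h
  exact (hUS (hpU t)).2 (subset_closure ⟨β, ⟨hβD, hβ, hxβ, hyβ⟩, h⟩)

theorem exists_greatest_dist_le {E : Type*} [PseudoMetricSpace E] {γ : ℝ → E} {a L ρ : ℝ}
    (ha : a ≤ L) (hγ : ContinuousOn γ (Icc a L)) (hρ : 0 ≤ ρ) :
    ∃ b ∈ Icc a L, dist (γ a) (γ b) ≤ ρ ∧ (b < L → ∀ s ∈ Icc b L, ρ ≤ dist (γ a) (γ s)) := by
  have hcont : ContinuousOn (fun s => dist (γ a) (γ s)) (Icc a L) := fun s hs =>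
    Filter.Tendsto.dist tendsto_const_nhds (hγ s hs)
  set S : Set ℝ := Icc a L ∩ (fun s => dist (γ a) (γ s)) ⁻¹' Iic ρ with hS
  have hSc : IsCompact S :=
    isCompact_Icc.of_isClosed_subset (hcont.preimage_isClosed_of_isClosed isClosed_Icc isClosed_Iic)
      inter_subset_left
  have hSne : S.Nonempty := ⟨a, ⟨le_rfl, ha⟩, by simpa using hρ⟩
  obtain ⟨b, hbS, hb⟩ := hSc.exists_isGreatest hSne
  refine ⟨b, hbS.1, hbS.2, fun hbL s hs => ?_⟩
  have hgt : ∀ s ∈ Ioc b L, ρ ≤ dist (γ a) (γ s) := by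
    intro s hs
    by_contra! h
    exact absurd (hb ⟨⟨hbS.1.1.trans hs.1.le, hs.2⟩, h.le⟩) (not_le.2 hs.1)
  have hcl : closure (Ioc b L) = Icc b L := closure_Ioc hbL.ne
  have := hcont.mono (Icc_subset_Icc_left hbS.1.1)
  exact le_on_closure (f := fun _ => ρ) hgt continuousOn_const (hcl ▸ this) (hcl ▸ hs)

theorem exists_chain {E : Type*} [PseudoMetricSpace E] {γ : ℝ → E} {δ : E → ℝ} {L : ℝ}
    (hL : 0 ≤ L) (hγ : ContinuousOn γ (Icc 0 L)) (hδ : Continuous δ)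
    (hpos : ∀ t ∈ Icc 0 L, 0 < δ (γ t)) :
    ∃ (N : ℕ) (t : ℕ → ℝ), t 0 = 0 ∧ t N = L ∧ Monotone t ∧ (∀ i, t i ∈ Icc 0 L) ∧
      (∀ i, dist (γ (t i)) (γ (t (i + 1))) ≤ δ (γ (t i)) / 4) ∧
      ∀ i j, i < j → j < N → δ (γ (t i)) / 4 ≤ dist (γ (t i)) (γ (t j)) := by
  have key : ∀ a : Icc (0 : ℝ) L, ∃ b : Icc (0 : ℝ) L, (a : ℝ) ≤ b ∧
      dist (γ a) (γ b) ≤ δ (γ a) / 4 ∧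
      ((b : ℝ) < L → ∀ s ∈ Icc (b : ℝ) L, δ (γ a) / 4 ≤ dist (γ a) (γ s)) := by
    rintro ⟨a, ha⟩
    obtain ⟨b, hb, h1, h2⟩ := exists_greatest_dist_le ha.2 (hγ.mono (Icc_subset_Icc_left ha.1))
      (by linarith [hpos a ha] : 0 ≤ δ (γ a) / 4)
    exact ⟨⟨b, ha.1.trans hb.1, hb.2⟩, hb.1, h1, h2⟩
  choose f hf1 hf2 hf3 using key
  let τ : ℕ → Icc (0 : ℝ) L := fun n => f^[n] ⟨0, le_rfl, hL⟩
  have hτ : ∀ n, τ (n + 1) = f (τ n) := fun n => Function.iterate_succ_apply' f n _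
  have hmono : Monotone fun n => (τ n : ℝ) :=
    monotone_nat_of_le_succ fun n => by rw [hτ]; exact hf1 _
  have hfin : ∃ n, (τ n : ℝ) = L := by
    by_contra! hne
    have hlt : ∀ n, (τ n : ℝ) < L := fun n => lt_of_le_of_ne (τ n).2.2 (hne n)
    obtain ⟨T, hT⟩ : ∃ T, Filter.Tendsto (fun n => (τ n : ℝ)) Filter.atTop (nhds T) :=
      ⟨_, tendsto_atTop_ciSup hmono ⟨L, by rintro _ ⟨n, rfl⟩; exact (τ n).2.2⟩⟩
    have hTm : T ∈ Icc 0 L := isClosed_Icc.mem_of_tendsto hT (.of_forall fun n => (τ n).2)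
    have hγT : Filter.Tendsto (fun n => γ (τ n)) Filter.atTop (nhds (γ T)) :=
      (hγ T hTm).tendsto.comp (tendsto_nhdsWithin_iff.2 ⟨hT, .of_forall fun n => (τ n).2⟩)
    have hδT := ((hδ.tendsto (γ T)).comp hγT).div_const 4
    have hdT := hγT.dist (hγT.comp (Filter.tendsto_add_atTop_nat 1))
    have : δ (γ T) / 4 ≤ dist (γ T) (γ T) := by
      refine le_of_tendsto_of_tendsto' hδT hdT fun n => ?_
      have h3 := hf3 (τ n)
      rw [← hτ] at h3
      exact h3 (hlt _) _ ⟨le_rfl, (hlt _).le⟩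
    rw [dist_self] at this
    linarith [hpos T hTm]
  classical
  refine ⟨Nat.find hfin, fun n => τ n, rfl, Nat.find_spec hfin, hmono, fun i => (τ i).2,
    fun i => by beta_reduce; rw [hτ]; exact hf2 _, fun i j hij hj => ?_⟩
  have hjL : (τ j : ℝ) < L := lt_of_le_of_ne (τ j).2.2 (Nat.find_min hfin hj)
  have hle : (τ (i + 1) : ℝ) ≤ τ j := hmono hij
  have h3 := hf3 (τ i)
  rw [← hτ] at h3
  exact h3 (hle.trans_lt hjL) _ ⟨hle, hjL.le⟩

theorem chain_separated {E : Type*} [PseudoMetricSpace E] {z : ℕ → E} {δ : E → ℝ} {N : ℕ}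
    (hδ : LipschitzWith 1 δ) (hsep : ∀ i j, i < j → j < N → δ (z i) / 4 ≤ dist (z i) (z j)) :
    ∀ i < N, ∀ j < N, i ≠ j → δ (z i) / 5 ≤ dist (z i) (z j) := by
  have hlip : ∀ a b, δ a ≤ δ b + dist a b := fun a b => by
    have := hδ.dist_le_mul a b
    rw [Real.dist_eq, NNReal.coe_one, one_mul] at this
    linarith [le_abs_self (δ a - δ b)]
  intro i hi j hj hij
  rcases lt_or_gt_of_ne hij with h | h
  · have := hsep i j h hj
    have := dist_nonneg (x := z i) (y := z j)
    linarith
  · have h1 := hsep j i h hi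
    have h2 := hlip (z i) (z j)
    rw [dist_comm] at h1
    linarith

theorem sum_sq_mul_le_lintegral {s : Finset ℕ} {z : ℕ → Euc 2} {d : ℕ → ℝ} {κ : ℝ}
    (hκ : 0 ≤ κ) (hd : ∀ i ∈ s, 0 < d i)
    (hsep : ∀ i ∈ s, ∀ j ∈ s, i ≠ j → d i / 5 ≤ dist (z i) (z j))
    (hz : ∀ i ∈ s, ‖z i‖ ≤ κ * d i) {g : ℝ → ℝ} (hg : AntitoneOn g (Ioi 0)) :
    ENNReal.ofReal (∑ i ∈ s, d i ^ 2 * g ((κ + 1) * d i)) ≤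
      ENNReal.ofReal 100 * ∫⁻ v : Euc 2, ENNReal.ofReal (g ‖v‖) := by
  have hdisj : (s : Set ℕ).PairwiseDisjoint fun i => ball (z i) (d i / 10) := by
    intro i hi j hj hij
    refine ball_disjoint_ball ?_
    have h1 := hsep i hi j hj hij
    have h2 := hsep j hj i hi hij.symm
    rw [dist_comm] at h2
    linarith
  have hball : ∀ i ∈ s, ENNReal.ofReal (d i ^ 2 * g ((κ + 1) * d i)) ≤
      ENNReal.ofReal 100 * ∫⁻ v in ball (z i) (d i / 10), ENNReal.ofReal (g ‖v‖) := by
    intro i hi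
    have hdi := hd i hi
    have hvol : ENNReal.ofReal (d i ^ 2) ≤ ENNReal.ofReal 100 * volume (ball (z i) (d i / 10)) := by
      rw [EuclideanSpace.volume_ball_fin_two, ← ENNReal.ofReal_pow (by positivity),
        ← ENNReal.ofReal_mul (by positivity), ← ENNReal.ofReal_mul (by positivity)]
      refine ENNReal.ofReal_le_ofReal ?_
      nlinarith [Real.pi_gt_three, sq_nonneg (d i)]
    have hae : ∀ᵐ v : Euc 2 ∂volume.restrict (ball (z i) (d i / 10)),
        ENNReal.ofReal (g ((κ + 1) * d i)) ≤ ENNReal.ofReal (g ‖v‖) := by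
      filter_upwards [ae_restrict_mem measurableSet_ball,
        ae_restrict_of_ae (measure_eq_zero_iff_ae_notMem.1 (measure_singleton (0 : Euc 2)))]
        with v hv hv0
      have hv0' : 0 < ‖v‖ := norm_pos_iff.2 hv0
      refine ENNReal.ofReal_le_ofReal (hg hv0' (mem_Ioi.2 (by positivity)) ?_)
      have h1 : ‖v‖ ≤ ‖v - z i‖ + ‖z i‖ := by simpa using norm_add_le (v - z i) (z i)
      rw [mem_ball, dist_eq_norm] at hv
      nlinarith [hz i hi]
    calc ENNReal.ofReal (d i ^ 2 * g ((κ + 1) * d i))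
        = ENNReal.ofReal (d i ^ 2) * ENNReal.ofReal (g ((κ + 1) * d i)) :=
          ENNReal.ofReal_mul (by positivity)
      _ ≤ ENNReal.ofReal 100 * volume (ball (z i) (d i / 10)) *
            ENNReal.ofReal (g ((κ + 1) * d i)) := by gcongr
      _ = ENNReal.ofReal 100 * ∫⁻ v in ball (z i) (d i / 10),
            ENNReal.ofReal (g ((κ + 1) * d i)) := by
          rw [setLIntegral_const, mul_assoc, mul_comm (volume _)]
      _ ≤ _ := mul_le_mul' le_rfl (lintegral_mono_ae hae)
  calc ENNReal.ofReal (∑ i ∈ s, d i ^ 2 * g ((κ + 1) * d i))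
      ≤ ∑ i ∈ s, ENNReal.ofReal (d i ^ 2 * g ((κ + 1) * d i)) :=
        Finset.le_sum_of_subadditive ENNReal.ofReal ENNReal.ofReal_zero.le
          (fun _ _ => ENNReal.ofReal_add_le) _ _
    _ ≤ ∑ i ∈ s, ENNReal.ofReal 100 * ∫⁻ v in ball (z i) (d i / 10), ENNReal.ofReal (g ‖v‖) :=
        Finset.sum_le_sum hball
    _ = ENNReal.ofReal 100 * ∫⁻ v in ⋃ i ∈ s, ball (z i) (d i / 10), ENNReal.ofReal (g ‖v‖) := by
        rw [lintegral_biUnion_finset hdisj fun _ _ => measurableSet_ball, Finset.mul_sum]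
    _ ≤ _ := by gcongr; exact Measure.restrict_le_self

theorem exists_sum_sq_mul_le {κ : ℝ} (hκ : 0 ≤ κ) {g : ℝ → ℝ} (hg : AntitoneOn g (Ioi 0))
    (hfin : ∫⁻ v : Euc 2, ENNReal.ofReal (g ‖v‖) ≠ ⊤) :
    ∃ K : ℝ, 0 < K ∧ ∀ (s : Finset ℕ) (z : ℕ → Euc 2) (d : ℕ → ℝ) (w : Euc 2) (ρ : ℝ), 0 < ρ →
      (∀ i ∈ s, 0 < d i) → (∀ i ∈ s, ∀ j ∈ s, i ≠ j → d i / 5 ≤ dist (z i) (z j)) →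
      (∀ i ∈ s, dist w (z i) ≤ κ * d i) →
      ∑ i ∈ s, (d i / ρ) ^ 2 * g ((κ + 1) * (d i / ρ)) ≤ K := by
  refine ⟨(ENNReal.ofReal 100 * ∫⁻ v : Euc 2, ENNReal.ofReal (g ‖v‖)).toReal + 1, by positivity,
    fun s z d w ρ hρ hd hsep hw => ?_⟩
  refine le_trans ?_ (le_add_of_nonneg_right zero_le_one)
  rw [← ENNReal.ofReal_le_iff_le_toReal (ENNReal.mul_ne_top ENNReal.ofReal_ne_top hfin)]
  refine sum_sq_mul_le_lintegral (z := fun i => ρ⁻¹ • (z i - w)) hκ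
    (fun i hi => div_pos (hd i hi) hρ) (fun i hi j hj hij => ?_) (fun i hi => ?_) hg
  · rw [dist_eq_norm, ← smul_sub, sub_sub_sub_cancel_right, norm_smul, ← dist_eq_norm,
      Real.norm_eq_abs, abs_of_pos (inv_pos.2 hρ)]
    calc d i / ρ / 5 = ρ⁻¹ * (d i / 5) := by ring
      _ ≤ _ := by gcongr; exact hsep i hi j hj hij
  · rw [norm_smul, ← dist_eq_norm, dist_comm, Real.norm_eq_abs, abs_of_pos (inv_pos.2 hρ)]
    calc ρ⁻¹ * dist w (z i) ≤ ρ⁻¹ * (κ * d i) := by gcongr; exact hw i hi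
      _ = _ := by ring

theorem exists_sum_rpow_neg_le {κ σ : ℝ} (hκ : 0 ≤ κ) (hσ : 0 < σ) :
    ∃ K : ℝ, 0 < K ∧ ∀ (s : Finset ℕ) (z : ℕ → Euc 2) (d : ℕ → ℝ) (w : Euc 2) (ρ : ℝ), 0 < ρ →
      (∀ i ∈ s, ρ ≤ d i) → (∀ i ∈ s, ∀ j ∈ s, i ≠ j → d i / 5 ≤ dist (z i) (z j)) →
      (∀ i ∈ s, dist w (z i) ≤ κ * d i) → ∑ i ∈ s, d i ^ (-σ) ≤ K * ρ ^ (-σ) := by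
  obtain ⟨K, hK, H⟩ := exists_sum_sq_mul_le (g := fun t => (1 + t) ^ (-(σ + 2))) hκ
    (fun a ha b hb hab => Real.rpow_le_rpow_of_nonpos (by linarith [mem_Ioi.1 ha]) (by linarith)
      (by linarith))
    (finite_integral_one_add_norm (E := Euc 2) (r := σ + 2) (by simpa using hσ)).ne
  refine ⟨(κ + 2) ^ (σ + 2) * K, by positivity, fun s z d w ρ hρ hd hsep hw => ?_⟩
  have h := H s z d w ρ hρ (fun i hi => hρ.trans_le (hd i hi)) hsep hw
  calc ∑ i ∈ s, d i ^ (-σ)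
      ≤ ∑ i ∈ s, ((κ + 2) ^ (σ + 2) * ρ ^ (-σ)) *
          ((d i / ρ) ^ 2 * (1 + (κ + 1) * (d i / ρ)) ^ (-(σ + 2))) := by
        refine Finset.sum_le_sum fun i hi => ?_
        have hdi : 0 < d i := hρ.trans_le (hd i hi)
        have h1 : 1 ≤ d i / ρ := (one_le_div hρ).2 (hd i hi)
        have hx : 0 < d i / ρ := by positivity
        have h2 : ((κ + 2) * (d i / ρ)) ^ (-(σ + 2)) ≤ (1 + (κ + 1) * (d i / ρ)) ^ (-(σ + 2)) :=
          Real.rpow_le_rpow_of_nonpos (by positivity) (by nlinarith) (by linarith)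
        have h3 : d i ^ (-σ) = ((κ + 2) ^ (σ + 2) * ρ ^ (-σ)) *
            ((d i / ρ) ^ 2 * ((κ + 2) * (d i / ρ)) ^ (-(σ + 2))) := by
          rw [Real.mul_rpow (by positivity) hx.le, Real.rpow_neg (by positivity : 0 ≤ κ + 2)]
          have h4 : (d i / ρ) ^ 2 * (d i / ρ) ^ (-(σ + 2)) = (d i / ρ) ^ (-σ) := by
            rw [← Real.rpow_natCast, ← Real.rpow_add hx]; congr 1; push_cast; ring
          have h5 : (d i / ρ) ^ (-σ) * ρ ^ (-σ) = d i ^ (-σ) := by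
            rw [← Real.mul_rpow hx.le hρ.le, div_mul_cancel₀ _ hρ.ne']
          have h6 : (κ + 2) ^ (σ + 2) ≠ 0 := by positivity
          rw [← h5, ← h4]; field_simp
        rw [h3]; gcongr
    _ = (κ + 2) ^ (σ + 2) * ρ ^ (-σ) *
          ∑ i ∈ s, (d i / ρ) ^ 2 * (1 + (κ + 1) * (d i / ρ)) ^ (-(σ + 2)) := by
        rw [Finset.mul_sum]
    _ ≤ (κ + 2) ^ (σ + 2) * ρ ^ (-σ) * K := by gcongr
    _ = _ := by ring

theorem exists_sum_rpow_le {κ α : ℝ} (hκ : 0 ≤ κ) (hα : 0 < α) (hα2 : α ≤ 2) :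
    ∃ K : ℝ, 0 < K ∧ ∀ (s : Finset ℕ) (z : ℕ → Euc 2) (d : ℕ → ℝ) (w : Euc 2) (ρ : ℝ), 0 < ρ →
      (∀ i ∈ s, 0 < d i) → (∀ i ∈ s, d i ≤ ρ) →
      (∀ i ∈ s, ∀ j ∈ s, i ≠ j → d i / 5 ≤ dist (z i) (z j)) →
      (∀ i ∈ s, dist w (z i) ≤ κ * d i) → ∑ i ∈ s, d i ^ α ≤ K * ρ ^ α := by
  have hfin : ∫⁻ v : Euc 2, ENNReal.ofReal (if ‖v‖ < κ + 2 then ‖v‖ ^ (α - 2) else 0) ≠ ⊤ := by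
    have hintg : IntegrableOn (fun v : Euc 2 => ‖v‖ ^ (α - 2)) (ball 0 (κ + 2)) volume := by
      refine integrableOn_ball_of_norm_le_rpow (C := 1) (α := 2 - α) (by simp)
        (by simpa using hα) (.of_forall fun v => ?_) ?_
      · rw [one_mul, neg_sub, Real.norm_of_nonneg (by positivity)]
      · exact (measurable_norm.pow_const _).aestronglyMeasurable
    have heq : ∀ v : Euc 2, ENNReal.ofReal (if ‖v‖ < κ + 2 then ‖v‖ ^ (α - 2) else 0) =
        (ball (0 : Euc 2) (κ + 2)).indicator (fun v => ENNReal.ofReal (‖v‖ ^ (α - 2))) v := by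
      intro v
      by_cases hv : ‖v‖ < κ + 2
      · rw [if_pos hv, indicator_of_mem (mem_ball_zero_iff.2 hv)]
      · rw [if_neg hv, indicator_of_notMem (by simpa using hv), ENNReal.ofReal_zero]
    simp_rw [heq]
    rw [lintegral_indicator measurableSet_ball]
    exact hintg.lintegral_lt_top.ne
  obtain ⟨K, hK, H⟩ := exists_sum_sq_mul_le
    (g := fun t => if t < κ + 2 then t ^ (α - 2) else 0) hκ (fun a ha b hb hab => by
      have ha : 0 < a := ha
      beta_reduce
      split_ifs with h1 h2 h2
      · exact Real.rpow_le_rpow_of_nonpos ha hab (by linarith)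
      · linarith
      · positivity
      · exact le_rfl) hfin
  refine ⟨(κ + 1) ^ (2 - α) * K, by positivity, fun s z d w ρ hρ hd hdρ hsep hw => ?_⟩
  have h := H s z d w ρ hρ hd hsep hw
  calc ∑ i ∈ s, d i ^ α
      = ∑ i ∈ s, ((κ + 1) ^ (2 - α) * ρ ^ α) * ((d i / ρ) ^ 2 *
          if (κ + 1) * (d i / ρ) < κ + 2 then ((κ + 1) * (d i / ρ)) ^ (α - 2) else 0) := by
        refine Finset.sum_congr rfl fun i hi => ?_
        have hx : 0 < d i / ρ := div_pos (hd i hi) hρ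
        have hx1 : d i / ρ ≤ 1 := (div_le_one hρ).2 (hdρ i hi)
        rw [if_pos (by nlinarith), Real.mul_rpow (by positivity) hx.le]
        have h4 : (d i / ρ) ^ 2 * (d i / ρ) ^ (α - 2) = (d i / ρ) ^ α := by
          rw [← Real.rpow_natCast, ← Real.rpow_add hx]; congr 1; push_cast; ring
        have h5 : (d i / ρ) ^ α * ρ ^ α = d i ^ α := by
          rw [← Real.mul_rpow hx.le hρ.le, div_mul_cancel₀ _ hρ.ne']
        have h6 : (κ + 1) ^ (2 - α) * (κ + 1) ^ (α - 2) = 1 := by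
          rw [← Real.rpow_add (by positivity)]; simp
        rw [← h5, ← h4]
        linear_combination (-(d i / ρ) ^ 2 * (d i / ρ) ^ (α - 2) * ρ ^ α) * h6
    _ = (κ + 1) ^ (2 - α) * ρ ^ α * _ := by rw [Finset.mul_sum]
    _ ≤ (κ + 1) ^ (2 - α) * ρ ^ α * K := by gcongr
    _ = _ := by ring

theorem lintegral_add_smul_sub (a : Euc 2) {t : ℝ} (ht : 0 < t) {f : Euc 2 → ℝ≥0∞}
    (hf : Measurable f) :
    ∫⁻ w, f (a + t • (w - a)) = ENNReal.ofReal (t ^ (-2 : ℝ)) * ∫⁻ w, f w := by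
  have h1 : ∀ w : Euc 2, a + t • (w - a) = t • w + (a - t • a) := fun w => by
    rw [smul_sub]; abel
  have hm : Measurable fun w : Euc 2 => f (w + (a - t • a)) := hf.comp (measurable_add_const _)
  simp_rw [h1]
  rw [← lintegral_map (μ := volume) (f := fun w => f (w + (a - t • a))) hm
    (measurable_const_smul t), Measure.map_addHaar_smul _ ht.ne', lintegral_smul_measure,
    lintegral_add_right_eq_self f, smul_eq_mul]
  congr 2
  rw [finrank_euclideanSpace_fin, abs_of_pos (by positivity), Real.rpow_neg ht.le]
  norm_num

theorem ofReal_abs_sub_le_lintegral_fderiv {v : Euc 2 → ℝ} {K : ℝ≥0} (hv : LipschitzWith K v)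
    (a : Euc 2) :
    ∀ᵐ w : Euc 2, ENNReal.ofReal |v w - v a| ≤
      ∫⁻ t in Ioc (0 : ℝ) 1, ENNReal.ofReal ‖fderiv ℝ v (a + t • (w - a))‖ *
        ENNReal.ofReal ‖w - a‖ := by
  have hae : ∀ᵐ w : Euc 2, ∀ᵐ t ∂(volume.restrict (Ioc (0 : ℝ) 1)),
      DifferentiableAt ℝ v (a + t • (w - a)) := by
    rw [Measure.ae_ae_comm]
    · filter_upwards [ae_restrict_mem measurableSet_Ioc] with t ht
      have hN := hv.ae_differentiableAt (μ := (volume : Measure (Euc 2)))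
      have hmeas : MeasurableSet {x | ¬ DifferentiableAt ℝ v x} :=
        (measurableSet_of_differentiableAt ℝ v).compl
      rw [ae_iff] at hN ⊢
      have h2 := lintegral_add_smul_sub a ht.1 (f := {x | ¬ DifferentiableAt ℝ v x}.indicator 1)
        (measurable_one.indicator hmeas)
      rw [lintegral_indicator_one hmeas, hN, mul_zero] at h2
      have hcont : Measurable fun w : Euc 2 => a + t • (w - a) := by fun_prop
      exact (lintegral_indicator_one (hcont hmeas)).symm.trans h2
    · exact (by fun_prop : Measurable fun q : Euc 2 × ℝ => a + q.2 • (q.1 - a))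
        (measurableSet_of_differentiableAt ℝ v)
  filter_upwards [hae] with w hw
  set h : ℝ → ℝ := fun t => v (a + t • (w - a)) with hh
  have hlip : LipschitzWith (K * ‖w - a‖₊) h := by
    refine hv.comp (LipschitzWith.of_dist_le_mul fun s t => ?_)
    rw [dist_add_left, dist_eq_norm, ← sub_smul, norm_smul, mul_comm, coe_nnnorm,
      dist_eq_norm]
  have hac := (hlip.lipschitzOnWith (s := uIcc 0 1)).absolutelyContinuousOnInterval
  have hintg := hac.integral_deriv_eq_sub
  have h1 : h 1 = v w := by simp [hh]
  have h0 : h 0 = v a := by simp [hh]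
  rw [h1, h0, intervalIntegral.integral_of_le zero_le_one] at hintg
  rw [← hintg, ← Real.enorm_eq_ofReal_abs]
  refine (enorm_integral_le_lintegral_enorm _).trans (lintegral_mono_ae ?_)
  filter_upwards [hw] with t ht
  have hd : HasDerivAt h (fderiv ℝ v (a + t • (w - a)) (w - a)) t := by
    have h3 : HasDerivAt (fun t : ℝ => a + t • (w - a)) (w - a) t := by
      simpa using ((hasDerivAt_id t).smul_const (w - a)).const_add a
    exact ht.hasFDerivAt.comp_hasDerivAt t h3
  rw [hd.deriv, ← ofReal_norm, ← ENNReal.ofReal_mul (norm_nonneg _)]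
  exact ENNReal.ofReal_le_ofReal (ContinuousLinearMap.le_opNorm _ _)

theorem lintegral_Ioc_rpow_neg {s : ℝ} (hs : s < 1) :
    ∫⁻ t in Ioc (0 : ℝ) 1, ENNReal.ofReal (t ^ (-s)) = ENNReal.ofReal (1 / (1 - s)) := by
  have hi := (intervalIntegral.intervalIntegrable_rpow' (a := 0) (b := 1) (r := -s)
    (by linarith))
  rw [intervalIntegrable_iff_integrableOn_Ioc_of_le zero_le_one] at hi
  rw [← ofReal_integral_eq_lintegral_ofReal hi, ← intervalIntegral.integral_of_le zero_le_one,
    integral_rpow (Or.inl (by linarith))]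
  · rw [Real.one_rpow, Real.zero_rpow (by linarith)]
    congr 2 <;> ring
  · filter_upwards [ae_restrict_mem measurableSet_Ioc] with t ht
    exact Real.rpow_nonneg ht.1.le _

theorem lintegral_ball_abs_sub_le {p : ℝ} (hp : 2 < p) {v : Euc 2 → ℝ} {K : ℝ≥0}
    (hv : LipschitzWith K v) {m a : Euc 2} {ρ : ℝ} (hρ : 0 < ρ) (ha : a ∈ closedBall m ρ) :
    ∫⁻ w in ball m ρ, ENNReal.ofReal |v w - v a| ≤
      ENNReal.ofReal (2 * ρ * (p / (p - 2))) *
        (∫⁻ w in ball m ρ, ENNReal.ofReal ‖fderiv ℝ v w‖ ^ p) ^ (1 / p) *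
        volume (ball m ρ) ^ (1 - 1 / p) := by
  set F : Euc 2 → ℝ≥0∞ := fun w => ENNReal.ofReal ‖fderiv ℝ v w‖ with hF
  have hFm : Measurable F := (measurable_fderiv ℝ v).norm.ennreal_ofReal
  set G := ∫⁻ w in ball m ρ, F w ^ p with hG
  set B := ball m ρ with hB
  have hmap : ∀ w ∈ B, ∀ t ∈ Ioc (0 : ℝ) 1, a + t • (w - a) ∈ B := by
    intro w hw t ht
    have h2 : a + t • (w - a) - m = (1 - t) • (a - m) + t • (w - m) := by
      simp only [smul_sub, sub_smul, one_smul]; abel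
    rw [hB, mem_ball, dist_eq_norm] at hw ⊢
    rw [mem_closedBall, dist_eq_norm] at ha
    rw [h2]
    calc ‖(1 - t) • (a - m) + t • (w - m)‖ ≤ ‖(1 - t) • (a - m)‖ + ‖t • (w - m)‖ := norm_add_le _ _
      _ = (1 - t) * ‖a - m‖ + t * ‖w - m‖ := by
          rw [norm_smul, norm_smul, Real.norm_of_nonneg (by linarith [ht.2]),
            Real.norm_of_nonneg ht.1.le]
      _ < ρ := by nlinarith [ht.1, ht.2]
  have hp0 : 0 < p := by linarith
  have hpq : p.HolderConjugate (Real.conjExponent p) := .conjExponent (by linarith)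
  have hq : 1 / Real.conjExponent p = 1 - 1 / p := by
    have := hpq.inv_add_inv_eq_one
    rw [one_div, one_div]; linarith
  have hinner : ∀ t ∈ Ioc (0 : ℝ) 1, ∫⁻ w in B, F (a + t • (w - a)) ≤
      ENNReal.ofReal (t ^ (-(2 / p))) * (G ^ (1 / p) * volume B ^ (1 - 1 / p)) := by
    intro t ht
    have hφ : Measurable fun w : Euc 2 => a + t • (w - a) := by fun_prop
    have h1 := ENNReal.lintegral_mul_le_Lp_mul_Lq (volume.restrict B) hpq
      (f := fun w => F (a + t • (w - a))) (g := 1) (hFm.comp hφ).aemeasurable aemeasurable_one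
    simp only [mul_one, Pi.one_apply, ENNReal.one_rpow, lintegral_one, Measure.restrict_apply_univ,
      hq] at h1
    have h2 : ∫⁻ w in B, F (a + t • (w - a)) ^ p ≤ ENNReal.ofReal (t ^ (-2 : ℝ)) * G := by
      rw [hG, ← lintegral_indicator measurableSet_ball, ← lintegral_indicator measurableSet_ball,
        ← lintegral_add_smul_sub a ht.1 ((hFm.pow_const p).indicator measurableSet_ball)]
      refine lintegral_mono fun w => ?_
      by_cases hw : w ∈ B
      · rw [indicator_of_mem hw, indicator_of_mem (hmap w hw t ht)]
      · rw [indicator_of_notMem hw]; exact zero_le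
    have h3 : ENNReal.ofReal (t ^ (-2 : ℝ)) ^ (1 / p) = ENNReal.ofReal (t ^ (-(2 / p))) := by
      rw [ENNReal.ofReal_rpow_of_pos (Real.rpow_pos_of_pos ht.1 _), ← Real.rpow_mul ht.1.le]
      congr 2; ring
    calc _ ≤ _ := h1
      _ ≤ (ENNReal.ofReal (t ^ (-2 : ℝ)) * G) ^ (1 / p) * volume B ^ (1 - 1 / p) := by gcongr
      _ = _ := by rw [ENNReal.mul_rpow_of_nonneg _ _ (by positivity), h3, mul_assoc]
  have hjm : Measurable (Function.uncurry fun (w : Euc 2) (t : ℝ) => F (a + t • (w - a))) :=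
    hFm.comp (by fun_prop : Measurable fun q : Euc 2 × ℝ => a + q.2 • (q.1 - a))
  calc ∫⁻ w in B, ENNReal.ofReal |v w - v a|
      ≤ ∫⁻ w in B, ENNReal.ofReal (2 * ρ) * ∫⁻ t in Ioc (0 : ℝ) 1, F (a + t • (w - a)) := by
        refine lintegral_mono_ae ?_
        filter_upwards [ae_restrict_of_ae (ofReal_abs_sub_le_lintegral_fderiv hv a),
          ae_restrict_mem measurableSet_ball] with w h1 hw
        refine h1.trans ?_
        have hwt : Measurable fun t : ℝ => F (a + t • (w - a)) :=
          hFm.comp (by fun_prop : Measurable fun t : ℝ => a + t • (w - a))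
        rw [lintegral_mul_const _ hwt, mul_comm]
        gcongr
        have := dist_triangle_right w a m
        rw [← dist_eq_norm]
        linarith [mem_ball.1 hw, mem_closedBall.1 ha]
    _ = ENNReal.ofReal (2 * ρ) * ∫⁻ t in Ioc (0 : ℝ) 1, ∫⁻ w in B, F (a + t • (w - a)) := by
        have hjm2 : Measurable fun w : Euc 2 => ∫⁻ t in Ioc (0 : ℝ) 1, F (a + t • (w - a)) :=
          hjm.lintegral_prod_right'
        rw [lintegral_const_mul _ hjm2, lintegral_lintegral_swap hjm.aemeasurable]
    _ ≤ ENNReal.ofReal (2 * ρ) * ∫⁻ t in Ioc (0 : ℝ) 1,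
          ENNReal.ofReal (t ^ (-(2 / p))) * (G ^ (1 / p) * volume B ^ (1 - 1 / p)) := by
        exact mul_le_mul' le_rfl (setLIntegral_mono' measurableSet_Ioc hinner)
    _ = _ := by
        rw [lintegral_mul_const _ (by fun_prop), lintegral_Ioc_rpow_neg ((div_lt_one hp0).2 hp),
          ENNReal.ofReal_mul (by positivity : 0 ≤ 2 * ρ)]
        have : 1 / (1 - 2 / p) = p / (p - 2) := by
          have : p - 2 ≠ 0 := by linarith
          field_simp
        rw [this]; ring

theorem exists_morrey_ball {p : ℝ} (hp : 2 < p) : ∃ C : ℝ, 0 < C ∧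
    ∀ (u : Euc 2 → ℝ) (Ω : Set (Euc 2)), LocallyLipschitzOn Ω u → ∀ (m : Euc 2) (ρ : ℝ), 0 < ρ →
      closedBall m ρ ⊆ Ω → ∀ a ∈ closedBall m ρ, ∀ b ∈ closedBall m ρ,
      ENNReal.ofReal |u a - u b| ≤ ENNReal.ofReal (C * ρ ^ (1 - 2 / p)) *
        (∫⁻ w in ball m ρ, ENNReal.ofReal ‖fderiv ℝ u w‖ ^ p) ^ (1 / p) := by
  have hp0 : 0 < p := by linarith
  have hp2 : 0 < p - 2 := by linarith
  refine ⟨4 * (p / (p - 2)), by positivity, fun u Ω hu m ρ hρ hΩ a ha b hb => ?_⟩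
  obtain ⟨K, hK⟩ := (hu.mono hΩ).exists_lipschitzOnWith_of_compact (isCompact_closedBall m ρ)
  obtain ⟨v, hv, huv⟩ := hK.extend_real
  have hfd : ∀ w ∈ ball m ρ, fderiv ℝ u w = fderiv ℝ v w := fun w hw =>
    Filter.EventuallyEq.fderiv_eq (Filter.eventuallyEq_of_mem (isOpen_ball.mem_nhds hw)
      (huv.mono ball_subset_closedBall))
  have hG : ∫⁻ w in ball m ρ, ENNReal.ofReal ‖fderiv ℝ u w‖ ^ p =
      ∫⁻ w in ball m ρ, ENNReal.ofReal ‖fderiv ℝ v w‖ ^ p :=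
    setLIntegral_congr_fun measurableSet_ball fun w hw => by beta_reduce; rw [hfd w hw]
  rw [hG, huv ha, huv hb]
  set G := ∫⁻ w in ball m ρ, ENNReal.ofReal ‖fderiv ℝ v w‖ ^ p
  have hvol : volume (ball m ρ) = ENNReal.ofReal (ρ ^ 2 * Real.pi) := by
    rw [EuclideanSpace.volume_ball_fin_two, ← ENNReal.ofReal_pow hρ.le,
      ← ENNReal.ofReal_mul (by positivity)]
  have hA : 0 < ρ ^ 2 * Real.pi := by positivity
  have hmeas : ∀ c : ℝ, Measurable fun w => ENNReal.ofReal |v w - c| := fun c => by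
    have := hv.continuous
    fun_prop
  have hsum : ENNReal.ofReal (ρ ^ 2 * Real.pi) * ENNReal.ofReal |v a - v b| ≤
      ENNReal.ofReal (4 * ρ * (p / (p - 2))) * G ^ (1 / p) *
        ENNReal.ofReal (ρ ^ 2 * Real.pi) ^ (1 - 1 / p) := by
    calc ENNReal.ofReal (ρ ^ 2 * Real.pi) * ENNReal.ofReal |v a - v b|
        = ∫⁻ _ in ball m ρ, ENNReal.ofReal |v a - v b| := by
          rw [setLIntegral_const, hvol, mul_comm]
      _ ≤ ∫⁻ w in ball m ρ, (ENNReal.ofReal |v w - v a| + ENNReal.ofReal |v w - v b|) := by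
          refine lintegral_mono fun w => ?_
          rw [← ENNReal.ofReal_add (abs_nonneg _) (abs_nonneg _)]
          refine ENNReal.ofReal_le_ofReal ?_
          rw [abs_sub_comm (v w) (v a)]
          exact abs_sub_le _ _ _
      _ ≤ _ := by
          rw [lintegral_add_left (hmeas _), ← hvol]
          refine (add_le_add (lintegral_ball_abs_sub_le hp hv hρ ha)
            (lintegral_ball_abs_sub_le hp hv hρ hb)).trans_eq ?_
          have h4 : ENNReal.ofReal (4 * ρ * (p / (p - 2))) =
              2 * ENNReal.ofReal (2 * ρ * (p / (p - 2))) := by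
            rw [two_mul, ← ENNReal.ofReal_add (by positivity) (by positivity)]
            congr 1; ring
          rw [← two_mul, ← mul_assoc, ← mul_assoc, ← h4]
  have hpi : Real.pi ^ (-(1 / p)) ≤ 1 :=
    Real.rpow_le_one_of_one_le_of_nonpos (by linarith [Real.pi_gt_three]) (by
      rw [neg_nonpos]; positivity)
  have hAne : ENNReal.ofReal (ρ ^ 2 * Real.pi) ≠ 0 := (ENNReal.ofReal_pos.2 hA).ne'
  rw [mul_comm, ← ENNReal.le_div_iff_mul_le (Or.inl hAne) (Or.inl ENNReal.ofReal_ne_top)] at hsum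
  refine hsum.trans ?_
  rw [mul_div_assoc, ENNReal.ofReal_rpow_of_pos hA, ← ENNReal.ofReal_div_of_pos hA, mul_right_comm,
    ← ENNReal.ofReal_mul (by positivity)]
  refine mul_le_mul' (ENNReal.ofReal_le_ofReal ?_) le_rfl
  have h1 : (ρ ^ 2 * Real.pi) ^ (1 - 1 / p) / (ρ ^ 2 * Real.pi) =
      ρ ^ (-(2 / p)) * Real.pi ^ (-(1 / p)) := by
    rw [div_eq_iff hA.ne']
    have h2 : (ρ ^ 2 * Real.pi) ^ (1 - 1 / p) =
        (ρ ^ 2 * Real.pi) ^ (-(1 / p)) * (ρ ^ 2 * Real.pi) := by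
      rw [← Real.rpow_add_one hA.ne']; congr 1; ring
    rw [h2, Real.mul_rpow (by positivity) Real.pi_pos.le, ← Real.rpow_natCast,
      ← Real.rpow_mul hρ.le]
    congr 3; push_cast; ring
  have h3 : ρ ^ (1 - 2 / p) = ρ * ρ ^ (-(2 / p)) := by
    rw [sub_eq_add_neg, Real.rpow_add hρ, Real.rpow_one]
  rw [h1, h3]
  have h4 : 0 < ρ ^ (-(2 / p)) := by positivity
  calc 4 * ρ * (p / (p - 2)) * (ρ ^ (-(2 / p)) * Real.pi ^ (-(1 / p)))
      ≤ 4 * ρ * (p / (p - 2)) * (ρ ^ (-(2 / p)) * 1) := by gcongr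
    _ = _ := by ring

theorem frontier_nonempty_of_isBounded {E : Type*} [NormedAddCommGroup E] [NormedSpace ℝ E]
    [Nontrivial E] {Ω : Set E} (hb : Bornology.IsBounded Ω) (hne : Ω.Nonempty) :
    (frontier Ω).Nonempty := by
  have := NormedSpace.noncompactSpace ℝ E
  refine nonempty_frontier_iff.2 ⟨hne, fun h => ?_⟩
  exact NormedSpace.unbounded_univ ℝ E (h ▸ hb)

theorem infDist_frontier_pos {E : Type*} [NormedAddCommGroup E] [NormedSpace ℝ E] [Nontrivial E]
    {Ω : Set E} (hO : IsOpen Ω) (hb : Bornology.IsBounded Ω) {z : E} (hz : z ∈ Ω) :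
    0 < infDist z (frontier Ω) :=
  (isClosed_frontier.notMem_iff_infDist_pos (frontier_nonempty_of_isBounded hb ⟨z, hz⟩)).1
    fun h => (hO.frontier_eq ▸ h).2 hz

theorem closedBall_subset_of_lt_infDist_frontier {E : Type*} [NormedAddCommGroup E]
    [NormedSpace ℝ E] {Ω : Set E} (hO : IsOpen Ω) {z : E} (hz : z ∈ Ω) {ρ : ℝ}
    (hρ : ρ < infDist z (frontier Ω)) : closedBall z ρ ⊆ Ω := by
  rcases lt_or_ge ρ 0 with h | h
  · simp [closedBall_eq_empty.2 h]
  refine (convex_closedBall z ρ).isPreconnected.subset_left_of_subset_union hO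
    isClosed_closure.isOpen_compl (disjoint_compl_right_iff_subset.2 subset_closure)
    (fun w hw => ?_) ⟨z, mem_closedBall_self h, hz⟩
  by_contra hcon
  rw [mem_union, not_or, mem_compl_iff, not_not] at hcon
  have hwf : w ∈ frontier Ω := hO.frontier_eq ▸ ⟨hcon.2, hcon.1⟩
  have := infDist_le_dist_of_mem (x := z) hwf
  rw [mem_closedBall, dist_comm] at hw
  linarith

theorem ArclengthOn.dist_le {n : ℕ} {γ : ℝ → Euc n} {L a b : ℝ} (h : ArclengthOn γ L) (ha : 0 ≤ a)
    (hab : a ≤ b) (hb : b ≤ L) : dist (γ a) (γ b) ≤ b - a := by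
  have h1 := eVariationOn.edist_le γ (left_mem_Icc.2 hab) (right_mem_Icc.2 hab)
  rw [h a b ha hab hb, edist_dist] at h1
  exact (ENNReal.ofReal_le_ofReal_iff (by linarith)).1 h1

theorem ArclengthOn.continuousOn {n : ℕ} {γ : ℝ → Euc n} {L : ℝ} (h : ArclengthOn γ L) :
    ContinuousOn γ (Icc 0 L) := by
  refine LipschitzOnWith.continuousOn (K := 1) (LipschitzOnWith.of_dist_le_mul fun a ha b hb => ?_)
  rw [NNReal.coe_one, one_mul]
  rcases le_total a b with hab | hab
  · rw [Real.dist_eq, abs_sub_comm]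
    exact (h.dist_le ha.1 hab hb.2).trans (le_abs_self _)
  · rw [dist_comm, Real.dist_eq]
    exact (h.dist_le hb.1 hab ha.2).trans (le_abs_self _)

theorem sum_lintegral_le_lintegral_sum {α ι : Type*} [MeasurableSpace α] {μ : Measure α}
    (s : Finset ι) (f : ι → α → ℝ≥0∞) : ∑ i ∈ s, ∫⁻ a, f i a ∂μ ≤ ∫⁻ a, ∑ i ∈ s, f i a ∂μ := by
  classical
  induction s using Finset.induction_on with
  | empty => simp
  | insert i s hi ih =>
    simp only [Finset.sum_insert hi]
    exact (add_le_add le_rfl ih).trans (le_lintegral_add _ _)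

theorem exists_sum_indicator_ball_le : ∃ K : ℝ, 0 < K ∧
    ∀ (s : Finset ℕ) (z : ℕ → Euc 2) (δ : Euc 2 → ℝ), LipschitzWith 1 δ → (∀ i ∈ s, 0 < δ (z i)) →
      (∀ i ∈ s, ∀ j ∈ s, i ≠ j → δ (z i) / 5 ≤ dist (z i) (z j)) → ∀ f : Euc 2 → ℝ≥0∞,
      ∀ S : Set (Euc 2), MeasurableSet S → (∀ i ∈ s, ball (z i) (δ (z i) / 4) ⊆ S) →
      ∑ i ∈ s, ∫⁻ w in ball (z i) (δ (z i) / 4), f w ≤ ENNReal.ofReal K * ∫⁻ w in S, f w := by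
  obtain ⟨K, hK, H⟩ := exists_sum_rpow_neg_le (κ := 1) (σ := 1) zero_le_one one_pos
  refine ⟨5 / 3 * K, by positivity, fun s z δ hδ hpos hsep f S hS hsub => ?_⟩
  have hlip : ∀ a b, δ a ≤ δ b + dist a b := fun a b => by
    have := hδ.dist_le_mul a b
    rw [Real.dist_eq, NNReal.coe_one, one_mul] at this
    linarith [le_abs_self (δ a - δ b)]
  classical
  have hcard : ∀ w, ((s.filter fun i => w ∈ ball (z i) (δ (z i) / 4)).card : ℝ) ≤ 5 / 3 * K := by
    intro w
    set s' := s.filter fun i => w ∈ ball (z i) (δ (z i) / 4) with hs'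
    rcases s'.eq_empty_or_nonempty with he | ⟨i₀, hi₀⟩
    · rw [he]; simp; positivity
    have hc : ∀ i ∈ s', i ∈ s ∧ 4 / 5 * δ w ≤ δ (z i) ∧ δ (z i) ≤ 4 / 3 * δ w ∧
        dist w (z i) ≤ 1 * δ (z i) := by
      intro i hi
      obtain ⟨h1, h2⟩ := Finset.mem_filter.1 hi
      rw [mem_ball] at h2
      have h3 := hlip w (z i)
      have h4 := hlip (z i) w
      rw [dist_comm] at h4
      have := hpos i h1
      exact ⟨h1, by linarith, by linarith, by linarith⟩
    have hw : 0 < δ w := by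
      have := hc i₀ hi₀
      linarith [hpos i₀ this.1]
    have h := H s' z (fun i => δ (z i)) w (4 / 5 * δ w) (by positivity) (fun i hi => (hc i hi).2.1)
      (fun i hi j hj => hsep i (hc i hi).1 j (hc j hj).1) (fun i hi => (hc i hi).2.2.2)
    have h2 : (s'.card : ℝ) * (3 / 4 * (δ w)⁻¹) ≤ ∑ i ∈ s', δ (z i) ^ (-1 : ℝ) := by
      rw [← nsmul_eq_mul]
      refine Finset.card_nsmul_le_sum _ _ _ fun i hi => ?_
      obtain ⟨h1, -, h3, -⟩ := hc i hi
      rw [Real.rpow_neg_one]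
      calc 3 / 4 * (δ w)⁻¹ = (4 / 3 * δ w)⁻¹ := by rw [mul_inv]; norm_num
        _ ≤ _ := inv_anti₀ (hpos i h1) h3
    rw [Real.rpow_neg_one, mul_inv] at h
    have h3 := h2.trans h
    have h4 : (s'.card : ℝ) * (3 / 4) * (δ w)⁻¹ ≤ K * (4 / 5)⁻¹ * (δ w)⁻¹ := by linarith
    have h5 := le_of_mul_le_mul_right h4 (inv_pos.2 hw)
    norm_num at h5
    linarith
  calc ∑ i ∈ s, ∫⁻ w in ball (z i) (δ (z i) / 4), f w
      = ∑ i ∈ s, ∫⁻ w in S, (ball (z i) (δ (z i) / 4)).indicator f w := by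
        refine Finset.sum_congr rfl fun i hi => ?_
        rw [setLIntegral_indicator measurableSet_ball, inter_eq_left.2 (hsub i hi)]
    _ ≤ ∫⁻ w in S, ∑ i ∈ s, (ball (z i) (δ (z i) / 4)).indicator f w :=
        sum_lintegral_le_lintegral_sum s _
    _ ≤ ∫⁻ w in S, ENNReal.ofReal (5 / 3 * K) * f w := by
        refine lintegral_mono fun w => ?_
        simp only [indicator_apply]
        rw [← Finset.sum_filter, Finset.sum_const, nsmul_eq_mul]
        gcongr
        rw [← ENNReal.ofReal_natCast]
        exact ENNReal.ofReal_le_ofReal (hcard w)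
    _ = _ := lintegral_const_mul' _ _ ENNReal.ofReal_ne_top

theorem exists_abs_sub_le_of_chain {p : ℝ} (hp : 2 < p) : ∃ C : ℝ, 0 < C ∧
    ∀ (Ω : Set (Euc 2)) (u : Euc 2 → ℝ) (z : ℕ → Euc 2) (N : ℕ) (δ : Euc 2 → ℝ) (S : Set (Euc 2)),
      LocallyLipschitzOn Ω u → LipschitzWith 1 δ → (∀ i < N, 0 < δ (z i)) →
      (∀ i < N, closedBall (z i) (δ (z i) / 4) ⊆ Ω) →
      (∀ i < N, dist (z i) (z (i + 1)) ≤ δ (z i) / 4) →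
      (∀ i < N, ∀ j < N, i ≠ j → δ (z i) / 5 ≤ dist (z i) (z j)) → MeasurableSet S →
      (∀ i < N, ball (z i) (δ (z i) / 4) ⊆ S) →
      ENNReal.ofReal |u (z 0) - u (z N)| ≤
        ENNReal.ofReal (C * (∑ i ∈ Finset.range N, δ (z i) ^ ((p - 2) / (p - 1))) ^ (1 - 1 / p)) *
          (∫⁻ w in S, ENNReal.ofReal ‖fderiv ℝ u w‖ ^ p) ^ (1 / p) := by
  obtain ⟨C, hC, hM⟩ := exists_morrey_ball hp
  obtain ⟨K, hK, hO⟩ := exists_sum_indicator_ball_le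
  have hp0 : 0 < p := by linarith
  have hp1 : p - 1 ≠ 0 := by linarith
  refine ⟨C * K ^ (1 / p), by positivity, fun Ω u z N δ S hu hδ hpos hΩ hdist hsep hS hsub => ?_⟩
  have hpq : (Real.conjExponent p).HolderConjugate p :=
    (Real.HolderConjugate.conjExponent (by linarith)).symm
  have hq : 1 / Real.conjExponent p = 1 - 1 / p := by
    have := hpq.inv_add_inv_eq_one
    rw [one_div, one_div]; linarith
  set F : Euc 2 → ℝ≥0∞ := fun w => ENNReal.ofReal ‖fderiv ℝ u w‖ ^ p with hF
  set G : ℕ → ℝ≥0∞ := fun i => ∫⁻ w in ball (z i) (δ (z i) / 4), F w with hG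
  have hstep : ∀ i ∈ Finset.range N, ENNReal.ofReal |u (z i) - u (z (i + 1))| ≤
      ENNReal.ofReal C * (ENNReal.ofReal (δ (z i) ^ (1 - 2 / p)) * G i ^ (1 / p)) := by
    intro i hi
    have hi := Finset.mem_range.1 hi
    have hd := hpos i hi
    have h := hM u Ω hu (z i) (δ (z i) / 4) (by positivity) (hΩ i hi) (z i)
      (mem_closedBall_self (by positivity)) (z (i + 1)) (by
        rw [mem_closedBall, dist_comm]; exact hdist i hi)
    refine h.trans ?_
    rw [← mul_assoc, ← ENNReal.ofReal_mul hC.le]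
    have : (δ (z i) / 4) ^ (1 - 2 / p) ≤ δ (z i) ^ (1 - 2 / p) :=
      Real.rpow_le_rpow (by positivity) (by linarith) (by
        rw [sub_nonneg, div_le_one hp0]; exact hp.le)
    gcongr
  have htele : ENNReal.ofReal |u (z 0) - u (z N)| ≤
      ∑ i ∈ Finset.range N, ENNReal.ofReal |u (z i) - u (z (i + 1))| := by
    rw [← ENNReal.ofReal_sum_of_nonneg fun _ _ => abs_nonneg _]
    exact ENNReal.ofReal_le_ofReal (dist_le_range_sum_dist (fun i => u (z i)) N)
  have hpow : ∀ i ∈ Finset.range N, ENNReal.ofReal (δ (z i) ^ (1 - 2 / p)) ^ Real.conjExponent p =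
      ENNReal.ofReal (δ (z i) ^ ((p - 2) / (p - 1))) := by
    intro i hi
    have hd := hpos i (Finset.mem_range.1 hi)
    rw [ENNReal.ofReal_rpow_of_pos (Real.rpow_pos_of_pos hd _), ← Real.rpow_mul hd.le]
    congr 2
    rw [Real.conjExponent]
    field_simp
  have hGp : ∀ i, (G i ^ (1 / p)) ^ p = G i := fun i => by
    rw [← ENNReal.rpow_mul, one_div_mul_cancel hp0.ne', ENNReal.rpow_one]
  have hsum0 : ∀ i ∈ Finset.range N, 0 ≤ δ (z i) ^ ((p - 2) / (p - 1)) := fun i hi =>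
    Real.rpow_nonneg (hpos i (Finset.mem_range.1 hi)).le _
  calc ENNReal.ofReal |u (z 0) - u (z N)|
      ≤ ∑ i ∈ Finset.range N,
          ENNReal.ofReal C * (ENNReal.ofReal (δ (z i) ^ (1 - 2 / p)) * G i ^ (1 / p)) :=
        htele.trans (Finset.sum_le_sum hstep)
    _ = ENNReal.ofReal C *
          ∑ i ∈ Finset.range N, ENNReal.ofReal (δ (z i) ^ (1 - 2 / p)) * G i ^ (1 / p) := by
        rw [Finset.mul_sum]
    _ ≤ ENNReal.ofReal C * (ENNReal.ofReal (∑ i ∈ Finset.range N, δ (z i) ^ ((p - 2) / (p - 1))) ^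
          (1 - 1 / p) * (∑ i ∈ Finset.range N, G i) ^ (1 / p)) := by
        refine mul_le_mul' le_rfl ((ENNReal.inner_le_Lp_mul_Lq _ _ _ hpq).trans_eq ?_)
        rw [hq, Finset.sum_congr rfl hpow, ENNReal.ofReal_sum_of_nonneg hsum0]
        simp_rw [hGp]
    _ ≤ ENNReal.ofReal C * (ENNReal.ofReal (∑ i ∈ Finset.range N, δ (z i) ^ ((p - 2) / (p - 1))) ^
          (1 - 1 / p) * (ENNReal.ofReal K * ∫⁻ w in S, F w) ^ (1 / p)) := by
        gcongr
        exact hO (Finset.range N) z δ hδ (fun i hi => hpos i (Finset.mem_range.1 hi))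
          (fun i hi j hj => hsep i (Finset.mem_range.1 hi) j (Finset.mem_range.1 hj)) F S hS
          (fun i hi => hsub i (Finset.mem_range.1 hi))
    _ = _ := by
        have h1 : 0 ≤ 1 - 1 / p := by rw [sub_nonneg, div_le_one hp0]; linarith
        rw [ENNReal.mul_rpow_of_nonneg _ _ (by positivity), ENNReal.ofReal_rpow_of_pos hK,
          ENNReal.ofReal_rpow_of_nonneg (Finset.sum_nonneg hsum0) h1,
          ENNReal.ofReal_mul (by positivity), ENNReal.ofReal_mul hC.le]
        ring

theorem sum_rpow_le_lintegral {α L : ℝ} (hα0 : 0 < α) (hα1 : α < 1) {γ : ℝ → Euc 2}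
    (hγ : ∀ a b, 0 ≤ a → a ≤ b → b ≤ L → dist (γ a) (γ b) ≤ b - a) {δ : Euc 2 → ℝ}
    (hδ : LipschitzWith 1 δ) (hpos : ∀ t ∈ Icc 0 L, 0 < δ (γ t)) {N : ℕ} {t : ℕ → ℝ} (hN : 2 ≤ N)
    (ht : Monotone t) (htm : ∀ i, t i ∈ Icc 0 L)
    (hstep : ∀ i, dist (γ (t i)) (γ (t (i + 1))) ≤ δ (γ (t i)) / 4)
    (hsep : ∀ i j, i < j → j < N → δ (γ (t i)) / 4 ≤ dist (γ (t i)) (γ (t j))) :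
    ENNReal.ofReal (∑ i ∈ Finset.range N, δ (γ (t i)) ^ α) ≤
      ENNReal.ofReal 15 * ∫⁻ s in Icc 0 L, ENNReal.ofReal (δ (γ s) ^ (α - 1)) := by
  have hlip : ∀ a b, δ a ≤ δ b + dist a b := fun a b => by
    have := hδ.dist_le_mul a b
    rw [Real.dist_eq, NNReal.coe_one, one_mul] at this
    linarith [le_abs_self (δ a - δ b)]
  obtain ⟨n, rfl⟩ : ∃ n, N = n + 2 := ⟨N - 2, by omega⟩
  have hlast : ∑ i ∈ Finset.range (n + 2), δ (γ (t i)) ^ α ≤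
      3 * ∑ i ∈ Finset.range (n + 1), δ (γ (t i)) ^ α := by
    rw [Finset.sum_range_succ]
    have h0 := hpos _ (htm n)
    have h1 : δ (γ (t (n + 1))) ≤ 5 / 4 * δ (γ (t n)) := by
      have h2 := hlip (γ (t (n + 1))) (γ (t n))
      rw [dist_comm] at h2
      linarith [hstep n]
    have h2 : δ (γ (t (n + 1))) ^ α ≤ 5 / 4 * δ (γ (t n)) ^ α := by
      refine (Real.rpow_le_rpow (hpos _ (htm _)).le h1 hα0.le).trans ?_
      rw [Real.mul_rpow (by norm_num) h0.le]
      gcongr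
      exact (Real.rpow_le_rpow_of_exponent_le (by norm_num) hα1.le).trans_eq (Real.rpow_one _)
    have hnn : ∀ i, 0 ≤ δ (γ (t i)) ^ α := fun i => Real.rpow_nonneg (hpos _ (htm i)).le _
    have h3 : δ (γ (t n)) ^ α ≤ ∑ i ∈ Finset.range (n + 1), δ (γ (t i)) ^ α :=
      Finset.single_le_sum (f := fun i => δ (γ (t i)) ^ α) (fun i _ => hnn i)
        (Finset.mem_range.2 (Nat.lt_succ_self n))
    linarith [hnn n]
  have hpiece : ∀ i ∈ Finset.range (n + 1), ENNReal.ofReal (δ (γ (t i)) ^ α) ≤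
      ENNReal.ofReal 5 * ∫⁻ s in Ioc (t i) (t (i + 1)), ENNReal.ofReal (δ (γ s) ^ (α - 1)) := by
    intro i hi
    have hi := Finset.mem_range.1 hi
    set d := δ (γ (t i)) with hd
    have hd0 : 0 < d := hpos _ (htm i)
    have hgap : d / 4 ≤ t (i + 1) - t i :=
      (hsep i (i + 1) (by omega) (by omega)).trans
        (hγ _ _ (htm i).1 (ht (Nat.le_succ i)) (htm (i + 1)).2)
    have hval : ∀ s ∈ Ioc (t i) (t i + d / 4), ENNReal.ofReal ((5 / 4 * d) ^ (α - 1)) ≤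
        ENNReal.ofReal (δ (γ s) ^ (α - 1)) := by
      intro s hs
      have hsL : s ≤ L := by linarith [hs.2, (htm (i + 1)).2]
      have h1 := hlip (γ s) (γ (t i))
      have h2 := hγ (t i) s (htm i).1 hs.1.le hsL
      rw [dist_comm] at h2
      refine ENNReal.ofReal_le_ofReal (Real.rpow_le_rpow_of_nonpos
        (hpos s ⟨(htm i).1.trans hs.1.le, hsL⟩) ?_ (by linarith))
      linarith [hs.2]
    calc ENNReal.ofReal (d ^ α)
        ≤ ENNReal.ofReal 5 * (ENNReal.ofReal ((5 / 4 * d) ^ (α - 1)) * ENNReal.ofReal (d / 4)) := by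
          rw [← ENNReal.ofReal_mul (by positivity), ← ENNReal.ofReal_mul (by positivity)]
          refine ENNReal.ofReal_le_ofReal ?_
          rw [Real.mul_rpow (by norm_num) hd0.le, Real.rpow_sub_one hd0.ne']
          have h1 : (5 / 4 : ℝ) ^ (-1 : ℝ) ≤ (5 / 4 : ℝ) ^ (α - 1) :=
            Real.rpow_le_rpow_of_exponent_le (by norm_num) (by linarith)
          rw [Real.rpow_neg_one] at h1
          have h2 : 5 * ((5 / 4 : ℝ) ^ (α - 1) * (d ^ α / d) * (d / 4)) =
              5 / 4 * (5 / 4 : ℝ) ^ (α - 1) * d ^ α := by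
            field_simp
          rw [h2]
          have : 0 < d ^ α := by positivity
          norm_num at h1
          nlinarith
      _ = ENNReal.ofReal 5 * ∫⁻ s in Ioc (t i) (t i + d / 4),
            ENNReal.ofReal ((5 / 4 * d) ^ (α - 1)) := by
          rw [setLIntegral_const, Real.volume_Ioc]; congr 3; ring
      _ ≤ ENNReal.ofReal 5 * ∫⁻ s in Ioc (t i) (t i + d / 4), ENNReal.ofReal (δ (γ s) ^ (α - 1)) :=
          mul_le_mul' le_rfl (setLIntegral_mono' measurableSet_Ioc hval)
      _ ≤ _ := mul_le_mul' le_rfl (lintegral_mono_set (Ioc_subset_Ioc_right (by linarith)))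
  have hdisj : ((Finset.range (n + 1) : Finset ℕ) : Set ℕ).PairwiseDisjoint
      fun i => Ioc (t i) (t (i + 1)) :=
    fun i _ j _ hij => ht.pairwise_disjoint_on_Ioc_succ hij
  calc ENNReal.ofReal (∑ i ∈ Finset.range (n + 2), δ (γ (t i)) ^ α)
      ≤ ENNReal.ofReal (3 * ∑ i ∈ Finset.range (n + 1), δ (γ (t i)) ^ α) :=
        ENNReal.ofReal_le_ofReal hlast
    _ ≤ ENNReal.ofReal 3 * ∑ i ∈ Finset.range (n + 1), ENNReal.ofReal (δ (γ (t i)) ^ α) := by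
        rw [ENNReal.ofReal_mul (by norm_num)]
        exact mul_le_mul' le_rfl (Finset.le_sum_of_subadditive ENNReal.ofReal
          ENNReal.ofReal_zero.le (fun _ _ => ENNReal.ofReal_add_le) _ _)
    _ ≤ ENNReal.ofReal 3 * ∑ i ∈ Finset.range (n + 1), ENNReal.ofReal 5 *
          ∫⁻ s in Ioc (t i) (t (i + 1)), ENNReal.ofReal (δ (γ s) ^ (α - 1)) :=
        mul_le_mul' le_rfl (Finset.sum_le_sum hpiece)
    _ = ENNReal.ofReal 15 * ∫⁻ s in ⋃ i ∈ Finset.range (n + 1), Ioc (t i) (t (i + 1)),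
          ENNReal.ofReal (δ (γ s) ^ (α - 1)) := by
        rw [lintegral_biUnion_finset hdisj fun _ _ => measurableSet_Ioc, ← Finset.mul_sum,
          ← mul_assoc, ← ENNReal.ofReal_mul (by norm_num)]
        norm_num
    _ ≤ _ := by
        refine mul_le_mul' le_rfl (lintegral_mono_set (iUnion₂_subset fun i _ s hs => ?_))
        exact ⟨(htm i).1.trans hs.1.le, hs.2.trans (htm (i + 1)).2⟩

theorem length_le_of_cigar {α L s A : ℝ} (hα0 : 0 < α) (hα1 : α < 1) (hs : 0 < s) (hA : 0 < A)
    {γ : ℝ → Euc 2} (hγ : ∀ a b, 0 ≤ a → a ≤ b → b ≤ L → dist (γ a) (γ b) ≤ b - a)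
    {δ : Euc 2 → ℝ} (hδ : LipschitzWith 1 δ) (hpos : ∀ t ∈ Icc 0 L, 0 < δ (γ t))
    (h0 : δ (γ 0) ≤ 4 * s) (hsL : s ≤ L)
    (hcost : ∫⁻ t in Icc 0 L, ENNReal.ofReal (δ (γ t) ^ (α - 1)) ≤ ENNReal.ofReal (A * s ^ α)) :
    L ≤ (5 * A) ^ (1 / α) * s ∧ ∀ t ∈ Icc 0 L, δ (γ t) ≤ 5 * L := by
  have hL : 0 < L := hs.trans_le hsL
  have hδL : ∀ t ∈ Icc 0 L, δ (γ t) ≤ 5 * L := by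
    intro t ht
    have h1 := hδ.dist_le_mul (γ t) (γ 0)
    rw [Real.dist_eq, NNReal.coe_one, one_mul, dist_comm] at h1
    have h2 := hγ 0 t le_rfl ht.1 ht.2
    linarith [le_abs_self (δ (γ t) - δ (γ 0)), ht.2]
  refine ⟨?_, hδL⟩
  have h1 : ENNReal.ofReal (L * (5 * L) ^ (α - 1)) ≤ ENNReal.ofReal (A * s ^ α) := by
    refine le_trans ?_ hcost
    calc ENNReal.ofReal (L * (5 * L) ^ (α - 1))
        = ∫⁻ _ in Icc 0 L, ENNReal.ofReal ((5 * L) ^ (α - 1)) := by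
          rw [setLIntegral_const, Real.volume_Icc, sub_zero, mul_comm,
            ENNReal.ofReal_mul (by positivity)]
      _ ≤ _ := setLIntegral_mono' measurableSet_Icc fun t ht => ENNReal.ofReal_le_ofReal
          (Real.rpow_le_rpow_of_nonpos (hpos t ht) (hδL t ht) (by linarith))
  rw [ENNReal.ofReal_le_ofReal_iff (by positivity)] at h1
  have h2 : L ^ α ≤ 5 * A * s ^ α := by
    have h3 : (5 : ℝ) ^ (-1 : ℝ) ≤ 5 ^ (α - 1) :=
      Real.rpow_le_rpow_of_exponent_le (by norm_num) (by linarith)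
    rw [Real.rpow_neg_one] at h3
    have h4 : L * (5 * L) ^ (α - 1) = 5 ^ (α - 1) * L ^ α := by
      rw [Real.mul_rpow (by norm_num) hL.le, Real.rpow_sub_one hL.ne']; field_simp
    rw [h4] at h1
    have h5 : 0 < L ^ α := by positivity
    nlinarith
  have h3 : L = (L ^ α) ^ (1 / α) := by
    rw [← Real.rpow_mul hL.le, mul_one_div_cancel hα0.ne', Real.rpow_one]
  rw [h3]
  refine (Real.rpow_le_rpow (by positivity) h2 (by positivity)).trans_eq ?_
  rw [Real.mul_rpow (by positivity) (by positivity), ← Real.rpow_mul hs.le,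
    mul_one_div_cancel hα0.ne', Real.rpow_one]

theorem localSPHigh_of_isCigarDomain {p : ℝ} (hp : 2 < p) {Ω : Set (Euc 2)} (hO : IsOpen Ω)
    (hb : Bornology.IsBounded Ω) (h : IsCigarDomain Ω ((p - 2) / (p - 1))) :
    LocalSPHigh 2 Ω p := by
  have hp0 : 0 < p := by linarith
  have hα0 : 0 < (p - 2) / (p - 1) := div_pos (by linarith) (by linarith)
  have hα1 : (p - 2) / (p - 1) < 1 := (div_lt_one (by linarith)).2 (by linarith)
  obtain ⟨A, hA, hcig⟩ := h
  obtain ⟨C₁, hC₁, hM⟩ := exists_morrey_ball hp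
  obtain ⟨C₂, hC₂, hch⟩ := exists_abs_sub_le_of_chain hp
  set α := (p - 2) / (p - 1) with hα
  set M := (5 * A) ^ (1 / α) with hMdef
  have hM0 : 0 < M := by positivity
  have h1p : 0 ≤ 1 - 1 / p := by rw [sub_nonneg, div_le_one hp0]; linarith
  refine ⟨1 + C₁ + C₂ * (15 * A) ^ (1 - 1 / p), by
    have : 0 < C₂ * (15 * A) ^ (1 - 1 / p) := by positivity
    linarith, 3 + 5 * M, by linarith, fun u hu x hx r hr _ x₁ hx₁ x₂ hx₂ => ?_⟩
  set s := dist x₁ x₂ with hs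
  set δ : Euc 2 → ℝ := fun w => infDist w (frontier Ω) with hδdef
  have hδ : LipschitzWith 1 δ := lipschitz_infDist_pt _
  have hδpos : ∀ w ∈ Ω, 0 < δ w := fun w hw => infDist_frontier_pos hO hb hw
  set S := ball x ((3 + 5 * M) * r) ∩ Ω with hS
  have hSm : MeasurableSet S := measurableSet_ball.inter hO.measurableSet
  have hsr : s < 2 * r := by
    have := dist_triangle_right x₁ x₂ x
    linarith [mem_ball.1 hx₁.1, mem_ball.1 hx₂.1]
  have hu' : LocallyLipschitzOn Ω u := hu
  rcases eq_or_ne x₁ x₂ with heq | hne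
  · rw [heq]; simp
  have hs0 : 0 < s := dist_pos.2 hne
  rw [show (1 - ((2 : ℕ) : ℝ) / p) = 1 - 2 / p by norm_num]
  have hs2 : 0 < s ^ (1 - 2 / p) := by positivity
  have hX : 0 < C₂ * (15 * A) ^ (1 - 1 / p) := by positivity
  rcases le_or_gt s (δ x₁ / 4) with hnear | hfar
  · have hlt : s < infDist x₁ (frontier Ω) := by
      have := hδpos _ hx₁.2
      change s < δ x₁
      linarith
    have hsub := closedBall_subset_of_lt_infDist_frontier hO hx₁.2 hlt
    refine (hM u Ω hu' x₁ s hs0 hsub x₁ (mem_closedBall_self hs0.le) x₂ (by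
      rw [mem_closedBall, dist_comm])).trans ?_
    have hBS : ball x₁ s ⊆ S := by
      refine subset_inter (ball_subset_ball' ?_) (ball_subset_closedBall.trans hsub)
      nlinarith [mem_ball.1 hx₁.1]
    gcongr
    linarith
  · obtain ⟨L, hL, γ, hγ0, hγL, hγΩ, harc, hcost⟩ := hcig x₁ hx₁.2 x₂ hx₂.2
    have hγlip : ∀ a b, 0 ≤ a → a ≤ b → b ≤ L → dist (γ a) (γ b) ≤ b - a :=
      fun a b ha hab hb => harc.dist_le ha hab hb
    have hpos : ∀ t ∈ Icc 0 L, 0 < δ (γ t) := fun t ht => hδpos _ (hγΩ ht)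
    have hsL : s ≤ L := by
      have := hγlip 0 L le_rfl hL le_rfl
      rwa [hγ0, hγL, sub_zero] at this
    obtain ⟨hLM, hδL⟩ := length_le_of_cigar hα0 hα1 hs0 hA hγlip hδ hpos
      (by rw [hγ0]; linarith) hsL hcost
    obtain ⟨N, t, ht0, htN, htmono, htm, hstep, hsep⟩ :=
      exists_chain hL harc.continuousOn hδ.continuous hpos
    have hN : 2 ≤ N := by
      by_contra! hlt
      have h1 := hstep 0
      rw [ht0, hγ0] at h1
      interval_cases N
      · rw [ht0] at htN
        rw [← htN, hγ0] at hγL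
        exact hne hγL
      · rw [htN, hγL] at h1
        exact absurd h1 (not_le.2 hfar)
    have hclosed : ∀ i, closedBall (γ (t i)) (δ (γ (t i)) / 4) ⊆ Ω := fun i =>
      closedBall_subset_of_lt_infDist_frontier hO (hγΩ (htm i)) (by
        have := hpos _ (htm i)
        change δ (γ (t i)) / 4 < δ (γ (t i))
        linarith)
    have hmain := hch Ω u (fun i => γ (t i)) N δ S hu' hδ (fun i _ => hpos _ (htm i))
      (fun i _ => hclosed i) (fun i _ => hstep i) (chain_separated hδ hsep) hSm (fun i _ => by
        refine subset_inter (ball_subset_ball' ?_) (ball_subset_closedBall.trans (hclosed i))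
        have h1 := hγlip 0 (t i) le_rfl (htm i).1 (htm i).2
        rw [hγ0] at h1
        have h2 := dist_triangle_left (γ (t i)) x x₁
        have h3 := hδL _ (htm i)
        have h4 : L ≤ M * (2 * r) := hLM.trans (by gcongr)
        linarith [mem_ball.1 hx₁.1, (htm i).2])
    simp only [ht0, htN, hγ0, hγL] at hmain
    refine hmain.trans (mul_le_mul' (ENNReal.ofReal_le_ofReal ?_) le_rfl)
    have hsum := (sum_rpow_le_lintegral hα0 hα1 hγlip hδ hpos hN htmono htm hstep hsep).trans
      (mul_le_mul' le_rfl hcost)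
    rw [← ENNReal.ofReal_mul (by norm_num), ENNReal.ofReal_le_ofReal_iff (by positivity)] at hsum
    have hexp : α * (1 - 1 / p) = 1 - 2 / p := by
      rw [hα]
      have : p - 1 ≠ 0 := by linarith
      field_simp
    calc C₂ * (∑ i ∈ Finset.range N, δ (γ (t i)) ^ α) ^ (1 - 1 / p)
        ≤ C₂ * (15 * (A * s ^ α)) ^ (1 - 1 / p) := by
          gcongr
          exact Finset.sum_nonneg fun i _ => Real.rpow_nonneg (hpos _ (htm i)).le _
      _ = C₂ * (15 * A) ^ (1 - 1 / p) * s ^ (1 - 2 / p) := by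
          rw [← mul_assoc, Real.mul_rpow (by positivity) (by positivity), ← Real.rpow_mul hs0.le,
            hexp, mul_assoc]
      _ ≤ _ := by gcongr; linarith

theorem exists_path_ball_separation_of_isometry {E : Type*} [NormedAddCommGroup E] [NormedSpace ℝ E]
    (φ : E ≃ₗᵢ[ℝ] ℂ) {D : Set E} (hD : IsOpen D) (hconn : IsConnected D)
    (hb : Bornology.IsBounded D)
    (hlog : ∀ a ∈ frontier D, ∃ l : E → ℂ, ContinuousOn l D ∧ ∀ z ∈ D,
      Complex.exp (l z) = φ z - φ a) {x y : E} (hx : x ∈ D) (hy : y ∈ D) :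
    ∃ γ : ℝ → E, Continuous γ ∧ γ 0 = x ∧ γ 1 = y ∧ (∀ t, γ t ∈ D) ∧
      ∀ t, ∀ β ⊆ D, IsPreconnected β → x ∈ β → y ∈ β →
        ∃ z ∈ β, dist z (γ t) < 2 * infDist (γ t) (frontier D) := by
  have hfr : frontier (φ '' D) = φ '' frontier D := (φ.toHomeomorph.image_frontier D).symm
  obtain ⟨γ, hγ, h0, h1, hm, hsep⟩ := exists_path_ball_separation (D := φ '' D)
    (φ.toHomeomorph.isOpenMap D hD) (hconn.image φ φ.continuous.continuousOn)
    (φ.lipschitz.isBounded_image hb) (by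
      rw [hfr]
      rintro _ ⟨a, ha, rfl⟩
      obtain ⟨l, hl, hle⟩ := hlog a ha
      refine ⟨l ∘ φ.symm, hl.comp φ.symm.continuous.continuousOn ?_, ?_⟩
      · rintro _ ⟨z, hz, rfl⟩
        simpa using hz
      · rintro _ ⟨z, hz, rfl⟩
        simpa using hle z hz) (mem_image_of_mem φ hx) (mem_image_of_mem φ hy)
  refine ⟨φ.symm ∘ γ, φ.symm.continuous.comp hγ, by simp [h0], by simp [h1], fun t => ?_,
    fun t β hβ hpre hxβ hyβ => ?_⟩
  · obtain ⟨z, hz, he⟩ := hm t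
    simpa [← he] using hz
  · obtain ⟨_, ⟨z, hz, rfl⟩, hlt⟩ := hsep t (φ '' β) (image_mono hβ)
      (hpre.image φ φ.continuous.continuousOn) (mem_image_of_mem φ hxβ) (mem_image_of_mem φ hyβ)
    refine ⟨z, hz, ?_⟩
    have hγt : γ t = φ (φ.symm (γ t)) := by simp
    rw [hfr, hγt, infDist_image φ.isometry, φ.dist_map] at hlt
    exact hlt

theorem infDist_frontier_le_of_subset {E : Type*} [NormedAddCommGroup E] [NormedSpace ℝ E]
    [Nontrivial E] {D Ω : Set E} (hD : IsOpen D) (hO : IsOpen Ω) (hb : Bornology.IsBounded Ω)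
    (h : D ⊆ Ω) {z : E} (hz : z ∈ D) : infDist z (frontier D) ≤ infDist z (frontier Ω) := by
  by_contra! hlt
  obtain ⟨w, hw, hwd⟩ := (infDist_lt_iff (frontier_nonempty_of_isBounded hb ⟨z, h hz⟩)).1 hlt
  have := closedBall_subset_of_lt_infDist_frontier hD hz hwd (mem_closedBall'.2 le_rfl)
  exact (hO.frontier_eq ▸ hw).2 (h this)

theorem notMem_of_mem_frontier_connectedComponentIn {E : Type*} [TopologicalSpace E]
    [LocallyConnectedSpace E] {V : Set E} (hV : IsOpen V) {x a : E}
    (ha : a ∈ frontier (connectedComponentIn V x)) : a ∉ V := by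
  intro haV
  rw [hV.connectedComponentIn.frontier_eq] at ha
  obtain ⟨w, hw, hwx⟩ := mem_closure_iff.1 ha.1 _ (hV.connectedComponentIn (x := a))
    (mem_connectedComponentIn haV)
  apply ha.2
  rw [connectedComponentIn_eq hwx, ← connectedComponentIn_eq hw]
  exact mem_connectedComponentIn haV

theorem exists_log_sub {E : Type*} [NormedAddCommGroup E] [NormedSpace ℝ E]
    (φ : E ≃ₗᵢ[ℝ] ℂ) {Ω : Set E} (hO : IsOpen Ω) (hSC : SimplyConnectedSpace Ω) (x : E) {R : ℝ}
    {a : E} (ha : a ∉ Ω ∩ ball x R) :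
    ∃ l : E → ℂ, ContinuousOn l (Ω ∩ ball x R) ∧ ∀ z ∈ Ω ∩ ball x R,
      Complex.exp (l z) = φ z - φ a := by
  by_cases haΩ : a ∈ Ω
  · have hR : R ≤ dist a x := by
      by_contra! h
      exact ha ⟨haΩ, h⟩
    have key : ∀ z ∈ Ω ∩ ball x R, ‖(φ z - φ x) / (φ x - φ a)‖ < 1 := by
      intro z hz
      have h1 : dist z x < R := hz.2
      have h2 : 0 < dist a x := by linarith [dist_nonneg (x := z) (y := x)]
      rw [norm_div, ← dist_eq_norm, ← dist_eq_norm, φ.dist_map, φ.dist_map, dist_comm x a,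
        div_lt_one h2]
      linarith
    refine ⟨fun z => Complex.log (1 + (φ z - φ x) / (φ x - φ a)) + Complex.log (φ x - φ a), ?_, ?_⟩
    · refine ContinuousOn.add (ContinuousOn.clog ?_ fun z hz =>
        Complex.mem_slitPlane_of_norm_lt_one (key z hz)) continuousOn_const
      have := φ.continuous
      fun_prop
    · intro z hz
      have h1 : dist z x < R := hz.2
      have hne : φ x - φ a ≠ 0 := by
        rw [sub_ne_zero, φ.injective.ne_iff]
        rintro rfl
        rw [dist_self] at hR
        linarith [dist_nonneg (x := z) (y := x)]
      rw [Complex.exp_add, Complex.exp_log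
        (Complex.slitPlane_ne_zero (Complex.mem_slitPlane_of_norm_lt_one (key z hz))),
        Complex.exp_log hne]
      field_simp
      ring
  · have : LocallyPathConnectedSpace E := inferInstance
    obtain ⟨l, hl, he⟩ := Complex.exists_continuousOn_eqOn_exp_comp (U := Ω)
      (g := fun z => φ z - φ a)
      hSC hO (by have := φ.continuous; fun_prop) (by
        rintro ⟨z, hz, h⟩
        rw [sub_eq_zero, φ.injective.eq_iff] at h
        exact haΩ (h ▸ hz))
    exact ⟨l, hl.mono inter_subset_left, fun z hz => he hz.1⟩

/-- In a component `D` of `Ω ∩ B(x, R)` two points are joined by a curve such that every connected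
subset of `D` joining them passes close to each point of the curve, at the scale of `∂D`. -/
theorem exists_path_in_component {Ω : Set (Euc 2)} (hO : IsOpen Ω) (hSC : SimplyConnectedSpace Ω)
    {x y : Euc 2} {R : ℝ} (hy : y ∈ connectedComponentIn (Ω ∩ ball x R) x) :
    ∃ γ : ℝ → Euc 2, Continuous γ ∧ γ 0 = x ∧ γ 1 = y ∧
      (∀ t, γ t ∈ connectedComponentIn (Ω ∩ ball x R) x) ∧
      ∀ t, ∀ β ⊆ connectedComponentIn (Ω ∩ ball x R) x, IsPreconnected β → x ∈ β → y ∈ β →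
        ∃ z ∈ β, dist z (γ t) <
          2 * infDist (γ t) (frontier (connectedComponentIn (Ω ∩ ball x R) x)) := by
  have hV : IsOpen (Ω ∩ ball x R) := hO.inter isOpen_ball
  have hxV : x ∈ Ω ∩ ball x R := by
    by_contra h
    rw [connectedComponentIn_eq_empty h] at hy
    exact hy
  have hsub : connectedComponentIn (Ω ∩ ball x R) x ⊆ Ω ∩ ball x R :=
    connectedComponentIn_subset _ _
  refine exists_path_ball_separation_of_isometry Complex.orthonormalBasisOneI.repr.symm
    hV.connectedComponentIn (isConnected_connectedComponentIn_iff.2 hxV)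
    (isBounded_ball.subset (hsub.trans inter_subset_right)) (fun a ha => ?_)
    (mem_connectedComponentIn hxV) hy
  obtain ⟨l, hl, he⟩ := exists_log_sub Complex.orthonormalBasisOneI.repr.symm hO hSC x
    (notMem_of_mem_frontier_connectedComponentIn hV ha)
  exact ⟨l, hl.mono hsub, fun z hz => he z (hsub hz)⟩

theorem indicator_connectedComponentIn_eventuallyEq {E : Type*} [TopologicalSpace E]
    [LocallyConnectedSpace E] {W : Set E} (hW : IsOpen W) {x w : E} {f : E → ℝ}
    (h : w ∉ W → f =ᶠ[nhds w] 0) :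
    (connectedComponentIn W x).indicator f =ᶠ[nhds w] f ∨
      (connectedComponentIn W x).indicator f =ᶠ[nhds w] 0 := by
  by_cases hw : w ∈ W
  · by_cases hwE : w ∈ connectedComponentIn W x
    · left
      filter_upwards [hW.connectedComponentIn.mem_nhds hwE] with v hv
      exact indicator_of_mem hv f
    · right
      filter_upwards [hW.connectedComponentIn.mem_nhds (mem_connectedComponentIn hw)] with v hv
      refine indicator_of_notMem (fun hvx => hwE ?_) f
      rw [connectedComponentIn_eq hvx, ← connectedComponentIn_eq hv]
      exact mem_connectedComponentIn hw
  · right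
    filter_upwards [h hw] with v hv
    simp [hv]

/-- Truncation of a real number to `[0, 1]`. -/
def unitClamp (t : ℝ) : ℝ := max 0 (min 1 t)

theorem lipschitzWith_unitClamp : LipschitzWith 1 unitClamp :=
  (LipschitzWith.id.const_min 1).const_max 0

theorem unitClamp_of_one_le {t : ℝ} (h : 1 ≤ t) : unitClamp t = 1 := by
  rw [unitClamp, min_eq_left h, max_eq_right zero_le_one]

theorem unitClamp_of_nonpos {t : ℝ} (h : t ≤ 0) : unitClamp t = 0 := by
  rw [unitClamp, max_eq_left ((min_le_right _ _).trans h)]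

theorem unitClamp_nonneg (t : ℝ) : 0 ≤ unitClamp t := le_max_left _ _

theorem unitClamp_le_one (t : ℝ) : unitClamp t ≤ 1 := max_le zero_le_one (min_le_left _ _)

theorem lipschitzWith_unitClamp_dist {E : Type*} [PseudoMetricSpace E] (a : E) {d : ℝ} (hd : 0 < d)
    (c : ℝ) : LipschitzWith (Real.toNNReal (1 / d)) fun z => unitClamp (dist z a / d - c) := by
  refine LipschitzWith.of_dist_le_mul fun v w => ?_
  rw [Real.coe_toNNReal _ (by positivity)]
  have h := lipschitzWith_unitClamp.dist_le_mul (dist v a / d - c) (dist w a / d - c)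
  rw [NNReal.coe_one, one_mul] at h
  refine h.trans ?_
  rw [Real.dist_eq, sub_sub_sub_cancel_right, ← _root_.sub_div, abs_div, abs_of_pos hd,
    one_div_mul_eq_div]
  gcongr
  exact abs_dist_sub_le v w a

theorem lipschitzWith_unitClamp_sub_dist {E : Type*} [PseudoMetricSpace E] (a : E) {d : ℝ}
    (hd : 0 < d) (c : ℝ) :
    LipschitzWith (Real.toNNReal (1 / d)) fun z => unitClamp (c - dist z a / d) := by
  refine LipschitzWith.of_dist_le_mul fun v w => ?_
  rw [Real.coe_toNNReal _ (by positivity)]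
  have h := lipschitzWith_unitClamp.dist_le_mul (c - dist v a / d) (c - dist w a / d)
  rw [NNReal.coe_one, one_mul] at h
  refine h.trans ?_
  rw [Real.dist_eq, _root_.sub_sub_sub_cancel_left, ← _root_.sub_div, abs_div, abs_of_pos hd,
    one_div_mul_eq_div]
  gcongr
  rw [abs_sub_comm]
  exact abs_dist_sub_le v w a

theorem exists_lipschitzOnWith_indicator {E : Type*} [PseudoMetricSpace E] {A : Set E} {w : E}
    {f : E → ℝ} {K : ℝ≥0} (hf : LipschitzWith K f)
    (h : A.indicator f =ᶠ[nhds w] f ∨ A.indicator f =ᶠ[nhds w] 0) :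
    ∃ K, ∃ s ∈ nhds w, LipschitzOnWith K (A.indicator f) s := by
  rcases h with h | h
  · exact ⟨K, _, h, fun a ha b hb => by rw [ha, hb]; exact hf a b⟩
  · exact ⟨0, _, h, fun a ha b hb => by rw [ha, hb]; simp⟩

theorem eventually_abs_indicator_sub_le {E : Type*} [PseudoMetricSpace E] {A : Set E} {w : E}
    {f : E → ℝ} {c : ℝ} (hc : 0 ≤ c) (hf : ∀ᶠ v in nhds w, |f v - f w| ≤ c * dist v w)
    (h : A.indicator f =ᶠ[nhds w] f ∨ A.indicator f =ᶠ[nhds w] 0) :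
    ∀ᶠ v in nhds w, |A.indicator f v - A.indicator f w| ≤ c * dist v w := by
  rcases h with h | h
  · filter_upwards [h, hf] with v hv hfv
    rwa [hv, h.self_of_nhds]
  · filter_upwards [h] with v hv
    rw [hv, h.self_of_nhds]
    simpa using mul_nonneg hc dist_nonneg

theorem exists_component_cutoff {Ω : Set (Euc 2)} (hO : IsOpen Ω) {x : Euc 2} (hx : x ∈ Ω) {ρ : ℝ}
    (hρ : 0 < ρ) : ∃ g : Euc 2 → ℝ, (∀ w ∈ Ω, ∃ K, ∃ s ∈ nhds w, LipschitzOnWith K g s) ∧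
      g x = 1 ∧ (∀ y ∉ connectedComponentIn (Ω ∩ ball x (3 * ρ)) x, g y = 0) ∧
      ∀ w ∈ Ω ∩ ball x ρ, ∀ᶠ v in nhds w, |g v - g w| ≤ 0 * dist v w := by
  set W := Ω ∩ ball x (3 * ρ) with hWdef
  have hW : IsOpen W := hO.inter isOpen_ball
  have hxW : x ∈ W := ⟨hx, mem_ball_self (by positivity)⟩
  set f : Euc 2 → ℝ := fun z => unitClamp (2 - dist z x / ρ) with hf
  have hfl := lipschitzWith_unitClamp_sub_dist x hρ 2
  have hind : ∀ w ∈ Ω, (connectedComponentIn W x).indicator f =ᶠ[nhds w] f ∨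
      (connectedComponentIn W x).indicator f =ᶠ[nhds w] 0 := fun w hw =>
    indicator_connectedComponentIn_eventuallyEq hW fun hwW => by
      have h1 : 2 * ρ < dist w x := by
        by_contra! h
        exact hwW ⟨hw, by rw [mem_ball]; linarith⟩
      filter_upwards [(isOpen_lt continuous_const
        (continuous_id.dist continuous_const)).mem_nhds h1]
        with v hv
      refine unitClamp_of_nonpos ?_
      rw [sub_nonpos, le_div_iff₀ hρ]
      exact le_of_lt hv
  refine ⟨(connectedComponentIn W x).indicator f, fun w hw =>
    exists_lipschitzOnWith_indicator hfl (hind w hw), ?_,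
    fun y hy => indicator_of_notMem hy f, fun w hw => ?_⟩
  · rw [indicator_of_mem (mem_connectedComponentIn hxW), hf]
    exact unitClamp_of_one_le (by simp)
  · refine eventually_abs_indicator_sub_le le_rfl ?_ (hind w hw.1)
    have hone : ∀ v ∈ ball x ρ, f v = 1 := fun v hv => unitClamp_of_one_le (by
      have := (div_lt_one hρ).2 (mem_ball.1 hv)
      linarith)
    filter_upwards [isOpen_ball.mem_nhds hw.2] with v hv
    rw [hone v hv, hone w hw.2]
    simp

theorem exists_component_cutoff_off_ball {Ω : Set (Euc 2)} (hO : IsOpen Ω) {x : Euc 2} (hx : x ∈ Ω)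
    {ρ : ℝ} (hρ : 0 < ρ) {a : Euc 2} {d : ℝ} (hd : 0 < d) (hxa : 4 * d ≤ dist x a) :
    ∃ g : Euc 2 → ℝ, (∀ w ∈ Ω, ∃ K, ∃ s ∈ nhds w, LipschitzOnWith K g s) ∧ g x = 1 ∧
      (∀ y ∉ connectedComponentIn (Ω ∩ ball x (3 * ρ) ∩ {z | 2 * d < dist z a}) x, g y = 0) ∧
      ∀ w ∈ Ω ∩ ball x ρ, ∀ᶠ v in nhds w,
        |g v - g w| ≤ (if dist w a ≤ 4 * d then 1 / d else 0) * dist v w := by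
  set W := Ω ∩ ball x (3 * ρ) ∩ {z | 2 * d < dist z a} with hWdef
  have hopen : ∀ c, IsOpen {z : Euc 2 | c < dist z a} := fun c =>
    isOpen_lt continuous_const (continuous_id.dist continuous_const)
  have hW : IsOpen W := (hO.inter isOpen_ball).inter (hopen _)
  have hxW : x ∈ W := ⟨⟨hx, mem_ball_self (by positivity)⟩, by
    rw [mem_ofPred_eq]; linarith⟩
  set f₁ : Euc 2 → ℝ := fun z => unitClamp (dist z a / d - 3) with hf₁
  set f₂ : Euc 2 → ℝ := fun z => unitClamp (2 - dist z x / ρ) with hf₂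
  set f : Euc 2 → ℝ := fun z => min (f₁ z) (f₂ z) with hf
  have hf₁l : LipschitzWith (Real.toNNReal (1 / d)) f₁ := lipschitzWith_unitClamp_dist a hd 3
  have hfl := hf₁l.min (lipschitzWith_unitClamp_sub_dist x hρ 2)
  have hind : ∀ w ∈ Ω, (connectedComponentIn W x).indicator f =ᶠ[nhds w] f ∨
      (connectedComponentIn W x).indicator f =ᶠ[nhds w] 0 := fun w hw =>
    indicator_connectedComponentIn_eventuallyEq hW fun hwW => by
      by_cases h1 : 2 * ρ < dist w x
      · filter_upwards [(isOpen_lt continuous_const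
          (continuous_id.dist continuous_const)).mem_nhds h1] with v hv
        have h2 : f₂ v = 0 := unitClamp_of_nonpos (by
          rw [sub_nonpos, le_div_iff₀ hρ]
          exact le_of_lt hv)
        rw [hf]
        simp only [h2]
        exact min_eq_right (unitClamp_nonneg _)
      · have h2 : w ∈ ball a (3 * d) := by
          by_contra h
          rw [mem_ball] at h
          exact hwW ⟨⟨hw, by rw [mem_ball]; linarith⟩, by rw [mem_ofPred_eq]; linarith⟩
        filter_upwards [isOpen_ball.mem_nhds h2] with v hv
        have h3 : f₁ v = 0 := unitClamp_of_nonpos (by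
          rw [sub_nonpos, div_le_iff₀ hd]
          exact (mem_ball.1 hv).le)
        rw [hf]
        simp only [h3]
        exact min_eq_left (unitClamp_nonneg _)
  have hone : ∀ v ∈ ball x ρ, f v = f₁ v := fun v hv => by
    have h2 : f₂ v = 1 := unitClamp_of_one_le (by
      have := (div_lt_one hρ).2 (mem_ball.1 hv)
      linarith)
    rw [hf]
    simp only [h2]
    exact min_eq_left (unitClamp_le_one _)
  have hfar : ∀ v, 4 * d ≤ dist v a → f₁ v = 1 := fun v hv => unitClamp_of_one_le (by
    have := (le_div_iff₀ hd).2 hv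
    linarith)
  refine ⟨(connectedComponentIn W x).indicator f, fun w hw =>
    exists_lipschitzOnWith_indicator hfl (hind w hw), ?_,
    fun y hy => indicator_of_notMem hy f, fun w hw => ?_⟩
  · rw [indicator_of_mem (mem_connectedComponentIn hxW), hone x (mem_ball_self hρ), hfar x hxa]
  · refine eventually_abs_indicator_sub_le (by split_ifs <;> positivity) ?_ (hind w hw.1)
    split_ifs with hwa
    · filter_upwards [isOpen_ball.mem_nhds hw.2] with v hv
      rw [hone v hv, hone w hw.2]
      have := hf₁l.dist_le_mul v w
      rwa [Real.coe_toNNReal _ (by positivity)] at this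
    · filter_upwards [isOpen_ball.mem_nhds hw.2, (hopen _).mem_nhds (not_le.1 hwa)] with v hv hva
      rw [hone v hv, hone w hw.2, hfar v (le_of_lt hva), hfar w (le_of_lt (not_le.1 hwa))]
      simp

theorem exists_lipschitzOnWith_sum {E ι : Type*} [PseudoMetricSpace E] (s : Finset ι) (c : ι → ℝ)
    (g : ι → E → ℝ) (w : E) (h : ∀ i ∈ s, ∃ K, ∃ t ∈ nhds w, LipschitzOnWith K (g i) t) :
    ∃ K, ∃ t ∈ nhds w, LipschitzOnWith K (fun v => ∑ i ∈ s, c i * g i v) t := by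
  classical
  induction s using Finset.induction_on with
  | empty => exact ⟨0, univ, Filter.univ_mem, by simp⟩
  | insert i s hi ih =>
    obtain ⟨K, t, ht, hK⟩ := ih fun j hj => h j (Finset.mem_insert_of_mem hj)
    obtain ⟨K', t', ht', hK'⟩ := h i (Finset.mem_insert_self i s)
    refine ⟨‖c i‖₊ * K' + K, t' ∩ t, Filter.inter_mem ht' ht, ?_⟩
    simp only [Finset.sum_insert hi]
    refine LipschitzOnWith.add (LipschitzOnWith.of_dist_le_mul fun a ha b hb => ?_)
      (hK.mono inter_subset_right)
    rw [Real.dist_eq, ← mul_sub, abs_mul, NNReal.coe_mul, coe_nnnorm, Real.norm_eq_abs, mul_assoc]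
    gcongr
    exact hK'.dist_le_mul a ha.1 b hb.1

theorem exists_rpow_sum_le {p : ℝ} (hp : 2 < p) : ∃ K : ℝ, 0 < K ∧
    ∀ (s : Finset ℕ) (z : ℕ → Euc 2) (d : ℕ → ℝ), (∀ i ∈ s, 0 < d i) →
      (∀ i ∈ s, ∀ j ∈ s, i ≠ j → d i / 5 ≤ dist (z i) (z j)) → ∀ w : Euc 2,
      (∑ i ∈ s, if dist w (z i) ≤ 4 * d i then d i ^ ((p - 2) / (p - 1) - 1) else 0) ^ p ≤
        K * ∑ i ∈ s, if dist w (z i) ≤ 4 * d i then d i ^ ((p - 2) / (p - 1) - 2) else 0 := by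
  have hp1 : 0 < p - 1 := by linarith
  obtain ⟨K, hK, H⟩ := exists_sum_rpow_neg_le (κ := 4) (σ := 1 / (p - 1)) (by norm_num)
    (by positivity)
  refine ⟨K ^ p, by positivity, fun s z d hd hsep w => ?_⟩
  rw [← Finset.sum_filter, ← Finset.sum_filter]
  set s' := s.filter fun i => dist w (z i) ≤ 4 * d i with hs'
  have hmem : ∀ i ∈ s', i ∈ s ∧ dist w (z i) ≤ 4 * d i := fun i hi => Finset.mem_filter.1 hi
  rcases s'.eq_empty_or_nonempty with he | hne
  · rw [he]
    simp [Real.zero_rpow (show p ≠ 0 by linarith)]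
  obtain ⟨i₀, hi₀, hmin⟩ := s'.exists_min_image d hne
  have hd0 := hd i₀ (hmem i₀ hi₀).1
  have h1 := H s' z d w (d i₀) hd0 hmin
    (fun i hi j hj => hsep i (hmem i hi).1 j (hmem j hj).1) fun i hi => (hmem i hi).2
  have he1 : (p - 2) / (p - 1) - 1 = -(1 / (p - 1)) := by field_simp; ring
  have he2 : -(1 / (p - 1)) * p = (p - 2) / (p - 1) - 2 := by field_simp; ring
  rw [he1]
  calc (∑ i ∈ s', d i ^ (-(1 / (p - 1)))) ^ p ≤ (K * d i₀ ^ (-(1 / (p - 1)))) ^ p := by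
        refine Real.rpow_le_rpow (Finset.sum_nonneg fun i hi => ?_) h1 (by linarith)
        exact Real.rpow_nonneg (hd i (hmem i hi).1).le _
    _ = K ^ p * d i₀ ^ ((p - 2) / (p - 1) - 2) := by
        rw [Real.mul_rpow hK.le (by positivity), ← Real.rpow_mul hd0.le, he2]
    _ ≤ _ := by
        gcongr
        exact Finset.single_le_sum (f := fun i => d i ^ ((p - 2) / (p - 1) - 2))
          (fun i hi => Real.rpow_nonneg (hd i (hmem i hi).1).le _) hi₀

theorem lintegral_sum_ite_closedBall_le {s : Finset ℕ} {z : ℕ → Euc 2} {d : ℕ → ℝ} {α : ℝ}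
    (hd : ∀ i ∈ s, 0 < d i) :
    ∫⁻ w, ENNReal.ofReal (∑ i ∈ s, if dist w (z i) ≤ 4 * d i then d i ^ (α - 2) else 0) ≤
      ENNReal.ofReal (16 * Real.pi * ∑ i ∈ s, d i ^ α) := by
  have h1 : ∀ w, ENNReal.ofReal (∑ i ∈ s, if dist w (z i) ≤ 4 * d i then d i ^ (α - 2) else 0) =
      ∑ i ∈ s, (closedBall (z i) (4 * d i)).indicator (fun _ => ENNReal.ofReal (d i ^ (α - 2))) w :=
    fun w => by
      rw [ENNReal.ofReal_sum_of_nonneg fun i hi => by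
        have := hd i hi
        split_ifs <;> positivity]
      refine Finset.sum_congr rfl fun i _ => ?_
      by_cases h : dist w (z i) ≤ 4 * d i
      · rw [indicator_of_mem (mem_closedBall.2 h), if_pos h]
      · rw [indicator_of_notMem (by rwa [mem_closedBall]), if_neg h, ENNReal.ofReal_zero]
  simp only [h1]
  rw [lintegral_finsetSum _ fun i _ => measurable_const.indicator measurableSet_closedBall,
    Finset.mul_sum, ENNReal.ofReal_sum_of_nonneg fun i hi => by
      have := hd i hi
      positivity]
  refine Finset.sum_le_sum fun i hi => ?_
  have hdi := hd i hi
  rw [lintegral_indicator measurableSet_closedBall, setLIntegral_const,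
    EuclideanSpace.volume_closedBall_fin_two, ← ENNReal.ofReal_pow (by positivity),
    ← ENNReal.ofReal_mul (by positivity),
    ← ENNReal.ofReal_mul (by positivity)]
  refine ENNReal.ofReal_le_ofReal (le_of_eq ?_)
  have : d i ^ α = d i ^ (α - 2) * d i ^ 2 := by
    rw [← Real.rpow_natCast, ← Real.rpow_add hdi]; norm_num
  rw [this]
  ring

theorem le_of_le_mul_rpow_one_div {p A B s : ℝ} (hp : 2 < p) (hA : 0 ≤ A) (hB : 0 ≤ B) (hs : 0 ≤ s)
    (h : A ≤ B * s ^ (1 - 2 / p) * A ^ (1 / p)) :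
    A ≤ B ^ (p / (p - 1)) * s ^ ((p - 2) / (p - 1)) := by
  rcases hA.eq_or_lt with rfl | hA
  · positivity
  have hp1 : 0 < p - 1 := by linarith
  have h1 : A ^ (1 - 1 / p) ≤ B * s ^ (1 - 2 / p) := by
    rw [Real.rpow_sub hA, Real.rpow_one, div_le_iff₀ (by positivity)]
    exact h
  have he : (1 - 1 / p) * (p / (p - 1)) = 1 := by field_simp
  have he2 : (1 - 2 / p) * (p / (p - 1)) = (p - 2) / (p - 1) := by field_simp
  calc A = (A ^ (1 - 1 / p)) ^ (p / (p - 1)) := by rw [← Real.rpow_mul hA.le, he, Real.rpow_one]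
    _ ≤ (B * s ^ (1 - 2 / p)) ^ (p / (p - 1)) := by gcongr
    _ = _ := by rw [Real.mul_rpow hB (by positivity), ← Real.rpow_mul hs, he2]

theorem mem_connectedComponentIn_of_morrey {p : ℝ} (hp : 2 < p) {Ω : Set (Euc 2)} (hO : IsOpen Ω)
    {x y : Euc 2} (hx : x ∈ Ω) {ρ : ℝ} (hρ : 0 < ρ) {b : ℝ≥0∞}
    (hSP : ∀ u : Euc 2 → ℝ, LocallyLipschitzOnSet u Ω → ENNReal.ofReal |u x - u y| ≤
      b * (∫⁻ w in ball x ρ ∩ Ω, ENNReal.ofReal ‖fderiv ℝ u w‖ ^ p) ^ (1 / p)) :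
    y ∈ connectedComponentIn (Ω ∩ ball x (3 * ρ)) x := by
  by_contra hy
  have hp0 : 0 < p := by linarith
  obtain ⟨g, hg, hgx, hgy, hgs⟩ := exists_component_cutoff hO hx hρ
  have h := hSP g fun w hw => by
    obtain ⟨K, s, hs, hK⟩ := hg w hw
    exact ⟨K, s, mem_nhdsWithin_of_mem_nhds hs, hK⟩
  have h0 : ∫⁻ w in ball x ρ ∩ Ω, ENNReal.ofReal ‖fderiv ℝ g w‖ ^ p = 0 := by
    rw [setLIntegral_congr_fun (g := fun _ => 0) (measurableSet_ball.inter hO.measurableSet),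
      lintegral_zero]
    intro w hw
    have h1 : ‖fderiv ℝ g w‖ ≤ 0 := norm_fderiv_le_of_lip' ℝ le_rfl (by
      filter_upwards [hgs w hw.symm] with v hv
      rwa [dist_eq_norm] at hv)
    simp [le_antisymm h1 (norm_nonneg _), hp0]
  rw [h0, hgx, hgy y hy, ENNReal.zero_rpow_of_pos (by positivity), mul_zero] at h
  simp at h

theorem exists_sum_rpow_le_of_morrey {p : ℝ} (hp : 2 < p) : ∃ B : ℝ, 0 < B ∧
    ∀ (Ω : Set (Euc 2)), IsOpen Ω → ∀ x ∈ Ω, ∀ (y : Euc 2) (ρ C : ℝ), 0 < ρ → 0 ≤ C →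
      (∀ u : Euc 2 → ℝ, LocallyLipschitzOnSet u Ω → ENNReal.ofReal |u x - u y| ≤
        ENNReal.ofReal (C * dist x y ^ (1 - 2 / p)) *
          (∫⁻ w in ball x ρ ∩ Ω, ENNReal.ofReal ‖fderiv ℝ u w‖ ^ p) ^ (1 / p)) →
      ∀ (s : Finset ℕ) (z : ℕ → Euc 2) (d : ℕ → ℝ), (∀ i ∈ s, 0 < d i) →
      (∀ i ∈ s, ∀ j ∈ s, i ≠ j → d i / 5 ≤ dist (z i) (z j)) →
      (∀ i ∈ s, 4 * d i ≤ dist x (z i)) →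
      (∀ i ∈ s, y ∉ connectedComponentIn
        (Ω ∩ ball x (3 * ρ) ∩ {v | 2 * d i < dist v (z i)}) x) →
      ∑ i ∈ s, d i ^ ((p - 2) / (p - 1)) ≤
        (C * B) ^ (p / (p - 1)) * dist x y ^ ((p - 2) / (p - 1)) := by
  have hp0 : 0 < p := by linarith
  obtain ⟨K, hK, H⟩ := exists_rpow_sum_le hp
  refine ⟨(K * (16 * Real.pi)) ^ (1 / p), by positivity,
    fun Ω hO x hx y ρ C hρ hC hSP s z d hd hsep hfar hy => ?_⟩
  set α := (p - 2) / (p - 1) with hα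
  have hg : ∀ i, ∃ g : Euc 2 → ℝ, i ∈ s → (∀ w ∈ Ω, ∃ K, ∃ s ∈ nhds w, LipschitzOnWith K g s) ∧
      g x = 1 ∧ g y = 0 ∧ ∀ w ∈ Ω ∩ ball x ρ, ∀ᶠ v in nhds w,
        |g v - g w| ≤ (if dist w (z i) ≤ 4 * d i then 1 / d i else 0) * dist v w := fun i => by
    by_cases hi : i ∈ s
    · obtain ⟨g, h1, h2, h3, h4⟩ := exists_component_cutoff_off_ball hO hx hρ (hd i hi) (hfar i hi)
      exact ⟨g, fun _ => ⟨h1, h2, h3 y (hy i hi), h4⟩⟩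
    · exact ⟨0, fun h => absurd h hi⟩
  choose g hg using hg
  set A := ∑ i ∈ s, d i ^ α with hA
  have hA0 : 0 ≤ A := Finset.sum_nonneg fun i hi => Real.rpow_nonneg (hd i hi).le _
  set u : Euc 2 → ℝ := fun v => ∑ i ∈ s, d i ^ α * g i v with hu
  have hux : u x = A := Finset.sum_congr rfl fun i hi => by rw [(hg i hi).2.1, mul_one]
  have huy : u y = 0 := Finset.sum_eq_zero fun i hi => by rw [(hg i hi).2.2.1, mul_zero]
  have h := hSP u fun w hw => by
    obtain ⟨K, s, hs, hK⟩ := exists_lipschitzOnWith_sum s (fun i => d i ^ α) g w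
      fun i hi => (hg i hi).1 w hw
    exact ⟨K, s, mem_nhdsWithin_of_mem_nhds hs, hK⟩
  have hnn : ∀ w, 0 ≤ ∑ i ∈ s, if dist w (z i) ≤ 4 * d i then d i ^ (α - 1) else 0 := fun w =>
    Finset.sum_nonneg fun i hi => by
      have := hd i hi
      split_ifs <;> positivity
  have hslope : ∀ w ∈ Ω ∩ ball x ρ, ‖fderiv ℝ u w‖ ≤
      ∑ i ∈ s, if dist w (z i) ≤ 4 * d i then d i ^ (α - 1) else 0 := fun w hw => by
    refine norm_fderiv_le_of_lip' ℝ (hnn w) ?_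
    filter_upwards [(Finset.eventually_all s).2 fun i hi => (hg i hi).2.2.2 w hw] with v hv
    rw [Real.norm_eq_abs, ← Finset.sum_sub_distrib, Finset.sum_mul]
    refine (Finset.abs_sum_le_sum_abs _ _).trans (Finset.sum_le_sum fun i hi => ?_)
    have hdi := hd i hi
    have h1 := mul_le_mul_of_nonneg_left (hv i hi) (Real.rpow_nonneg hdi.le α)
    rw [← mul_sub, abs_mul, abs_of_nonneg (Real.rpow_nonneg hdi.le α), ← dist_eq_norm]
    refine h1.trans_eq ?_
    split_ifs
    · rw [Real.rpow_sub_one hdi.ne']; ring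
    · simp
  have hintg : ∫⁻ w in ball x ρ ∩ Ω, ENNReal.ofReal ‖fderiv ℝ u w‖ ^ p ≤
      ENNReal.ofReal (K * (16 * Real.pi) * A) := by
    calc ∫⁻ w in ball x ρ ∩ Ω, ENNReal.ofReal ‖fderiv ℝ u w‖ ^ p
        ≤ ∫⁻ w in ball x ρ ∩ Ω, ENNReal.ofReal K * ENNReal.ofReal (∑ i ∈ s,
            if dist w (z i) ≤ 4 * d i then d i ^ (α - 2) else 0) := by
          refine setLIntegral_mono' (measurableSet_ball.inter hO.measurableSet) fun w hw => ?_
          rw [ENNReal.ofReal_rpow_of_nonneg (norm_nonneg _) hp0.le, ← ENNReal.ofReal_mul hK.le]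
          refine ENNReal.ofReal_le_ofReal (le_trans ?_ (H s z d hd hsep w))
          exact Real.rpow_le_rpow (norm_nonneg _) (hslope w hw.symm) hp0.le
      _ ≤ ∫⁻ w, ENNReal.ofReal K * ENNReal.ofReal (∑ i ∈ s,
            if dist w (z i) ≤ 4 * d i then d i ^ (α - 2) else 0) := setLIntegral_le_lintegral _ _
      _ ≤ _ := by
          rw [lintegral_const_mul' _ _ ENNReal.ofReal_ne_top, mul_assoc, ENNReal.ofReal_mul hK.le]
          exact mul_le_mul' le_rfl (lintegral_sum_ite_closedBall_le hd)
  rw [hux, huy, sub_zero, abs_of_nonneg hA0] at h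
  have h2 := h.trans (mul_le_mul' le_rfl (ENNReal.rpow_le_rpow hintg (by positivity)))
  rw [ENNReal.ofReal_rpow_of_nonneg (by positivity) (by positivity),
    ← ENNReal.ofReal_mul (by positivity), ENNReal.ofReal_le_ofReal_iff (by positivity)] at h2
  refine le_of_le_mul_rpow_one_div hp hA0 (by positivity) dist_nonneg (h2.trans_eq ?_)
  rw [Real.mul_rpow (by positivity) hA0]
  ring

/-- `a` and `b` are joined in `Ω` by a curve of weighted length at most `c`. -/
def JoinedWithCost (Ω : Set (Euc 2)) (α : ℝ) (a b : Euc 2) (c : ℝ≥0∞) : Prop :=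
  ∃ L : ℝ, 0 ≤ L ∧ ∃ γ : ℝ → Euc 2,
    γ 0 = a ∧ γ L = b ∧ MapsTo γ (Icc 0 L) Ω ∧ ArclengthOn γ L ∧
    (∫⁻ t in Icc (0:ℝ) L, ENNReal.ofReal (infDist (γ t) (frontier Ω) ^ (α - 1)) ∂volume) ≤ c

theorem JoinedWithCost.refl {Ω : Set (Euc 2)} {α : ℝ} {a : Euc 2} (ha : a ∈ Ω) (c : ℝ≥0∞) :
    JoinedWithCost Ω α a a c := by
  refine ⟨0, le_rfl, fun _ => a, rfl, rfl, fun _ _ => ha, fun s t hs hst ht => ?_, ?_⟩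
  · rw [eVariationOn.subsingleton _ (by
      rw [le_antisymm (hst.trans ht) hs, le_antisymm ht (hs.trans hst), Icc_self]
      exact subsingleton_singleton), le_antisymm (hst.trans ht) hs, le_antisymm ht (hs.trans hst)]
    simp
  · simp

theorem arclengthOn_of_isometry {n : ℕ} {γ : ℝ → Euc n} (hγ : Isometry γ) (L : ℝ) :
    ArclengthOn γ L := by
  intro s t _ hst _
  refine le_antisymm ?_ ?_
  · have h := (hγ.lipschitz.lipschitzOnWith (s := univ)).comp_eVariationOn_le
      (g := id) (s := Icc s t) (mapsTo_univ _ _)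
    rw [Function.comp_id, ENNReal.coe_one, one_mul] at h
    have h2 := (monotone_id (α := ℝ)).monotoneOn (Icc s t) |>.eVariationOn_eq
      (left_mem_Icc.2 hst) (right_mem_Icc.2 hst)
    rw [inter_self] at h2
    exact h.trans h2.le
  · have h := eVariationOn.edist_le γ (left_mem_Icc.2 hst) (right_mem_Icc.2 hst)
    rwa [hγ.edist_eq, edist_dist, dist_comm, Real.dist_eq, abs_of_nonneg (sub_nonneg.2 hst)] at h

theorem joinedWithCost_segment {Ω : Set (Euc 2)} (hO : IsOpen Ω) {α d : ℝ} (hα0 : 0 < α)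
    (hα1 : α < 1) (hd : 0 < d) {a b : Euc 2} (ha : a ∈ Ω) (hda : d ≤ infDist a (frontier Ω))
    (hab : dist a b ≤ d / 4) : JoinedWithCost Ω α a b (ENNReal.ofReal (d ^ α)) := by
  rcases eq_or_ne a b with rfl | hne
  · exact .refl ha _
  set L := dist a b with hL
  have hL0 : 0 < L := dist_pos.2 hne
  set γ : ℝ → Euc 2 := fun t => a + (t / L) • (b - a) with hγ
  have hiso : Isometry γ := Isometry.of_dist_eq fun s t => by
    rw [hγ]
    simp only [dist_add_left]
    rw [dist_eq_norm, ← sub_smul, norm_smul, ← dist_eq_norm b a, dist_comm b a, ← hL,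
      ← _root_.sub_div, norm_div, Real.norm_of_nonneg hL0.le, div_mul_cancel₀ _ hL0.ne',
      dist_eq_norm]
  have hdist : ∀ t ∈ Icc 0 L, dist a (γ t) ≤ d / 4 := fun t ht => by
    have h0 : γ 0 = a := by simp [hγ]
    have h := hiso.dist_eq 0 t
    rw [h0, dist_comm 0 t, Real.dist_0_eq_abs, abs_of_nonneg ht.1] at h
    rw [h]
    exact ht.2.trans hab
  refine ⟨L, hL0.le, γ, by simp [hγ], by simp [hγ, div_self hL0.ne'], fun t ht =>
    closedBall_subset_of_lt_infDist_frontier hO ha (ρ := d / 4) (by linarith)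
      (mem_closedBall'.2 (hdist t ht)), arclengthOn_of_isometry hiso L, ?_⟩
  calc (∫⁻ t in Icc (0:ℝ) L, ENNReal.ofReal (infDist (γ t) (frontier Ω) ^ (α - 1)))
      ≤ ∫⁻ _ in Icc (0:ℝ) L, ENNReal.ofReal ((3 / 4 * d) ^ (α - 1)) := by
        refine setLIntegral_mono' measurableSet_Icc fun t ht => ENNReal.ofReal_le_ofReal
          (Real.rpow_le_rpow_of_nonpos (by positivity) ?_ (by linarith))
        have := infDist_le_infDist_add_dist (s := frontier Ω) (x := a) (y := γ t)
        linarith [hdist t ht]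
    _ ≤ _ := by
        rw [setLIntegral_const, Real.volume_Icc, sub_zero, ← ENNReal.ofReal_mul (by positivity)]
        refine ENNReal.ofReal_le_ofReal ?_
        have h1 : (3 / 4 : ℝ) ^ (α - 1) ≤ (3 / 4) ^ (-1 : ℝ) :=
          Real.rpow_le_rpow_of_exponent_ge (by norm_num) (by norm_num) (by linarith)
        rw [Real.rpow_neg_one] at h1
        have h2 : 0 < d ^ (α - 1) := by positivity
        have h3 : d ^ α = d ^ (α - 1) * d := by
          rw [Real.rpow_sub_one hd.ne', div_mul_cancel₀ _ hd.ne']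
        rw [Real.mul_rpow (by norm_num) hd.le, h3]
        calc (3 / 4 : ℝ) ^ (α - 1) * d ^ (α - 1) * L
            ≤ (3 / 4)⁻¹ * d ^ (α - 1) * (d / 4) := by gcongr
          _ ≤ d ^ (α - 1) * d := by nlinarith [mul_pos h2 hd]

theorem ArclengthOn.append {n : ℕ} {γ₁ γ₂ : ℝ → Euc n} {L₁ L₂ : ℝ} (h₁ : ArclengthOn γ₁ L₁)
    (h₂ : ArclengthOn γ₂ L₂) (h : γ₁ L₁ = γ₂ 0) :
    ArclengthOn (fun t => if t ≤ L₁ then γ₁ t else γ₂ (t - L₁)) (L₁ + L₂) := by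
  set γ := fun t => if t ≤ L₁ then γ₁ t else γ₂ (t - L₁) with hγ
  have hle : ∀ s t, 0 ≤ s → s ≤ t → t ≤ L₁ → eVariationOn γ (Icc s t) = ENNReal.ofReal (t - s) := by
    intro s t hs hst ht
    rw [← h₁ s t hs hst ht]
    exact eVariationOn.congr fun v hv => if_pos (hv.2.trans ht)
  have hge : ∀ s t, L₁ ≤ s → s ≤ t → t ≤ L₁ + L₂ →
      eVariationOn γ (Icc s t) = ENNReal.ofReal (t - s) := by
    intro s t hs hst ht
    have h3 : EqOn γ (γ₂ ∘ fun v => v - L₁) (Icc s t) := fun v hv => by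
      rcases (hs.trans hv.1).eq_or_lt with h' | h'
      · rw [← h']
        simp [hγ, h]
      · exact if_neg (not_le.2 h')
    rw [eVariationOn.congr h3, eVariationOn.comp_eq_of_monotoneOn _ _
      (fun a _ b _ hab => sub_le_sub_right hab L₁), image_sub_const_Icc,
      h₂ _ _ (by linarith) (by linarith) (by linarith), sub_sub_sub_cancel_right]
  intro s t hs hst ht
  rcases le_total t L₁ with h1 | h1
  · exact hle s t hs hst h1
  rcases le_total L₁ s with h2 | h2
  · exact hge s t h2 hst ht
  have := eVariationOn.Icc_add_Icc γ (s := univ) h2 h1 (mem_univ _)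
  simp only [univ_inter] at this
  rw [← this, hle s L₁ hs h2 le_rfl, hge L₁ t le_rfl h1 ht,
    ← ENNReal.ofReal_add (by linarith) (by linarith)]
  congr 1
  ring

theorem JoinedWithCost.trans {Ω : Set (Euc 2)} {α : ℝ} {a b e : Euc 2} {c₁ c₂ : ℝ≥0∞}
    (h₁ : JoinedWithCost Ω α a b c₁) (h₂ : JoinedWithCost Ω α b e c₂) :
    JoinedWithCost Ω α a e (c₁ + c₂) := by
  obtain ⟨L₁, hL₁, γ₁, h10, h1L, h1m, h1a, h1c⟩ := h₁
  obtain ⟨L₂, hL₂, γ₂, h20, h2L, h2m, h2a, h2c⟩ := h₂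
  set γ := fun t => if t ≤ L₁ then γ₁ t else γ₂ (t - L₁) with hγ
  have hle : ∀ t ≤ L₁, γ t = γ₁ t := fun t ht => if_pos ht
  have hge : ∀ t, L₁ ≤ t → γ t = γ₂ (t - L₁) := fun t ht => by
    rcases ht.eq_or_lt with rfl | ht
    · rw [hle _ le_rfl, sub_self, h1L, h20]
    · exact if_neg (not_le.2 ht)
  refine ⟨L₁ + L₂, by positivity, γ, by rw [hle 0 hL₁, h10], by
    rw [hge _ (by linarith), add_sub_cancel_left, h2L], fun t ht => ?_,
    h1a.append h2a (by rw [h1L, h20]), ?_⟩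
  · rcases le_total t L₁ with h | h
    · rw [hle t h]
      exact h1m ⟨ht.1, h⟩
    · rw [hge t h]
      exact h2m ⟨by linarith, by linarith [ht.2]⟩
  · rw [← Icc_union_Icc_eq_Icc hL₁ (by linarith : L₁ ≤ L₁ + L₂)]
    refine (lintegral_union_le _ _ _).trans (add_le_add ?_ ?_)
    · refine le_trans (le_of_eq ?_) h1c
      exact setLIntegral_congr_fun measurableSet_Icc fun t ht => by rw [hle t ht.2]
    · refine le_trans (le_of_eq ?_) h2c
      rw [setLIntegral_congr_fun (g := fun t =>
        ENNReal.ofReal (infDist (γ₂ (t - L₁)) (frontier Ω) ^ (α - 1))) measurableSet_Icc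
        fun t ht => by rw [hge t ht.1]]
      have := (measurePreserving_sub_right (volume : Measure ℝ) L₁).setLIntegral_comp_preimage_emb
        (MeasurableEquiv.subRight L₁).measurableEmbedding
        (fun t => ENNReal.ofReal (infDist (γ₂ t) (frontier Ω) ^ (α - 1))) (Icc 0 L₂)
      rw [← this, preimage_sub_const_Icc, zero_add, add_comm L₂]

theorem joinedWithCost_chain {Ω : Set (Euc 2)} (hO : IsOpen Ω) {α : ℝ} (hα0 : 0 < α) (hα1 : α < 1)
    {z : ℕ → Euc 2} {d : ℕ → ℝ} (hz : ∀ i, z i ∈ Ω) (hd : ∀ i, 0 < d i)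
    (hdz : ∀ i, d i ≤ infDist (z i) (frontier Ω)) (hstep : ∀ i, dist (z i) (z (i + 1)) ≤ d i / 4)
    (N : ℕ) : JoinedWithCost Ω α (z 0) (z N) (ENNReal.ofReal (∑ i ∈ Finset.range N, d i ^ α)) := by
  induction N with
  | zero => exact .refl (hz 0) _
  | succ N ih =>
    rw [Finset.sum_range_succ, ENNReal.ofReal_add (Finset.sum_nonneg fun i _ =>
      Real.rpow_nonneg (hd i).le _) (Real.rpow_nonneg (hd N).le _)]
    exact ih.trans (joinedWithCost_segment hO hα0 hα1 (hd N) (hz N) (hdz N) (hstep N))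

theorem dist_lt_diam {E : Type*} [NormedAddCommGroup E] [NormedSpace ℝ E] {Ω : Set E}
    (hO : IsOpen Ω) (hb : Bornology.IsBounded Ω) {x y : E} (hx : x ∈ Ω) (hy : y ∈ Ω) (hne : x ≠ y) :
    dist x y < diam Ω := by
  have hlim : Filter.Tendsto (fun t : ℝ => y + t • (y - x)) (nhdsWithin 0 (Ioi 0)) (nhds y) := by
    have : Continuous fun t : ℝ => y + t • (y - x) := by fun_prop
    simpa using (this.tendsto 0).mono_left nhdsWithin_le_nhds
  obtain ⟨t, ht, ht0⟩ := ((hlim.eventually (hO.mem_nhds hy)).and self_mem_nhdsWithin).exists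
  have ht0 : 0 < t := ht0
  refine lt_of_lt_of_le ?_ (dist_le_diam_of_mem hb hx ht)
  have h : dist x (y + t • (y - x)) = (1 + t) * dist x y := by
    rw [dist_comm, dist_eq_norm, dist_comm x y, dist_eq_norm,
      show y + t • (y - x) - x = (1 + t) • (y - x) by module, norm_smul,
      Real.norm_of_nonneg (by linarith)]
  rw [h]
  nlinarith [dist_pos.2 hne]

theorem infDist_frontier_le_of_subset_ball {E : Type*} [NormedAddCommGroup E] [NormedSpace ℝ E]
    [Nontrivial E] {D : Set E} {x z : E} {R : ℝ} (h : D ⊆ ball x R) (hz : z ∈ D) :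
    infDist z (frontier D) ≤ 2 * R := by
  obtain ⟨a, ha⟩ := frontier_nonempty_of_isBounded (isBounded_ball.subset h) ⟨z, hz⟩
  have h1 : a ∈ closedBall x R :=
    closure_minimal (h.trans ball_subset_closedBall) isClosed_closedBall
      (frontier_subset_closure ha)
  have h2 := infDist_le_dist_of_mem (x := z) ha
  have h3 := dist_triangle_right z a x
  linarith [mem_closedBall.1 h1, mem_ball.1 (h hz)]

theorem isCigarDomain_of_localSPHigh {p : ℝ} (hp : 2 < p) {Ω : Set (Euc 2)} (hO : IsOpen Ω)
    (hb : Bornology.IsBounded Ω) (hSC : SimplyConnectedSpace Ω) (h : LocalSPHigh 2 Ω p) :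
    IsCigarDomain Ω ((p - 2) / (p - 1)) := by
  have hα0 : 0 < (p - 2) / (p - 1) := div_pos (by linarith) (by linarith)
  have hα1 : (p - 2) / (p - 1) < 1 := (div_lt_one (by linarith)).2 (by linarith)
  obtain ⟨C, hC, lam, hlam, hSP⟩ := h
  obtain ⟨B, hB, hfarsum⟩ := exists_sum_rpow_le_of_morrey hp
  obtain ⟨K, hK, hnearsum⟩ := exists_sum_rpow_le (κ := 4) (by norm_num) hα0 (by linarith)
  set α := (p - 2) / (p - 1) with hα
  refine ⟨(C * B) ^ (p / (p - 1)) + K * (12 * lam) ^ α, by positivity, fun x hx y hy => ?_⟩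
  change JoinedWithCost Ω α x y _
  rcases eq_or_ne x y with rfl | hne
  · exact .refl hx _
  have hs := dist_pos.2 hne
  obtain ⟨r, hsr, hr⟩ := exists_between
    (lt_min (by linarith : dist x y < 2 * dist x y) (dist_lt_diam hO hb hx hy hne))
  obtain ⟨hr2, hrd⟩ := lt_min_iff.1 hr
  have hr0 : 0 < r := hs.trans hsr
  have hρ : 0 < lam * r := by positivity
  have hSPxy : ∀ u : Euc 2 → ℝ, LocallyLipschitzOnSet u Ω → ENNReal.ofReal |u x - u y| ≤
      ENNReal.ofReal (C * dist x y ^ (1 - 2 / p)) *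
        (∫⁻ w in ball x (lam * r) ∩ Ω, ENNReal.ofReal ‖fderiv ℝ u w‖ ^ p) ^ (1 / p) := fun u hu =>
    hSP u hu x hx r hr0 hrd x ⟨mem_ball_self hr0, hx⟩ y ⟨mem_ball'.2 hsr, hy⟩
  set D := connectedComponentIn (Ω ∩ ball x (3 * (lam * r))) x with hDdef
  have hD : IsOpen D := (hO.inter isOpen_ball).connectedComponentIn
  have hDsub : D ⊆ Ω ∩ ball x (3 * (lam * r)) := connectedComponentIn_subset _ _
  have hDb : Bornology.IsBounded D := hb.subset (hDsub.trans inter_subset_left)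
  obtain ⟨γ, hγ, h0, h1, hm, hsepar⟩ := exists_path_in_component hO hSC
    (mem_connectedComponentIn_of_morrey hp hO hx hρ hSPxy)
  set δ : Euc 2 → ℝ := fun w => infDist w (frontier D) with hδdef
  have hδ : LipschitzWith 1 δ := lipschitz_infDist_pt _
  have hpos : ∀ w ∈ D, 0 < δ w := fun w hw => infDist_frontier_pos hD hDb hw
  obtain ⟨N, t, ht0, htN, -, -, hstep, hsep⟩ :=
    exists_chain zero_le_one hγ.continuousOn hδ.continuous fun t _ => hpos _ (hm t)
  have hsep' := chain_separated (z := fun i => γ (t i)) hδ hsep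
  have hchain := joinedWithCost_chain hO hα0 hα1 (z := fun i => γ (t i)) (d := fun i => δ (γ (t i)))
    (fun i => (hDsub (hm _)).1) (fun i => hpos _ (hm _))
    (fun i => infDist_frontier_le_of_subset hD hO hb (hDsub.trans inter_subset_left) (hm _)) hstep N
  simp only [ht0, htN, h0, h1] at hchain
  obtain ⟨L, hL, c, hc0, hcL, hcm, hca, hcost⟩ := hchain
  refine ⟨L, hL, c, hc0, hcL, hcm, hca, hcost.trans (ENNReal.ofReal_le_ofReal ?_)⟩
  rw [← Finset.sum_filter_add_sum_filter_not _ (fun i => 4 * δ (γ (t i)) ≤ dist x (γ (t i))),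
    add_mul]
  refine add_le_add ?_ ?_
  · refine hfarsum Ω hO x hx y (lam * r) C hρ (by linarith) hSPxy _ (fun i => γ (t i))
      (fun i => δ (γ (t i))) (fun i _ => hpos _ (hm _)) (fun i hi j hj => ?_)
      (fun i hi => (Finset.mem_filter.1 hi).2) fun i hi hyE => ?_
    · exact hsep' i (Finset.mem_range.1 (Finset.mem_filter.1 hi).1) j
        (Finset.mem_range.1 (Finset.mem_filter.1 hj).1)
    · have hfar := (Finset.mem_filter.1 hi).2
      have hd := hpos _ (hm (t i))
      have hsub := connectedComponentIn_subset
        (Ω ∩ ball x (3 * (lam * r)) ∩ {v | 2 * δ (γ (t i)) < dist v (γ (t i))}) x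
      obtain ⟨v, hv, hlt⟩ := hsepar (t i) _ (connectedComponentIn_mono x inter_subset_left)
        isPreconnected_connectedComponentIn (mem_connectedComponentIn
          ⟨⟨hx, mem_ball_self (by positivity)⟩, by
            change 2 * δ (γ (t i)) < dist x (γ (t i))
            linarith⟩) hyE
      exact lt_asymm hlt (hsub hv).2
  · have := hnearsum ((Finset.range N).filter fun i => ¬ 4 * δ (γ (t i)) ≤ dist x (γ (t i)))
      (fun i => γ (t i)) (fun i => δ (γ (t i))) x (12 * lam * dist x y) (by positivity)
      (fun i _ => hpos _ (hm _)) (fun i _ => ?_) (fun i hi j hj => ?_)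
      fun i hi => (not_le.1 (Finset.mem_filter.1 hi).2).le
    · rwa [Real.mul_rpow (by positivity) hs.le, ← mul_assoc] at this
    · have h1 := infDist_frontier_le_of_subset_ball (hDsub.trans inter_subset_right) (hm (t i))
      refine h1.trans ?_
      nlinarith
    · exact hsep' i (Finset.mem_range.1 (Finset.mem_filter.1 hi).1) j
        (Finset.mem_range.1 (Finset.mem_filter.1 hj).1)

/-- a bounded simply connected planar domain is a local
Sobolev–Poincaré imbedding domain of order `p`, `2 < p < ∞`, iff it is an
`(p-2)/(p-1)`-cigar domain. -/
theorem stmt8 (p : ℝ) (hp : 2 < p)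
    (Ω : Set (Euc 2)) (hOpen : IsOpen Ω)
    (hConn : IsConnected Ω) (hBdd : Bornology.IsBounded Ω)
    (hSC : SimplyConnectedSpace Ω) :
    LocalSPHigh 2 Ω p ↔ IsCigarDomain Ω ((p - 2) / (p - 1)) := by
  exact ⟨isCigarDomain_of_localSPHigh hp hOpen hBdd hSC,
    localSPHigh_of_isCigarDomain hp hOpen hBdd⟩
end
end

section
/- Let n ≥ 2 and let Ω ⊂ ℝⁿ be a bounded domain which is a local Sobolev–Poincaré imbedding domain of order n, i.e. there exist constants C ≥ 1, λ ≥ 1 and A > 0 such that for every locally Lipschitz function u : Ω → ℝ, every x ∈ Ω and every 0 < r < diam(Ω) with 0 < ∫_{B(x,λr)∩Ω} |∇u(y)|ⁿ dy < ∞, one has inf_{c∈ℝ} ∫_{B(x,r)∩Ω} exp( (A |u(y) − c| / (∫_{B(x,λr)∩Ω} |∇u(z)|ⁿ dz)^{1/n})^{n/(n−1)} ) dy ≤ C |B(x,r)|. Then Ω is intrinsic Ahlfors n-regular. -/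
open Set Metric MeasureTheory ENNReal NNReal

noncomputable section

section IntrinsicDistance

variable {n : ℕ} {Ω : Set (Euc n)} {x y z : Euc n}

lemma edist_le_intrinsicDist : edist x y ≤ intrinsicDist Ω x y := by
  refine le_iInf₂ fun γ hγ => ?_
  have h := eVariationOn.edist_le γ (s := Icc (0 : ℝ) 1) (x := 0) (y := 1) (by simp) (by simp)
  rwa [hγ.2.1, hγ.2.2.1] at h

lemma intrinsicDist_le_eVariationOn {γ : ℝ → Euc n} (hc : ContinuousOn γ (Icc 0 1))
    (h₀ : γ 0 = x) (h₁ : γ 1 = y) (hm : MapsTo γ (Icc 0 1) Ω) :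
    intrinsicDist Ω x y ≤ eVariationOn γ (Icc 0 1) :=
  iInf₂_le γ ⟨hc, h₀, h₁, hm⟩

lemma intrinsicDist_le_edist (h : segment ℝ x y ⊆ Ω) : intrinsicDist Ω x y ≤ edist x y := by
  have hlip : LipschitzWith (nndist x y) (AffineMap.lineMap x y : ℝ → Euc n) :=
    lipschitzWith_lineMap x y
  refine (intrinsicDist_le_eVariationOn (γ := AffineMap.lineMap x y)
    hlip.continuous.continuousOn (by simp) (by simp) fun t ht => h ?_).trans ?_
  · rw [segment_eq_image_lineMap]
    exact mem_image_of_mem _ ht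
  · have h1 := (hlip.lipschitzOnWith (s := univ)).comp_eVariationOn_le (g := (id : ℝ → ℝ))
      (s := Icc 0 1) (mapsTo_univ _ _)
    have h2 := (monotone_id (α := ℝ)).monotoneOn (univ) |>.eVariationOn_eq
      (mem_univ 0) (mem_univ 1)
    rw [univ_inter] at h2
    refine h1.trans ((mul_le_mul_right h2.le _).trans ?_)
    simp

lemma intrinsicDist_triangle :
    intrinsicDist Ω x z ≤ intrinsicDist Ω x y + intrinsicDist Ω y z := by
  have key : ∀ γ₁ γ₂ : ℝ → Euc n,
      (ContinuousOn γ₁ (Icc 0 1) ∧ γ₁ 0 = x ∧ γ₁ 1 = y ∧ MapsTo γ₁ (Icc 0 1) Ω) →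
      (ContinuousOn γ₂ (Icc 0 1) ∧ γ₂ 0 = y ∧ γ₂ 1 = z ∧ MapsTo γ₂ (Icc 0 1) Ω) →
      intrinsicDist Ω x z ≤ eVariationOn γ₁ (Icc 0 1) + eVariationOn γ₂ (Icc 0 1) := by
    rintro γ₁ γ₂ ⟨c₁, a₁, b₁, m₁⟩ ⟨c₂, a₂, b₂, m₂⟩
    set γ : ℝ → Euc n := fun t => if t ≤ 1 / 2 then γ₁ (2 * t) else γ₂ (2 * t - 1) with hγ
    have e₁ : EqOn γ (γ₁ ∘ fun t => 2 * t) (Icc 0 (1 / 2)) := fun t ht => if_pos ht.2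
    have e₂ : EqOn γ (γ₂ ∘ fun t => 2 * t - 1) (Icc (1 / 2) 1) := by
      intro t ht
      rcases ht.1.eq_or_lt with rfl | h
      · norm_num [hγ, b₁, a₂]
      · exact if_neg (not_le.2 h)
    have t₁ : MapsTo (fun t : ℝ => 2 * t) (Icc 0 (1 / 2)) (Icc 0 1) := by
      intro t ht
      constructor <;> linarith [ht.1, ht.2]
    have t₂ : MapsTo (fun t : ℝ => 2 * t - 1) (Icc (1 / 2) 1) (Icc 0 1) := by
      intro t ht
      constructor <;> linarith [ht.1, ht.2]
    have hu : Icc (0 : ℝ) 1 = Icc 0 (1 / 2) ∪ Icc (1 / 2) 1 :=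
      (Icc_union_Icc_eq_Icc (by norm_num) (by norm_num)).symm
    have k₁ : ContinuousOn γ (Icc 0 (1 / 2)) :=
      (c₁.comp (by fun_prop) t₁).congr e₁
    have k₂ : ContinuousOn γ (Icc (1 / 2) 1) :=
      (c₂.comp (by fun_prop) t₂).congr e₂
    refine (intrinsicDist_le_eVariationOn (γ := γ) ?_ ?_ ?_ ?_).trans ?_
    · rw [hu]
      exact k₁.union_of_isClosed k₂ isClosed_Icc isClosed_Icc
    · simp [hγ, a₁]
    · norm_num [hγ, b₂]
    · rw [hu]
      exact MapsTo.union ((m₁.comp t₁).congr e₁.symm) ((m₂.comp t₂).congr e₂.symm)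
    · have h := eVariationOn.Icc_add_Icc γ (s := univ) (a := 0) (b := (1 / 2 : ℝ)) (c := 1)
        (by norm_num) (by norm_num) (mem_univ _)
      simp only [univ_inter] at h
      rw [← h, eVariationOn.congr e₁, eVariationOn.congr e₂]
      refine add_le_add (eVariationOn.comp_le_of_monotoneOn _ _ ?_ t₁)
        (eVariationOn.comp_le_of_monotoneOn _ _ ?_ t₂)
      · intro s _ t _ hst
        dsimp only
        linarith
      · intro s _ t _ hst
        dsimp only
        linarith
  conv_rhs => rw [intrinsicDist, intrinsicDist]
  simp only [ENNReal.iInf_add, ENNReal.add_iInf]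
  exact le_iInf₂ fun γ₂ h₂ => le_iInf₂ fun γ₁ h₁ => key _ _ (by assumption) (by assumption)

lemma intrinsicDist_le_add_edist {w : Euc n} {τ : ℝ} (hτ : ball w τ ⊆ Ω)
    (hy : y ∈ ball w τ) (hz : z ∈ ball w τ) :
    intrinsicDist Ω x z ≤ intrinsicDist Ω x y + edist y z :=
  intrinsicDist_triangle.trans (add_le_add le_rfl (intrinsicDist_le_edist
    (((convex_ball w τ).segment_subset hy hz).trans hτ)))

lemma intrinsicDist_eq_edist {τ : ℝ} (hτ : ball x τ ⊆ Ω) (hy : y ∈ ball x τ) :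
    intrinsicDist Ω x y = edist x y :=
  le_antisymm (intrinsicDist_le_edist (((convex_ball x τ).segment_subset
    (mem_ball_self (dist_nonneg.trans_lt hy)) hy).trans hτ)) edist_le_intrinsicDist

lemma intrinsicDist_lt_top (hO : IsOpen Ω) (hC : IsPreconnected Ω) (hx : x ∈ Ω) (hy : y ∈ Ω) :
    intrinsicDist Ω x y < ⊤ := by
  have hxx : intrinsicDist Ω x x < ⊤ :=
    (intrinsicDist_le_edist (by simpa using hx)).trans_lt (by simp)
  have hU : IsOpen {y ∈ Ω | intrinsicDist Ω x y < ⊤} := by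
    refine Metric.isOpen_iff.2 fun w hw => ?_
    obtain ⟨τ, hτ, hb⟩ := Metric.isOpen_iff.1 hO w hw.1
    refine ⟨τ, hτ, fun z hz => ⟨hb hz, ?_⟩⟩
    exact (intrinsicDist_le_add_edist hb (mem_ball_self hτ) hz).trans_lt
      (ENNReal.add_lt_top.2 ⟨hw.2, edist_lt_top _ _⟩)
  have hV : IsOpen {y ∈ Ω | ¬ intrinsicDist Ω x y < ⊤} := by
    refine Metric.isOpen_iff.2 fun w hw => ?_
    obtain ⟨τ, hτ, hb⟩ := Metric.isOpen_iff.1 hO w hw.1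
    refine ⟨τ, hτ, fun z hz => ⟨hb hz, fun hlt => hw.2 ?_⟩⟩
    exact (intrinsicDist_le_add_edist hb hz (mem_ball_self hτ)).trans_lt
      (ENNReal.add_lt_top.2 ⟨hlt, edist_lt_top _ _⟩)
  refine (hC.subset_left_of_subset_union hU hV ?_ ?_ ⟨x, hx, hx, hxx⟩ hy).2
  · exact disjoint_left.2 fun w h1 h2 => h2.2 h1.2
  · intro w hw
    by_cases h : intrinsicDist Ω x w < ⊤
    · exact Or.inl ⟨hw, h⟩
    · exact Or.inr ⟨hw, h⟩

lemma isOpen_intrinsicBall (hO : IsOpen Ω) (r : ℝ) : IsOpen (intrinsicBall Ω x r) := by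
  refine Metric.isOpen_iff.2 fun w hw => ?_
  obtain ⟨τ, hτ, hb⟩ := Metric.isOpen_iff.1 hO w hw.1
  obtain ⟨ε, hε, hlt⟩ : ∃ ε : ℝ, 0 < ε ∧
      intrinsicDist Ω x w + ENNReal.ofReal ε < ENNReal.ofReal r := by
    obtain ⟨δ, hδ, h⟩ := ENNReal.lt_iff_exists_add_pos_lt.1 hw.2
    exact ⟨δ, by exact_mod_cast hδ, by simpa using h⟩
  refine ⟨min τ ε, lt_min hτ hε, fun z hz => ⟨hb (ball_subset_ball (min_le_left _ _) hz), ?_⟩⟩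
  refine (intrinsicDist_le_add_edist hb (mem_ball_self hτ)
    (ball_subset_ball (min_le_left _ _) hz)).trans_lt (lt_of_le_of_lt ?_ hlt)
  refine add_le_add le_rfl ?_
  rw [edist_comm, edist_dist]
  exact ENNReal.ofReal_le_ofReal (le_of_lt (lt_of_lt_of_le hz (min_le_right _ _)))

lemma intrinsicBall_subset (r : ℝ) : intrinsicBall Ω x r ⊆ Ω := fun _ h => h.1

lemma intrinsicBall_subset_ball (r : ℝ) : intrinsicBall Ω x r ⊆ ball x r := by
  intro y hy
  have h := edist_le_intrinsicDist.trans_lt hy.2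
  rw [edist_dist, ENNReal.ofReal_lt_ofReal_iff_of_nonneg dist_nonneg] at h
  rwa [mem_ball, dist_comm]

lemma intrinsicBall_mono {r s : ℝ} (h : r ≤ s) : intrinsicBall Ω x r ⊆ intrinsicBall Ω x s :=
  fun _ hy => ⟨hy.1, hy.2.trans_le (ENNReal.ofReal_le_ofReal h)⟩

lemma ball_subset_intrinsicBall {r : ℝ} (h : ball x r ⊆ Ω) : ball x r ⊆ intrinsicBall Ω x r := by
  intro y hy
  refine ⟨h hy, ?_⟩
  have hd : dist x y < r := by rwa [dist_comm]
  rw [intrinsicDist_eq_edist h hy, edist_dist]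
  exact (ENNReal.ofReal_lt_ofReal_iff (dist_nonneg.trans_lt hd)).2 hd

end IntrinsicDistance

section TruncatedDistance

/-- The intrinsic distance to `x`, truncated at height `ρ`. -/
def truncDist {n : ℕ} (Ω : Set (Euc n)) (x : Euc n) (ρ : ℝ) (y : Euc n) : ℝ :=
  min (intrinsicDist Ω x y).toReal ρ

variable {n : ℕ} {Ω : Set (Euc n)} {x y z : Euc n} {ρ : ℝ}

lemma truncDist_le (y : Euc n) : truncDist Ω x ρ y ≤ ρ := min_le_right _ _

lemma truncDist_lt_of_mem {r : ℝ} (hy : y ∈ intrinsicBall Ω x r) : truncDist Ω x ρ y < r := by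
  refine (min_le_left _ _).trans_lt ?_
  have h : 0 < ENNReal.ofReal r := bot_le.trans_lt hy.2
  have h2 := (ENNReal.toReal_lt_toReal (hy.2.trans_le le_top).ne ENNReal.ofReal_ne_top).2 hy.2
  rwa [ENNReal.toReal_ofReal (ENNReal.ofReal_pos.1 h).le] at h2

lemma truncDist_eq_of_notMem (hO : IsOpen Ω) (hC : IsPreconnected Ω) (hx : x ∈ Ω)
    (hy : y ∈ Ω) (h : y ∉ intrinsicBall Ω x ρ) : truncDist Ω x ρ y = ρ := by
  have h1 : ENNReal.ofReal ρ ≤ intrinsicDist Ω x y := not_lt.1 fun hlt => h ⟨hy, hlt⟩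
  exact min_eq_right
    ((ENNReal.ofReal_le_iff_le_toReal (intrinsicDist_lt_top hO hC hx hy).ne).1 h1)

lemma abs_truncDist_sub_le (hO : IsOpen Ω) (hC : IsPreconnected Ω) (hx : x ∈ Ω)
    {w : Euc n} {τ : ℝ} (hτ : ball w τ ⊆ Ω) (hy : y ∈ ball w τ) (hz : z ∈ ball w τ) :
    |truncDist Ω x ρ y - truncDist Ω x ρ z| ≤ dist y z := by
  have key : ∀ a ∈ ball w τ, ∀ b ∈ ball w τ,
      (intrinsicDist Ω x b).toReal ≤ (intrinsicDist Ω x a).toReal + dist a b := by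
    intro a ha b hb
    have hfin := (intrinsicDist_lt_top hO hC hx (hτ ha)).ne
    have h := ENNReal.toReal_mono (ENNReal.add_ne_top.2 ⟨hfin, edist_ne_top _ _⟩)
      (intrinsicDist_le_add_edist (x := x) hτ ha hb)
    rwa [ENNReal.toReal_add hfin (edist_ne_top _ _), edist_dist,
      ENNReal.toReal_ofReal dist_nonneg] at h
  refine (abs_min_sub_min_le_max _ _ _ _).trans (max_le ?_ (by simp))
  rw [abs_le]
  have h1 := key y hy z hz
  have h2 := key z hz y hy
  rw [dist_comm] at h2
  constructor <;> linarith

lemma locallyLipschitzOnSet_truncDist (hO : IsOpen Ω) (hC : IsPreconnected Ω) (hx : x ∈ Ω) :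
    LocallyLipschitzOnSet (truncDist Ω x ρ) Ω := by
  intro w hw
  obtain ⟨τ, hτ, hb⟩ := Metric.isOpen_iff.1 hO w hw
  refine ⟨1, ball w τ, mem_nhdsWithin_of_mem_nhds (ball_mem_nhds w hτ),
    LipschitzOnWith.of_dist_le_mul fun a ha b hb' => ?_⟩
  simpa [Real.dist_eq] using abs_truncDist_sub_le hO hC hx hb ha hb'

lemma norm_fderiv_truncDist_le (hO : IsOpen Ω) (hC : IsPreconnected Ω) (hx : x ∈ Ω)
    (hy : y ∈ Ω) : ‖fderiv ℝ (truncDist Ω x ρ) y‖ ≤ 1 := by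
  obtain ⟨τ, hτ, hb⟩ := Metric.isOpen_iff.1 hO y hy
  refine norm_fderiv_le_of_lip' ℝ zero_le_one ?_
  filter_upwards [ball_mem_nhds y hτ] with z hz
  rw [one_mul, ← dist_eq_norm z y, Real.norm_eq_abs]
  exact abs_truncDist_sub_le hO hC hx hb hz (mem_ball_self hτ)

lemma fderiv_truncDist_eq_zero (hO : IsOpen Ω) (hC : IsPreconnected Ω) (hx : x ∈ Ω)
    (hy : y ∈ Ω) (h : y ∉ intrinsicBall Ω x ρ) : fderiv ℝ (truncDist Ω x ρ) y = 0 := by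
  refine IsLocalMax.fderiv_eq_zero (Filter.Eventually.of_forall fun z => ?_)
  rw [truncDist_eq_of_notMem hO hC hx hy h]
  exact truncDist_le z

lemma lintegral_norm_fderiv_truncDist_le (hn : n ≠ 0) (hO : IsOpen Ω) (hC : IsPreconnected Ω)
    (hx : x ∈ Ω) {S : Set (Euc n)} (hS : S ⊆ Ω) (hSm : MeasurableSet S) :
    ∫⁻ y in S, ENNReal.ofReal ‖fderiv ℝ (truncDist Ω x ρ) y‖ ^ (n : ℝ) ∂volume
      ≤ volume (intrinsicBall Ω x ρ) := by
  have hB := (isOpen_intrinsicBall (x := x) hO ρ).measurableSet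
  calc ∫⁻ y in S, ENNReal.ofReal ‖fderiv ℝ (truncDist Ω x ρ) y‖ ^ (n : ℝ) ∂volume
      ≤ ∫⁻ y in S, (intrinsicBall Ω x ρ).indicator 1 y ∂volume := by
        refine setLIntegral_mono' hSm fun y hy => ?_
        by_cases h : y ∈ intrinsicBall Ω x ρ
        · rw [indicator_of_mem h]
          refine ENNReal.rpow_le_one ?_ n.cast_nonneg
          exact ENNReal.ofReal_le_one.2 (norm_fderiv_truncDist_le hO hC hx (hS hy))
        · rw [fderiv_truncDist_eq_zero hO hC hx (hS hy) h]
          simp [hn]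
    _ ≤ ∫⁻ y, (intrinsicBall Ω x ρ).indicator 1 y ∂volume := setLIntegral_le_lintegral _ _
    _ = volume (intrinsicBall Ω x ρ) := lintegral_indicator_one hB

lemma norm_fderiv_truncDist_eq_one [NeZero n] {τ : ℝ} (hτ : ball x τ ⊆ Ω) (hρ : τ ≤ ρ)
    (hy : y ∈ ball x τ) (hne : y ≠ x) : ‖fderiv ℝ (truncDist Ω x ρ) y‖ = 1 := by
  have heq : truncDist Ω x ρ =ᶠ[nhds y] fun z => ‖z - x‖ := by
    filter_upwards [isOpen_ball.mem_nhds hy] with z hz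
    rw [truncDist, intrinsicDist_eq_edist hτ hz, edist_dist, ENNReal.toReal_ofReal dist_nonneg,
      dist_comm, ← dist_eq_norm]
    exact min_eq_left ((mem_ball.1 hz).le.trans hρ)
  rw [heq.fderiv_eq]
  have h := norm_fderiv_norm ((contDiffAt_norm ℝ (n := 1) (sub_ne_zero.2 hne)).differentiableAt
    (by simp))
  rwa [← fderiv_comp_sub] at h

lemma lintegral_norm_fderiv_truncDist_pos [NeZero n] (hO : IsOpen Ω) (hx : x ∈ Ω)
    (hρ : 0 < ρ) {R : ℝ} (hR : 0 < R) :
    0 < ∫⁻ y in ball x R ∩ Ω,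
      ENNReal.ofReal ‖fderiv ℝ (truncDist Ω x ρ) y‖ ^ (n : ℝ) ∂volume := by
  obtain ⟨τ₀, hτ₀, hb⟩ := Metric.isOpen_iff.1 hO x hx
  set τ := min τ₀ (min ρ R) with hτ
  have hτpos : 0 < τ := lt_min hτ₀ (lt_min hρ hR)
  have hbτ : ball x τ ⊆ Ω := (ball_subset_ball (min_le_left _ _)).trans hb
  have hτρ : τ ≤ ρ := (min_le_right _ _).trans (min_le_left _ _)
  have hτR : τ ≤ R := (min_le_right _ _).trans (min_le_right _ _)
  calc 0 < volume (ball x τ \ {x}) := by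
        rw [measure_sdiff_null (measure_singleton x)]
        exact measure_ball_pos _ _ hτpos
    _ = ∫⁻ y in ball x τ \ {x}, 1 ∂volume := by simp
    _ ≤ ∫⁻ y in ball x τ \ {x},
          ENNReal.ofReal ‖fderiv ℝ (truncDist Ω x ρ) y‖ ^ (n : ℝ) ∂volume := by
        refine setLIntegral_mono' (isOpen_ball.sdiff isClosed_singleton).measurableSet
          fun y hy => ?_
        rw [norm_fderiv_truncDist_eq_one hbτ hτρ hy.1 hy.2]
        simp
    _ ≤ ∫⁻ y in ball x R ∩ Ω,
          ENNReal.ofReal ‖fderiv ℝ (truncDist Ω x ρ) y‖ ^ (n : ℝ) ∂volume :=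
        lintegral_mono_set fun y hy => ⟨ball_subset_ball hτR hy.1, hbτ hy.1⟩

end TruncatedDistance

section Trudinger

/-- The local Trudinger inequality on `Ω` with fixed constants. -/
def TrudingerWith (n : ℕ) (Ω : Set (Euc n)) (C lam A : ℝ) : Prop :=
  ∀ u : Euc n → ℝ, LocallyLipschitzOnSet u Ω →
    ∀ x ∈ Ω, ∀ r : ℝ, 0 < r → r < diam Ω →
      0 < (∫⁻ y in ball x (lam * r) ∩ Ω,
            ENNReal.ofReal ‖fderiv ℝ u y‖ ^ (n : ℝ) ∂volume) →
      (∫⁻ y in ball x (lam * r) ∩ Ω,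
            ENNReal.ofReal ‖fderiv ℝ u y‖ ^ (n : ℝ) ∂volume) < ⊤ →
      (⨅ c : ℝ, ∫⁻ y in ball x r ∩ Ω,
          ENNReal.ofReal (Real.exp ((A * |u y - c| /
            (∫⁻ z in ball x (lam * r) ∩ Ω,
              ENNReal.ofReal ‖fderiv ℝ u z‖ ^ (n : ℝ) ∂volume).toReal
                ^ ((1 : ℝ) / (n : ℝ))) ^ ((n : ℝ) / ((n : ℝ) - 1)))) ∂volume)
        ≤ ENNReal.ofReal C * volume (ball x r)

lemma pow_div_factorial_le_exp_rpow {z p : ℝ} (hz : 0 ≤ z) (hp : 1 ≤ p) (k : ℕ) :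
    z ^ k / (k.factorial : ℝ) ≤ Real.exp (z ^ p) := by
  rcases le_total z 1 with h | h
  · have h1 : z ^ k / (k.factorial : ℝ) ≤ 1 :=
      div_le_one_of_le₀ ((pow_le_one₀ hz h).trans (by exact_mod_cast k.factorial_pos))
        (by positivity)
    exact h1.trans (Real.one_le_exp (by positivity))
  · exact (Real.pow_div_factorial_le_exp z hz k).trans
      (Real.exp_le_exp.2 (Real.self_le_rpow_of_one_le h hp))

lemma volume_ball_eq {n : ℕ} (x : Euc n) {R : ℝ} (hR : 0 < R) :
    volume (ball x R) = ENNReal.ofReal (volume.real (ball (0 : Euc n) 1) * R ^ n) := by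
  rw [Measure.addHaar_ball_of_pos _ _ hR, mul_comm, ENNReal.ofReal_mul measureReal_nonneg,
    ofReal_measureReal measure_ball_lt_top.ne, finrank_euclideanSpace_fin]

variable {n : ℕ} {Ω : Set (Euc n)} {x : Euc n} {C lam A : ℝ}

lemma TrudingerWith.gap_le (h : TrudingerWith n Ω C lam A) (hn : 2 ≤ n) (hO : IsOpen Ω)
    (hconn : IsPreconnected Ω) (hC : 1 ≤ C) (hlam : 1 ≤ lam) (hA : 0 < A) (hx : x ∈ Ω)
    {σ ρ₁ ρ₂ R t : ℝ} (hσ : 0 < σ) (hρ₁ : 0 < ρ₁) (hρ : ρ₁ ≤ ρ₂)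
    (hvol : volume (intrinsicBall Ω x ρ₂) ≤ ENNReal.ofReal (σ ^ n))
    (hR : 0 < R) (hRd : R < diam Ω) (ht : 0 ≤ t)
    (h₁ : ENNReal.ofReal t ≤ volume (ball x R ∩ intrinsicBall Ω x ρ₁))
    (h₂ : ENNReal.ofReal t ≤ volume (ball x R ∩ (Ω \ intrinsicBall Ω x ρ₂))) :
    t * ((A * (ρ₂ - ρ₁) / (2 * σ)) ^ (n + 1) / ((n + 1).factorial : ℝ))
      ≤ C * (volume.real (ball (0 : Euc n) 1) * R ^ n) := by
  have : NeZero n := ⟨by omega⟩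
  have hn1 : (1 : ℝ) < n := by exact_mod_cast hn
  have hp : 1 ≤ (n : ℝ) / ((n : ℝ) - 1) := by
    rw [le_div_iff₀ (by linarith)]
    linarith
  set u := truncDist Ω x ρ₂ with hu
  set p := (n : ℝ) / ((n : ℝ) - 1) with hpdef
  have hI0 := lintegral_norm_fderiv_truncDist_pos (ρ := ρ₂) hO hx (hρ₁.trans_le hρ)
    (R := lam * R) (by positivity)
  have hI1 := (lintegral_norm_fderiv_truncDist_le (ρ := ρ₂) (by omega : n ≠ 0) hO hconn hx
    (S := ball x (lam * R) ∩ Ω) inter_subset_right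
    (isOpen_ball.inter hO).measurableSet).trans hvol
  have hT := h u (locallyLipschitzOnSet_truncDist hO hconn hx) x hx R hR hRd hI0
    (hI1.trans_lt ENNReal.ofReal_lt_top)
  rw [← hu] at hI0 hI1
  set I := ∫⁻ y in ball x (lam * R) ∩ Ω,
    ENNReal.ofReal ‖fderiv ℝ u y‖ ^ (n : ℝ) ∂volume with hI
  set N := I.toReal ^ ((1 : ℝ) / (n : ℝ)) with hN
  have hIpos : 0 < I.toReal :=
    ENNReal.toReal_pos hI0.ne' (hI1.trans_lt ENNReal.ofReal_lt_top).ne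
  have hNpos : 0 < N := Real.rpow_pos_of_pos hIpos _
  have hNσ : N ≤ σ := by
    have h3 : I.toReal ≤ σ ^ n := ENNReal.toReal_le_of_le_ofReal (by positivity) hI1
    calc N ≤ (σ ^ n) ^ ((1 : ℝ) / (n : ℝ)) :=
          Real.rpow_le_rpow hIpos.le h3 (by positivity)
      _ = σ := by rw [one_div, Real.pow_rpow_inv_natCast hσ.le (by omega)]
  set z := A * (ρ₂ - ρ₁) / (2 * σ) with hz
  have hz0 : 0 ≤ z := div_nonneg (mul_nonneg hA.le (sub_nonneg.2 hρ)) (by positivity)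
  have lower : ∀ (c : ℝ) (S : Set (Euc n)), MeasurableSet S → S ⊆ ball x R ∩ Ω →
      ENNReal.ofReal t ≤ volume S → (∀ y ∈ S, (ρ₂ - ρ₁) / 2 ≤ |u y - c|) →
      ENNReal.ofReal (t * Real.exp (z ^ p)) ≤ ∫⁻ y in ball x R ∩ Ω,
        ENNReal.ofReal (Real.exp ((A * |u y - c| / N) ^ p)) ∂volume := by
    intro c S hSm hS hSt hSu
    calc ENNReal.ofReal (t * Real.exp (z ^ p))
        = ENNReal.ofReal (Real.exp (z ^ p)) * ENNReal.ofReal t := by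
          rw [mul_comm, ENNReal.ofReal_mul (Real.exp_pos _).le]
      _ ≤ ENNReal.ofReal (Real.exp (z ^ p)) * volume S := by gcongr
      _ = ∫⁻ y in S, ENNReal.ofReal (Real.exp (z ^ p)) ∂volume := by
          rw [setLIntegral_const]
      _ ≤ ∫⁻ y in S, ENNReal.ofReal (Real.exp ((A * |u y - c| / N) ^ p)) ∂volume := by
          refine setLIntegral_mono' hSm fun y hy => ENNReal.ofReal_le_ofReal
            (Real.exp_le_exp.2 (Real.rpow_le_rpow hz0 ?_ (by linarith)))
          calc z = A * ((ρ₂ - ρ₁) / 2) / σ := by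
                rw [hz]
                field_simp
            _ ≤ A * |u y - c| / N := by
                have := hSu y hy
                gcongr
      _ ≤ _ := lintegral_mono_set hS
  have hB := fun r => (isOpen_intrinsicBall (x := x) hO r).measurableSet
  have hbound : ENNReal.ofReal (t * Real.exp (z ^ p))
      ≤ ENNReal.ofReal (C * (volume.real (ball (0 : Euc n) 1) * R ^ n)) := by
    rw [ENNReal.ofReal_mul (p := C) (by linarith), ← volume_ball_eq x hR]
    refine le_trans (le_iInf fun c => ?_) hT
    rcases le_total ((ρ₁ + ρ₂) / 2) c with hc | hc
    · refine lower c _ (measurableSet_ball.inter (hB ρ₁))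
        (inter_subset_inter_right _ (intrinsicBall_subset _)) h₁ fun y hy => ?_
      have h4 : u y < ρ₁ := truncDist_lt_of_mem hy.2
      rw [abs_sub_comm]
      exact le_trans (by linarith) (le_abs_self _)
    · refine lower c _ (measurableSet_ball.inter (hO.measurableSet.diff (hB ρ₂)))
        (inter_subset_inter_right _ sdiff_subset) h₂ fun y hy => ?_
      have h4 : u y = ρ₂ := truncDist_eq_of_notMem hO hconn hx hy.2.1 hy.2.2
      rw [h4]
      exact le_trans (by linarith) (le_abs_self _)
  have hfin := (ENNReal.ofReal_le_ofReal_iff (by positivity)).1 hbound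
  exact (mul_le_mul_of_nonneg_left (pow_div_factorial_le_exp_rpow hz0 hp _) ht).trans hfin

lemma diam_pos_of_isOpen (hn : n ≠ 0) (hO : IsOpen Ω) (hb : Bornology.IsBounded Ω)
    (hx : x ∈ Ω) : 0 < diam Ω := by
  have : NeZero n := ⟨hn⟩
  obtain ⟨τ, hτ, hball⟩ := Metric.isOpen_iff.1 hO x hx
  obtain ⟨v, hv⟩ := exists_norm_eq (Euc n) (half_pos hτ).le
  have hmem : x + v ∈ Ω := hball (by simp [hv, hτ])
  have h := dist_le_diam_of_mem hb hmem hx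
  simp only [dist_eq_norm, add_sub_cancel_left, hv] at h
  linarith

lemma subset_ball_diam (hn : n ≠ 0) (hO : IsOpen Ω) (hb : Bornology.IsBounded Ω)
    (hx : x ∈ Ω) : Ω ⊆ ball x (diam Ω) := by
  intro y hy
  have hD := diam_pos_of_isOpen hn hO hb hx
  rcases (dist_le_diam_of_mem hb hy hx).lt_or_eq with h | h
  · exact h
  obtain ⟨τ, hτ, hball⟩ := Metric.isOpen_iff.1 hO y hy
  set D := diam Ω
  have hnorm : ‖y - x‖ = D := by rw [← dist_eq_norm, h]
  set ε := τ / (2 * D) with hε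
  have hεpos : 0 < ε := by positivity
  have hmem : y + ε • (y - x) ∈ Ω := by
    refine hball ?_
    rw [mem_ball, dist_eq_norm, add_sub_cancel_left, norm_smul, hnorm, Real.norm_of_nonneg hεpos.le]
    have : ε * D = τ / 2 := by
      rw [hε]
      field_simp
    linarith
  have h2 := dist_le_diam_of_mem hb hmem hx
  have h3 : y + ε • (y - x) - x = (1 + ε) • (y - x) := by
    rw [add_smul, one_smul]
    abel
  rw [dist_eq_norm, h3, norm_smul, hnorm, Real.norm_of_nonneg (by positivity)] at h2
  nlinarith

/-- Some ball with radius less than `diam Ω` still captures a given amount of mass. -/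
lemma exists_radius_lt_diam (hn : n ≠ 0) (hO : IsOpen Ω) (hb : Bornology.IsBounded Ω)
    (hx : x ∈ Ω) {E : Set (Euc n)} (hE : E ⊆ Ω) {m : ℝ≥0∞} (hm : m < volume E) :
    ∃ R < diam Ω, ∀ R', R ≤ R' → m < volume (ball x R' ∩ E) := by
  set s : ℕ → Set (Euc n) := fun k => ball x (diam Ω - 1 / ((k : ℝ) + 1)) ∩ E with hs
  have hmono : Monotone s := by
    intro j k hjk
    refine inter_subset_inter_left _ (ball_subset_ball (sub_le_sub_left ?_ _))
    exact one_div_le_one_div_of_le (by positivity) (by exact_mod_cast Nat.succ_le_succ hjk)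
  have hU : ⋃ k, s k = E := by
    refine subset_antisymm (iUnion_subset fun k => inter_subset_right) fun y hy => ?_
    have hd : 0 < diam Ω - dist y x := sub_pos.2 (subset_ball_diam hn hO hb hx (hE hy))
    obtain ⟨k, hk⟩ := exists_nat_one_div_lt hd
    exact mem_iUnion.2 ⟨k, by rw [mem_ball]; linarith, hy⟩
  have hlim := tendsto_measure_iUnion_atTop (μ := volume) hmono
  rw [hU] at hlim
  obtain ⟨k, hk⟩ := (hlim.eventually (lt_mem_nhds hm)).exists
  refine ⟨diam Ω - 1 / ((k : ℝ) + 1), sub_lt_self _ (by positivity), fun R' hR' => ?_⟩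
  exact hk.trans_le (measure_mono (inter_subset_inter_left _ (ball_subset_ball hR')))

/-- The estimate of `TrudingerWith.gap_le` without the restriction `R < diam Ω`. -/
lemma TrudingerWith.gap_le' (h : TrudingerWith n Ω C lam A) (hn : 2 ≤ n) (hO : IsOpen Ω)
    (hconn : IsPreconnected Ω) (hb : Bornology.IsBounded Ω) (hC : 1 ≤ C) (hlam : 1 ≤ lam)
    (hA : 0 < A) (hx : x ∈ Ω) {σ ρ₁ ρ₂ R t : ℝ} (hσ : 0 < σ) (hρ₁ : 0 < ρ₁) (hρ : ρ₁ ≤ ρ₂)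
    (hvol : volume (intrinsicBall Ω x ρ₂) ≤ ENNReal.ofReal (σ ^ n)) (hR : 0 < R) (ht : 0 ≤ t)
    (h₁ : ENNReal.ofReal t < volume (ball x R ∩ intrinsicBall Ω x ρ₁))
    (h₂ : ENNReal.ofReal t < volume (ball x R ∩ (Ω \ intrinsicBall Ω x ρ₂))) :
    t * ((A * (ρ₂ - ρ₁) / (2 * σ)) ^ (n + 1) / ((n + 1).factorial : ℝ))
      ≤ C * (volume.real (ball (0 : Euc n) 1) * R ^ n) := by
  rcases lt_or_ge R (diam Ω) with hRd | hRd
  · exact h.gap_le hn hO hconn hC hlam hA hx hσ hρ₁ hρ hvol hR hRd ht h₁.le h₂.le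
  · have hn0 : n ≠ 0 := by omega
    obtain ⟨R₁, hR₁, k₁⟩ := exists_radius_lt_diam hn0 hO hb hx
      (intrinsicBall_subset ρ₁) (h₁.trans_le (measure_mono inter_subset_right))
    obtain ⟨R₂, hR₂, k₂⟩ := exists_radius_lt_diam hn0 hO hb hx
      (sdiff_subset (t := intrinsicBall Ω x ρ₂)) (h₂.trans_le (measure_mono inter_subset_right))
    have hD := diam_pos_of_isOpen hn0 hO hb hx
    set R' := max (diam Ω / 2) (max R₁ R₂) with hR'
    have hR'0 : 0 < R' := lt_max_of_lt_left (half_pos hD)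
    have hR'D : R' < diam Ω := max_lt (half_lt_self hD) (max_lt hR₁ hR₂)
    refine (h.gap_le hn hO hconn hC hlam hA hx hσ hρ₁ hρ hvol hR'0 hR'D ht
      (k₁ R' ((le_max_left _ _).trans (le_max_right _ _))).le
      (k₂ R' ((le_max_right _ _).trans (le_max_right _ _))).le).trans ?_
    have : R' ≤ R := hR'D.le.trans hRd
    have : 0 ≤ volume.real (ball (0 : Euc n) 1) := measureReal_nonneg
    gcongr

end Trudinger

section Growth

/-- Intrinsic balls around `x` of measure at most `σ ^ n ≤ s` have radius at most `M * σ`. -/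
def RadiusBound {n : ℕ} (Ω : Set (Euc n)) (x : Euc n) (s M : ℝ) : Prop :=
  ∀ σ : ℝ, 0 < σ → σ ^ n ≤ s → ∀ r : ℝ, 0 < r →
    volume (intrinsicBall Ω x r) ≤ ENNReal.ofReal (σ ^ n) → r ≤ M * σ

variable {n : ℕ} {Ω : Set (Euc n)} {x : Euc n} {s M : ℝ}

lemma RadiusBound.mono {M' : ℝ} (h : RadiusBound Ω x s M) (hM : M ≤ M') :
    RadiusBound Ω x s M' := fun σ hσ hs r hr hv =>
  (h σ hσ hs r hr hv).trans (mul_le_mul_of_nonneg_right hM hσ.le)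

lemma exists_radiusBound (hn : n ≠ 0) (hO : IsOpen Ω) (hconn : IsPreconnected Ω) (hx : x ∈ Ω)
    (hs : ENNReal.ofReal s < volume Ω) : ∃ M, RadiusBound Ω x s M := by
  have hmono : Monotone fun k : ℕ => intrinsicBall Ω x (k : ℝ) := fun j k hjk =>
    intrinsicBall_mono (by exact_mod_cast hjk)
  have hU : ⋃ k : ℕ, intrinsicBall Ω x (k : ℝ) = Ω := by
    refine subset_antisymm (iUnion_subset fun k => intrinsicBall_subset _) fun y hy => ?_
    obtain ⟨k, hk⟩ := ENNReal.exists_nat_gt (intrinsicDist_lt_top hO hconn hx hy).ne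
    exact mem_iUnion.2 ⟨k, hy, by simpa using hk⟩
  have hlim := tendsto_measure_iUnion_atTop (μ := volume) hmono
  rw [hU] at hlim
  obtain ⟨k, hk⟩ := (hlim.eventually (lt_mem_nhds hs)).exists
  replace hk : ENNReal.ofReal s < volume (intrinsicBall Ω x (k : ℝ)) := hk
  set r₁ : ℝ := (k : ℝ) with hr₁
  have hr₁pos : 0 < r₁ := by
    by_contra hle
    have hempty : intrinsicBall Ω x r₁ = ∅ := by
      refine eq_empty_of_forall_notMem fun y hy => ?_
      have := hy.2
      simp [ENNReal.ofReal_of_nonpos (not_lt.1 hle)] at this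
    simp [hempty] at hk
  obtain ⟨τ₀, hτ₀, hball⟩ := Metric.isOpen_iff.1 hO x hx
  set τ := min τ₀ r₁ with hτ
  have hτpos : 0 < τ := lt_min hτ₀ hr₁pos
  set ω := volume.real (ball (0 : Euc n) 1) with hω
  have hωpos : 0 < ω := ENNReal.toReal_pos (measure_ball_pos _ _ one_pos).ne'
    measure_ball_lt_top.ne
  set c := min 1 ω with hc
  have hcpos : 0 < c := lt_min one_pos hωpos
  refine ⟨r₁ / (τ * c), fun σ hσ hσs r hr hv => ?_⟩
  have hrlt : r < r₁ := by
    by_contra hle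
    exact absurd ((measure_mono (intrinsicBall_mono (not_lt.1 hle))).trans
      (hv.trans (ENNReal.ofReal_le_ofReal hσs))) (not_le.2 hk)
  set q := r * τ / r₁ with hq
  have hqpos : 0 < q := by positivity
  have hqτ : q ≤ τ := by
    rw [hq, div_le_iff₀ hr₁pos]
    nlinarith
  have hqr : q ≤ r := by
    rw [hq, div_le_iff₀ hr₁pos]
    exact mul_le_mul_of_nonneg_left (min_le_right _ _) hr.le
  have hsub : ball x q ⊆ intrinsicBall Ω x r :=
    (ball_subset_intrinsicBall ((ball_subset_ball (hqτ.trans (min_le_left _ _))).trans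
      hball)).trans (intrinsicBall_mono hqr)
  have hle := (measure_mono hsub).trans hv
  rw [volume_ball_eq x hqpos, ENNReal.ofReal_le_ofReal_iff (by positivity)] at hle
  have hcq : (c * q) ^ n ≤ σ ^ n := by
    rw [mul_pow]
    refine le_trans ?_ hle
    gcongr
    exact (pow_le_of_le_one hcpos.le (min_le_left _ _) hn).trans (min_le_right _ _)
  have hfin : c * q ≤ σ := le_of_pow_le_pow_left₀ hn hσ.le hcq
  rw [hq] at hfin
  rw [div_mul_eq_mul_div, le_div_iff₀ (by positivity)]
  rw [← mul_div_assoc, div_le_iff₀ hr₁pos] at hfin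
  linarith

lemma RadiusBound.improve {C lam A : ℝ} (h : TrudingerWith n Ω C lam A) (hn : 2 ≤ n)
    (hO : IsOpen Ω) (hconn : IsPreconnected Ω) (hb : Bornology.IsBounded Ω) (hC : 1 ≤ C)
    (hlam : 1 ≤ lam) (hA : 0 < A) (hx : x ∈ Ω) (hs : 0 < s)
    (hsΩ : ENNReal.ofReal (2 * s) < volume Ω) (hM : 1 ≤ M)
    (hM₁ : C * volume.real (ball (0 : Euc n) 1) * ((n + 1).factorial : ℝ) * 8 ^ n
      < (A / 16) ^ (n + 1) * M)
    (hM₂ : C * volume.real (ball (0 : Euc n) 1) * ((n + 1).factorial : ℝ) * (4 * diam Ω) ^ n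
      < (A / 16) ^ (n + 1) * M * s)
    (hbd : RadiusBound Ω x s M) : RadiusBound Ω x s (3 / 4 * M) := by
  intro σ hσ hσs r hr hv
  by_contra! hlt
  have hn0 : n ≠ 0 := by omega
  set ω := volume.real (ball (0 : Euc n) 1) with hω
  have hω0 : 0 ≤ ω := measureReal_nonneg
  have hMσ : 0 < M * σ := by positivity
  set ρ := 5 / 8 * (M * σ) with hρ
  have hρpos : 0 < ρ := by positivity
  have hσn : 0 < σ ^ n := by positivity
  have hhalf : (σ / 2) ^ n ≤ σ ^ n / 4 := by
    rw [div_pow]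
    have h4 : (4 : ℝ) ≤ 2 ^ n := by
      calc (4 : ℝ) = 2 ^ 2 := by norm_num
        _ ≤ 2 ^ n := pow_le_pow_right₀ (by norm_num) hn
    gcongr
  have hρvol : ENNReal.ofReal ((σ / 2) ^ n) < volume (intrinsicBall Ω x ρ) := by
    by_contra! hle
    have := hbd (σ / 2) (by positivity) (by linarith) ρ hρpos hle
    linarith
  have gap : ∀ R : ℝ, 0 < R → intrinsicBall Ω x ρ ⊆ ball x R →
      ENNReal.ofReal ((σ / 2) ^ n) < volume (ball x R ∩ (Ω \ intrinsicBall Ω x r)) →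
      (σ / 2) ^ n * ((A / 16) ^ (n + 1) * M ^ (n + 1))
        ≤ C * ω * ((n + 1).factorial : ℝ) * R ^ n := by
    intro R hR hsub hout
    have hg := h.gap_le' hn hO hconn hb hC hlam hA hx hσ hρpos (by linarith) hv hR
      (by positivity) (by rwa [inter_eq_right.2 hsub]) hout
    rw [← mul_div_assoc, div_le_iff₀ (by positivity)] at hg
    refine le_trans ?_ (hg.trans (by linarith))
    rw [← mul_pow]
    gcongr
    rw [le_div_iff₀ (by positivity)]
    nlinarith
  have outer : ∀ (E : Set (Euc n)) (R : ℝ), E ⊆ Ω → E ⊆ ball x R →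
      ENNReal.ofReal ((σ / 2) ^ n + σ ^ n) < volume E →
      ENNReal.ofReal ((σ / 2) ^ n) < volume (ball x R ∩ (Ω \ intrinsicBall Ω x r)) := by
    intro E R hEΩ hER hE
    calc ENNReal.ofReal ((σ / 2) ^ n)
        < volume E - volume (intrinsicBall Ω x r) := by
          rw [lt_tsub_iff_right]
          refine lt_of_le_of_lt ?_ hE
          rw [ENNReal.ofReal_add (by positivity) hσn.le]
          gcongr
      _ ≤ volume (E \ intrinsicBall Ω x r) := le_measure_sdiff
      _ ≤ volume (ball x R ∩ (Ω \ intrinsicBall Ω x r)) :=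
        measure_mono fun y hy => ⟨hER hy.1, hEΩ hy.1, hy.2⟩
  rcases le_or_gt ((2 * σ) ^ n) s with h2 | h2
  · have hvolR : ENNReal.ofReal ((2 * σ) ^ n) < volume (intrinsicBall Ω x (4 * M * σ)) := by
      by_contra! hle
      have := hbd (2 * σ) (by positivity) h2 (4 * M * σ) (by positivity) hle
      linarith
    have hbig : 4 * σ ^ n ≤ (2 * σ) ^ n := by
      rw [mul_pow]
      gcongr
      calc (4 : ℝ) = 2 ^ 2 := by norm_num
        _ ≤ 2 ^ n := pow_le_pow_right₀ (by norm_num) hn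
    have hg := gap (4 * M * σ) (by positivity)
      ((intrinsicBall_subset_ball ρ).trans (ball_subset_ball (by linarith)))
      (outer _ _ (intrinsicBall_subset _) (intrinsicBall_subset_ball _)
        ((ENNReal.ofReal_le_ofReal (by linarith)).trans_lt hvolR))
    have hk : 0 < (σ / 2) ^ n * M ^ n := by positivity
    have e1 : (σ / 2) ^ n * ((A / 16) ^ (n + 1) * M ^ (n + 1))
        = (A / 16) ^ (n + 1) * M * ((σ / 2) ^ n * M ^ n) := by ring
    have e2 : (4 * M * σ) ^ n = 8 ^ n * ((σ / 2) ^ n * M ^ n) := by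
      rw [← mul_pow, ← mul_pow]
      congr 1
      ring
    rw [e1, e2, ← mul_assoc (C * ω * ((n + 1).factorial : ℝ))] at hg
    exact absurd (le_of_mul_le_mul_right hg hk) (not_le.2 hM₁)
  · have hD := diam_pos_of_isOpen hn0 hO hb hx
    have hΩ := subset_ball_diam hn0 hO hb hx
    have hg := gap (diam Ω) hD ((intrinsicBall_subset ρ).trans hΩ)
      (outer Ω _ subset_rfl hΩ
        ((ENNReal.ofReal_le_ofReal (by linarith)).trans_lt hsΩ))
    have hpow : M ≤ M ^ (n + 1) := le_self_pow₀ hM (by omega)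
    have e1 : (2 * σ) ^ n = 4 ^ n * (σ / 2) ^ n := by
      rw [← mul_pow]
      congr 1
      ring
    have : (A / 16) ^ (n + 1) * M * s
        ≤ C * ω * ((n + 1).factorial : ℝ) * (4 * diam Ω) ^ n := by
      calc (A / 16) ^ (n + 1) * M * s
          ≤ (A / 16) ^ (n + 1) * M ^ (n + 1) * (4 ^ n * (σ / 2) ^ n) := by
            rw [← e1]
            gcongr
        _ = 4 ^ n * ((σ / 2) ^ n * ((A / 16) ^ (n + 1) * M ^ (n + 1))) := by ring
        _ ≤ 4 ^ n * (C * ω * ((n + 1).factorial : ℝ) * diam Ω ^ n) := by gcongr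
        _ = _ := by
            rw [mul_pow]
            ring
    exact absurd this (not_le.2 hM₂)

/-- A property passing to larger numbers and self-improving above `M₁` holds at `M₁`. -/
lemma of_self_improving {P : ℝ → Prop} (hmono : ∀ a b, a ≤ b → P a → P b) {M₀ M₁ : ℝ}
    (hM₁ : 0 < M₁) (h₀ : P M₀) (himp : ∀ M, M₁ ≤ M → P M → P (3 / 4 * M)) : P M₁ := by
  have key : ∀ k : ℕ, P ((4 / 3) ^ k * M₁) → P M₁ := by
    intro k
    induction k with
    | zero => simp
    | succ k ih =>
      intro hk
      refine ih ?_
      have h1 : M₁ ≤ (4 / 3) ^ (k + 1) * M₁ :=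
        le_mul_of_one_le_left hM₁.le (one_le_pow₀ (by norm_num))
      have h2 := himp _ h1 hk
      rwa [pow_succ, show (3 / 4 : ℝ) * ((4 / 3) ^ k * (4 / 3) * M₁) = (4 / 3) ^ k * M₁ by ring]
        at h2
  obtain ⟨k, hk⟩ := pow_unbounded_of_one_lt (M₀ / M₁) (by norm_num : (1 : ℝ) < 4 / 3)
  exact key k (hmono _ _ ((div_lt_iff₀ hM₁).1 hk).le h₀)

end Growth

/-- a bounded local Sobolev–Poincaré imbedding domain of order
`n` is intrinsic Ahlfors `n`-regular. -/
theorem stmt11 (n : ℕ) (hn : 2 ≤ n)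
    (Ω : Set (Euc n)) (hOpen : IsOpen Ω)
    (hConn : IsConnected Ω) (hBdd : Bornology.IsBounded Ω)
    (hSP : LocalSPn n Ω) :
    IntrinsicAhlforsRegular Ω := by
  obtain ⟨C, hC, lam, hlam, A, hA, h⟩ := hSP
  have hT : TrudingerWith n Ω C lam A := h
  have hn0 : n ≠ 0 := by omega
  have hΩtop : volume Ω < ⊤ := hBdd.measure_lt_top
  have hΩpos : 0 < volume.real Ω :=
    ENNReal.toReal_pos (hOpen.measure_pos volume hConn.nonempty).ne' hΩtop.ne
  set s := volume.real Ω / 4 with hs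
  have hspos : 0 < s := by positivity
  have hsΩ : ∀ a < 4 * s, ENNReal.ofReal a < volume Ω := by
    intro a ha
    rw [← ofReal_measureReal hΩtop.ne, ENNReal.ofReal_lt_ofReal_iff hΩpos]
    linarith
  set ω := volume.real (ball (0 : Euc n) 1) with hω
  have hωpos : 0 < ω := ENNReal.toReal_pos (measure_ball_pos _ _ one_pos).ne'
    measure_ball_lt_top.ne
  set G := C * ω * ((n + 1).factorial : ℝ) with hG
  have hGpos : 0 < G := by positivity
  have ha : 0 < (A / 16) ^ (n + 1) := by positivity
  set M₁ := 1 + G * 8 ^ n / (A / 16) ^ (n + 1)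
    + G * (4 * diam Ω) ^ n / ((A / 16) ^ (n + 1) * s) with hM₁
  have hD : 0 ≤ diam Ω := diam_nonneg
  have t1 : 0 ≤ G * 8 ^ n / (A / 16) ^ (n + 1) := by positivity
  have t2 : 0 ≤ G * (4 * diam Ω) ^ n / ((A / 16) ^ (n + 1) * s) := by positivity
  have hM₁one : 1 ≤ M₁ := by linarith
  have hM₁pos : 0 < M₁ := by linarith
  have bound : ∀ x ∈ Ω, RadiusBound Ω x s M₁ := by
    intro x hx
    obtain ⟨M₀, hM₀⟩ := exists_radiusBound hn0 hOpen hConn.isPreconnected hx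
      (hsΩ s (by linarith))
    refine of_self_improving (fun a b hab ha => ha.mono hab) hM₁pos hM₀ fun M hM hP => ?_
    refine hP.improve hT hn hOpen hConn.isPreconnected hBdd hC hlam hA hx hspos
      (hsΩ _ (by linarith)) (hM₁one.trans hM) ?_ ?_
    · rw [mul_comm _ M, ← div_lt_iff₀ ha]
      linarith
    · rw [mul_right_comm ((A / 16) ^ (n + 1)) M s, mul_comm _ M, ← div_lt_iff₀ (by positivity)]
      linarith
  refine ⟨1 / (ω * M₁ ^ n + 1), by positivity, ?_, min 1 (s / ω), by positivity, ?_⟩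
  · rw [div_lt_one (by positivity)]
    have : 0 < ω * M₁ ^ n := by positivity
    linarith
  intro x hx r hr hrr
  have hvr : volume (intrinsicBall Ω x r) < ⊤ :=
    (measure_mono (intrinsicBall_subset r)).trans_lt hΩtop
  set v := volume.real (intrinsicBall Ω x r) with hv
  have hve : volume (intrinsicBall Ω x r) = ENNReal.ofReal v :=
    (ofReal_measureReal hvr.ne).symm
  have hvpos : 0 < v := by
    refine ENNReal.toReal_pos ((isOpen_intrinsicBall hOpen r).measure_pos volume ?_).ne' hvr.ne
    refine ⟨x, hx, (intrinsicDist_le_edist (by simpa using hx)).trans_lt ?_⟩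
    simpa using hr
  have hvs : v ≤ s := by
    have h1 : v ≤ ω * r ^ n := by
      have := measure_mono (μ := volume) (intrinsicBall_subset_ball (Ω := Ω) (x := x) r)
      rwa [hve, volume_ball_eq x hr, ENNReal.ofReal_le_ofReal_iff (by positivity)] at this
    have h2 : r ^ n ≤ r := pow_le_of_le_one hr.le (hrr.le.trans (min_le_left _ _)) hn0
    have h3 : r ≤ s / ω := hrr.le.trans (min_le_right _ _)
    rw [le_div_iff₀ hωpos] at h3
    nlinarith
  have hroot : (v ^ ((n : ℝ)⁻¹)) ^ n = v := Real.rpow_inv_natCast_pow hvpos.le hn0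
  have hle := bound x hx (v ^ ((n : ℝ)⁻¹)) (by positivity) (hroot.le.trans hvs) r hr
    (by rw [hroot, hve])
  have hpow : r ^ n ≤ M₁ ^ n * v := by
    calc r ^ n ≤ (M₁ * v ^ ((n : ℝ)⁻¹)) ^ n := by gcongr
      _ = M₁ ^ n * v := by rw [mul_pow, hroot]
  rw [volume_ball_eq x hr, hve, ← ENNReal.ofReal_mul (by positivity)]
  refine ENNReal.ofReal_le_ofReal ?_
  rw [one_div, inv_mul_le_iff₀ (by positivity)]
  nlinarith
end
end
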